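/- The k-linear map A ⊕ B^q → C given by ([a],[b_1],…,[b_q]) ↦ [a + Σ_{i=1}^q b_i T^i] (for a, b_i ∈ R) is well-defined and bijective. Consequently: C is Artinian; HF(m, C) = HF(m, A) + Σ_{i=1}^q HF(m−i, B) for all m ≥ 0; HF(C) equals the Hilbert function of a general Artinian reduction of k[D_σ]; and in particular C_i = 0 for i ≥ d+1 and C_d is 1-dimensional. -/

import Mathlib

open MvPolynomial

set_option synthInstance.maxHeartbeats 1000000
set_option maxHeartbeats 1000000

noncomputable section

namespace SRWLP

variable (k : Type) [Field k]

/-- An (abstract) simplicial complex on the vertex set `Fin n`: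
a collection of finite subsets (faces) closed under passing to subsets. -/
structure SC (n : ℕ) where
  faces : Finset (Finset (Fin n))
  down_closed : ∀ s ∈ faces, ∀ t ⊆ s, t ∈ faces

variable {n : ℕ}

/-- `dimP D = dim D + 1`, i.e. the maximal cardinality of a face of `D`. -/
def dimP (D : SC n) : ℕ := D.faces.sup Finset.card

/-- The Stanley–Reisner ideal of `D`: the ideal generated by the squarefree
monomials corresponding to non-faces. -/
def srIdeal (D : SC n) : Ideal (MvPolynomial (Fin n) k) :=
  Ideal.span { p | ∃ s : Finset (Fin n), s ∉ D.faces ∧ p = ∏ i ∈ s, X i }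

/-- `x_σ`, the product of the variables indexed by the face `σ`. -/
def xFace (σ : Finset (Fin n)) : MvPolynomial (Fin n) k := ∏ i ∈ σ, X i

variable {ι : Type} [Fintype ι]

/-- The degree-`m` graded component of the standard graded algebra
`k[Xᵢ : i ∈ ι] ⧸ J`, as a `k`-submodule. -/
def qComp (J : Ideal (MvPolynomial ι k)) (m : ℕ) :
    Submodule k (MvPolynomial ι k ⧸ J) :=
  (homogeneousSubmodule ι k m).map (Ideal.Quotient.mkₐ k J).toLinearMap

/-- Graded components indexed by `ℤ` (zero in negative degrees). -/
def qCompZ (J : Ideal (MvPolynomial ι k)) (m : ℤ) :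
    Submodule k (MvPolynomial ι k ⧸ J) :=
  if 0 ≤ m then qComp k J m.toNat else ⊥

/-- The Hilbert function of `k[Xᵢ] ⧸ J`. -/
def HFq (J : Ideal (MvPolynomial ι k)) (m : ℕ) : ℕ := Module.finrank k (qComp k J m)

/-- The Hilbert function, with `ℤ` argument. -/
def HFZ (J : Ideal (MvPolynomial ι k)) (m : ℤ) : ℕ := Module.finrank k (qCompZ k J m)

/-- A property `P` of tuples `c : τ → k` holds *generically* (i.e. for all choices
in a suitable nonempty Zariski-open subset of the affine space `k^τ`) if there is a
nonzero polynomial `g` such that `P c` holds whenever `g` does not vanish at `c`. -/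
def Generic (τ : Type) (P : (τ → k) → Prop) : Prop :=
  ∃ g : MvPolynomial τ k, g ≠ 0 ∧ ∀ c : τ → k, eval c g ≠ 0 → P c

/-- The linear form with coefficient tuple `c`. -/
def linForm (c : ι → k) : MvPolynomial ι k := ∑ i, C (c i) * X i

/-- The ideal `J` together with the `d` linear forms encoded by `c`. -/
def redIdeal (J : Ideal (MvPolynomial ι k)) {d : ℕ} (c : Fin d × ι → k) :
    Ideal (MvPolynomial ι k) :=
  J ⊔ Ideal.span (Set.range fun j : Fin d => linForm k fun i => c (j, i))

/-- `depth (k[Xᵢ]⧸J) ≥ t` : there is a regular sequence of length `t` consisting of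
elements of the graded maximal ideal. -/
def depthGE (J : Ideal (MvPolynomial ι k)) (t : ℕ) : Prop :=
  ∃ rs : List (MvPolynomial ι k), rs.length = t ∧
    (∀ f ∈ rs, f ∈ Ideal.span (Set.range (X : ι → MvPolynomial ι k))) ∧
    RingTheory.Sequence.IsRegular (MvPolynomial ι k ⧸ J)
      (rs.map (Ideal.Quotient.mk J))

/-- `k[Xᵢ]⧸J` is Cohen–Macaulay of Krull dimension `d`. -/
def isCM (J : Ideal (MvPolynomial ι k)) (d : ℕ) : Prop :=
  ringKrullDim (MvPolynomial ι k ⧸ J) = (d : ℕ) ∧ depthGE k J d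

/-- The socle of `k[Xᵢ]⧸J` (the annihilator of the graded maximal ideal). -/
def socle (J : Ideal (MvPolynomial ι k)) : Submodule k (MvPolynomial ι k ⧸ J) :=
  ⨅ i : ι, LinearMap.ker (LinearMap.mulLeft k (Ideal.Quotient.mk J (X i)))

/-- `k[Xᵢ]⧸J` is Artinian Gorenstein: Artinian with one-dimensional socle. -/
def artGor (J : Ideal (MvPolynomial ι k)) : Prop :=
  IsArtinianRing (MvPolynomial ι k ⧸ J) ∧ Module.finrank k (socle k J) = 1

/-- `k[Xᵢ]⧸J` is Gorenstein of Krull dimension `d`: it is Cohen–Macaulay of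
dimension `d` and a general Artinian reduction is Artinian Gorenstein. -/
def isGor (J : Ideal (MvPolynomial ι k)) (d : ℕ) : Prop :=
  isCM k J d ∧ Generic k (Fin d × ι) fun c => artGor k (redIdeal k J c)

/-- Multiplication by `ω` from the degree-`m` component to the degree-`(m+1)`
component of `k[Xᵢ]⧸J` has maximal rank (is injective or surjective). -/
def mulMaxRank (J : Ideal (MvPolynomial ι k)) (ω : MvPolynomial ι k ⧸ J) (m : ℕ) : Prop :=
  (∀ x ∈ qComp k J m, ω * x = 0 → x = 0) ∨
  (∀ y ∈ qComp k J (m + 1), ∃ x ∈ qComp k J m, ω * x = y)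

/-- The Weak Lefschetz Property for the Artinian algebra `k[Xᵢ]⧸J`: for a general
linear form `ω`, multiplication `ω : (⧸J)ₘ → (⧸J)ₘ₊₁` has maximal rank for all `m`. -/
def artWLP (J : Ideal (MvPolynomial ι k)) : Prop :=
  Generic k ι fun c => ∀ m : ℕ,
    mulMaxRank k J (Ideal.Quotient.mk J (linForm k c)) m

/-- The Weak Lefschetz Property for `k[Xᵢ]⧸J` of Krull dimension `d ≥ 1`:
Cohen–Macaulay, and a general Artinian reduction has the WLP. -/
def hasWLP (J : Ideal (MvPolynomial ι k)) (d : ℕ) : Prop :=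
  isCM k J d ∧ Generic k (Fin d × ι) fun c => artWLP k (redIdeal k J c)

/-- The Strong Lefschetz Property for the Artinian algebra `k[Xᵢ]⧸J`. -/
def artSLP (J : Ideal (MvPolynomial ι k)) : Prop :=
  ∃ r : ℕ, qComp k J r ≠ ⊥ ∧ (∀ j : ℕ, r < j → qComp k J j = ⊥) ∧
    (∀ i ≤ r, HFq k J i = HFq k J (r - i)) ∧
    Generic k ι fun c => ∀ i : ℕ, 2 * i ≤ r →
      (∀ x ∈ qComp k J i,
          Ideal.Quotient.mk J (linForm k c) ^ (r - 2 * i) * x = 0 → x = 0) ∧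
      (∀ y ∈ qComp k J (r - i), ∃ x ∈ qComp k J i,
          Ideal.Quotient.mk J (linForm k c) ^ (r - 2 * i) * x = y)

/-- The Strong Lefschetz Property for `k[Xᵢ]⧸J` of Krull dimension `d ≥ 1`. -/
def hasSLP (J : Ideal (MvPolynomial ι k)) (d : ℕ) : Prop :=
  isCM k J d ∧ Generic k (Fin d × ι) fun c => artSLP k (redIdeal k J c)

/-- `D` is Gorenstein* over `k`: every element of the vertex set is a vertex,
`k[D]` is Gorenstein (of dimension `dim D + 1`), and for every vertex `i` there is a
face `τ` with `τ ∪ {i}` not a face. -/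
def gorStar (D : SC n) : Prop :=
  (∀ i : Fin n, {i} ∈ D.faces) ∧
  isGor k (srIdeal k D) (dimP D) ∧
  (∀ i : Fin n, ∃ τ ∈ D.faces, insert i τ ∉ D.faces)

/-! `R[T]` is modelled as the polynomial ring in `n+1` variables, the last
variable playing the role of `T`. -/

/-- The inclusion `R = k[x₁,…,xₙ] → R[T] = k[x₁,…,xₙ,T]`. -/
def toT : MvPolynomial (Fin n) k →ₐ[k] MvPolynomial (Fin (n + 1)) k :=
  rename Fin.castSucc

/-- The variable `T` of `R[T]`. -/
def Tv (n : ℕ) : MvPolynomial (Fin (n + 1)) k := X (Fin.last n)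

/-- Extension of an ideal of `R` to `R[T]`. -/
def extI (J : Ideal (MvPolynomial (Fin n) k)) : Ideal (MvPolynomial (Fin (n + 1)) k) :=
  Ideal.map (toT k) J

/-- The ideal `T·J` of `R[T]`, for an ideal `J` of `R`. -/
def TmulI (J : Ideal (MvPolynomial (Fin n) k)) : Ideal (MvPolynomial (Fin (n + 1)) k) :=
  Ideal.span ((fun f => Tv k n * toT k f) '' (J : Set (MvPolynomial (Fin n) k)))

/-- `I_L = (I_D : x_σ)`, the Stanley–Reisner ideal of the link of `σ` in `D`
(extended to `R`). -/
def linkIdeal (D : SC n) (σ : Finset (Fin n)) : Ideal (MvPolynomial (Fin n) k) :=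
  Submodule.colon (srIdeal k D) (Ideal.span {xFace k σ})

/-- `J_st = (I, x_σ, T·I_L) ⊂ R[T]`, the Stanley–Reisner ideal of the stellar
subdivision `D_σ`. -/
def Jst (D : SC n) (σ : Finset (Fin n)) : Ideal (MvPolynomial (Fin (n + 1)) k) :=
  extI k (srIdeal k D) ⊔ Ideal.span {toT k (xFace k σ)} ⊔ TmulI k (linkIdeal k D σ)

/-- `I_C = (I, T^{q+1}, T·I_L) ⊂ R[T]`. -/
def IC (D : SC n) (σ : Finset (Fin n)) (q : ℕ) : Ideal (MvPolynomial (Fin (n + 1)) k) :=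
  extI k (srIdeal k D) ⊔ Ideal.span {Tv k n ^ (q + 1)} ⊔ TmulI k (linkIdeal k D σ)

/-- `I_G = (I, T^{q+1} - x_σ, T·I_L) ⊂ R[T]`. -/
def IG (D : SC n) (σ : Finset (Fin n)) (q : ℕ) : Ideal (MvPolynomial (Fin (n + 1)) k) :=
  extI k (srIdeal k D) ⊔ Ideal.span {Tv k n ^ (q + 1) - toT k (xFace k σ)} ⊔
    TmulI k (linkIdeal k D σ)

/-- The ideal of `R[T]` generated by `d` general linear forms of `R`
(involving only the `x`-variables). -/
def xForms {d : ℕ} (c : Fin d × Fin n → k) : Ideal (MvPolynomial (Fin (n + 1)) k) :=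
  Ideal.span (Set.range fun j : Fin d => toT k (linForm k fun i => c (j, i)))

/-- Property `M_{q,p₁}` for the Artinian algebra `B = R⧸J_B`: for a general linear
form `ω`, multiplication by `ω^q : B_{p₁-q} → B_{p₁}` is injective. -/
def propM (JB : Ideal (MvPolynomial (Fin n) k)) (q p₁ : ℕ) : Prop :=
  Generic k (Fin n) fun c => ∀ x ∈ qCompZ k JB ((p₁ : ℤ) - (q : ℤ)),
    Ideal.Quotient.mk JB (linForm k c) ^ q * x = 0 → x = 0

section HomogeneousIdeals

omit [Fintype ι]
variable {k}

lemma homogeneousComponent_add_mul {f : MvPolynomial ι k} {e : ℕ} (hf : f.IsHomogeneous e)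
    (r : MvPolynomial ι k) (m : ℕ) :
    homogeneousComponent (m + e) (f * r) = f * homogeneousComponent m r := by
  conv_lhs => rw [← sum_homogeneousComponent r]
  rw [Finset.mul_sum, map_sum]
  have h : ∀ i, homogeneousComponent (m + e) (f * homogeneousComponent i r) =
      if i = m then f * homogeneousComponent i r else 0 := by
    intro i
    have := homogeneousComponent_of_mem (m := m + e) (n := e + i)
      (hf.mul (homogeneousComponent_isHomogeneous i r))
    rw [this]
    congr 1
    simp only [eq_iff_iff]
    omega
  simp only [h]
  rw [Finset.sum_ite_eq']
  split_ifs with hm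
  · rfl
  · rw [homogeneousComponent_eq_zero, mul_zero]
    simpa using hm

lemma homogeneousComponent_mul_of_lt {f : MvPolynomial ι k} {e : ℕ} (hf : f.IsHomogeneous e)
    (r : MvPolynomial ι k) {m : ℕ} (hm : m < e) :
    homogeneousComponent m (f * r) = 0 := by
  conv_lhs => rw [← sum_homogeneousComponent r]
  rw [Finset.mul_sum, map_sum]
  refine Finset.sum_eq_zero fun i _ => ?_
  rw [homogeneousComponent_of_mem (m := m) (n := e + i)
      (hf.mul (homogeneousComponent_isHomogeneous i r)), if_neg (by omega)]

/-- An ideal is homogeneous if it contains the homogeneous components of its elements. -/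
def HomI (J : Ideal (MvPolynomial ι k)) : Prop :=
  ∀ p ∈ J, ∀ m, homogeneousComponent m p ∈ J

lemma HomI.sup {J K : Ideal (MvPolynomial ι k)} (hJ : HomI J) (hK : HomI K) : HomI (J ⊔ K) := by
  intro p hp m
  obtain ⟨a, ha, b, hb, rfl⟩ := Submodule.mem_sup.1 hp
  rw [map_add]
  exact Submodule.add_mem_sup (hJ a ha m) (hK b hb m)

lemma HomI.span {S : Set (MvPolynomial ι k)} (hS : ∀ s ∈ S, ∃ e, s.IsHomogeneous e) :
    HomI (Ideal.span S) := by
  intro p hp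
  induction hp using Submodule.span_induction with
  | mem x hx =>
    intro m
    obtain ⟨e, he⟩ := hS x hx
    rw [homogeneousComponent_of_mem (n := e) he]
    split_ifs
    · exact Ideal.subset_span hx
    · exact zero_mem _
  | zero => intro m; simp
  | add x y _ _ hx hy => intro m; rw [map_add]; exact add_mem (hx m) (hy m)
  | smul a x _ hx =>
    intro m
    rw [smul_eq_mul, ← sum_homogeneousComponent x, Finset.mul_sum, map_sum]
    refine sum_mem fun i _ => ?_
    rw [mul_comm]
    rcases lt_or_ge m i with h | h
    · rw [homogeneousComponent_mul_of_lt (homogeneousComponent_isHomogeneous i x) _ h]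
      exact zero_mem _
    · obtain ⟨j, rfl⟩ := Nat.exists_eq_add_of_le' h
      rw [homogeneousComponent_add_mul (homogeneousComponent_isHomogeneous i x)]
      exact Ideal.mul_mem_right _ _ (hx i)

lemma HomI.span_singleton {f : MvPolynomial ι k} {e : ℕ} (hf : f.IsHomogeneous e) :
    HomI (Ideal.span {f}) :=
  HomI.span fun s hs => ⟨e, by rw [Set.mem_singleton_iff.1 hs]; exact hf⟩

/-- The colon ideal `J : f`. -/
def colonBy (J : Ideal (MvPolynomial ι k)) (f : MvPolynomial ι k) : Ideal (MvPolynomial ι k) :=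
  Submodule.comap (LinearMap.mulLeft (MvPolynomial ι k) f) J

lemma mem_colonBy {J : Ideal (MvPolynomial ι k)} {f r : MvPolynomial ι k} :
    r ∈ colonBy J f ↔ f * r ∈ J := Iff.rfl

lemma le_colonBy (J : Ideal (MvPolynomial ι k)) (f : MvPolynomial ι k) : J ≤ colonBy J f :=
  fun _ hr => Ideal.mul_mem_left _ _ hr

lemma HomI.colonBy {J : Ideal (MvPolynomial ι k)} (hJ : HomI J) {f : MvPolynomial ι k} {e : ℕ}
    (hf : f.IsHomogeneous e) : HomI (colonBy J f) := by
  intro p hp m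
  rw [mem_colonBy, ← homogeneousComponent_add_mul hf]
  exact hJ _ hp _

lemma mem_of_homogeneousComponent_mem {J : Ideal (MvPolynomial ι k)} {p : MvPolynomial ι k}
    (h : ∀ m, homogeneousComponent m p ∈ J) : p ∈ J := by
  rw [← sum_homogeneousComponent p]
  exact sum_mem fun i _ => h i

lemma mem_sup_span_singleton {R : Type*} [CommRing R] {J : Ideal R} {f r : R} :
    r ∈ J ⊔ Ideal.span {f} ↔ ∃ b, r - f * b ∈ J := by
  constructor
  · intro h
    obtain ⟨a, ha, y, hy, rfl⟩ := Submodule.mem_sup.1 h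
    obtain ⟨b, rfl⟩ := Ideal.mem_span_singleton.1 hy
    exact ⟨b, by simpa using ha⟩
  · rintro ⟨b, hb⟩
    have : r = (r - f * b) + f * b := by ring
    rw [this]
    exact Submodule.add_mem_sup hb (Ideal.mul_mem_right _ _ (Ideal.mem_span_singleton_self f))

end HomogeneousIdeals

section HilbertFunction

variable {k}

instance finiteDimensional_homogeneousSubmodule (m : ℕ) :
    FiniteDimensional k (homogeneousSubmodule ι k m) :=
  Module.Finite.iff_fg.2 (homogeneousSubmodule_fg ι k m)

instance finiteDimensional_qComp (J : Ideal (MvPolynomial ι k)) (m : ℕ) :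
    FiniteDimensional k (qComp k J m) := by
  unfold qComp; infer_instance

lemma mem_qComp {J : Ideal (MvPolynomial ι k)} {m : ℕ} {x : MvPolynomial ι k ⧸ J} :
    x ∈ qComp k J m ↔ ∃ p : MvPolynomial ι k, p.IsHomogeneous m ∧ Ideal.Quotient.mk J p = x :=
  Iff.rfl

lemma finrank_map_eq_of_ker_eq {V W₁ W₂ : Type*} [AddCommGroup V] [Module k V] [AddCommGroup W₁]
    [Module k W₁] [AddCommGroup W₂] [Module k W₂] (f : V →ₗ[k] W₁) (g : V →ₗ[k] W₂)
    (h : ∀ v, f v = 0 ↔ g v = 0) (U : Submodule k V) [FiniteDimensional k U] :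
    Module.finrank k (U.map f) = Module.finrank k (U.map g) := by
  have h1 := LinearMap.finrank_range_add_finrank_ker (f.domRestrict U)
  have h2 := LinearMap.finrank_range_add_finrank_ker (g.domRestrict U)
  have h3 : LinearMap.ker (f.domRestrict U) = LinearMap.ker (g.domRestrict U) := by
    ext x; simp [h]
  rw [LinearMap.range_domRestrict] at h1 h2
  rw [h3] at h1
  omega

lemma finrank_map_eq_HFq {V : Type*} [AddCommGroup V] [Module k V] {J : Ideal (MvPolynomial ι k)}
    (φ : MvPolynomial ι k →ₗ[k] V) (h : ∀ p, φ p = 0 ↔ p ∈ J) (m : ℕ) :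
    Module.finrank k ((homogeneousSubmodule ι k m).map φ) = HFq k J m := by
  unfold HFq qComp
  apply finrank_map_eq_of_ker_eq
  intro v
  rw [h]
  exact (Ideal.Quotient.eq_zero_iff_mem).symm

lemma finrank_map_add_of_le {V W₁ W₂ : Type*} [AddCommGroup V] [Module k V] [AddCommGroup W₁]
    [Module k W₁] [AddCommGroup W₂] [Module k W₂] (f : V →ₗ[k] W₁) (g : V →ₗ[k] W₂)
    (U : Submodule k V) [FiniteDimensional k U]
    (h : ∀ v, f v = 0 → g v = 0) (N : Submodule k W₁)
    (hN : ∀ w, w ∈ N ↔ ∃ v ∈ U, g v = 0 ∧ f v = w) :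
    Module.finrank k (U.map f) = Module.finrank k (U.map g) + Module.finrank k N := by
  have h1 := LinearMap.finrank_range_add_finrank_ker (f.domRestrict U)
  have h2 := LinearMap.finrank_range_add_finrank_ker (g.domRestrict U)
  rw [LinearMap.range_domRestrict] at h1 h2
  have hNe : N = (LinearMap.ker (g.domRestrict U)).map (f.domRestrict U) := by
    ext w
    rw [hN]
    constructor
    · rintro ⟨v, hv, h0, rfl⟩
      exact ⟨⟨v, hv⟩, by simpa using h0, rfl⟩
    · rintro ⟨⟨v, hv⟩, h0, rfl⟩
      exact ⟨v, hv, by simpa using h0, rfl⟩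
  have h3 := LinearMap.finrank_range_add_finrank_ker
    ((f.domRestrict U).domRestrict (LinearMap.ker (g.domRestrict U)))
  rw [LinearMap.range_domRestrict, ← hNe] at h3
  have h4 : Module.finrank k (LinearMap.ker
      ((f.domRestrict U).domRestrict (LinearMap.ker (g.domRestrict U)))) =
      Module.finrank k (LinearMap.ker (f.domRestrict U)) := by
    have hle : LinearMap.ker (f.domRestrict U) ≤ LinearMap.ker (g.domRestrict U) := by
      intro x hx
      simpa using h _ (by simpa using hx)
    rw [LinearMap.ker_domRestrict]
    exact (Submodule.comapSubtypeEquivOfLe hle).finrank_eq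
  omega

/-- The Hilbert function of `R/J` splits along multiplication by a homogeneous element. -/
lemma HFq_add_eq {J : Ideal (MvPolynomial ι k)} (hJ : HomI J) {f : MvPolynomial ι k} {e : ℕ}
    (hf : f.IsHomogeneous e) (m : ℕ) :
    HFq k J (m + e) = HFq k (J ⊔ Ideal.span {f}) (m + e) + HFq k (colonBy J f) m := by
  rw [← finrank_map_eq_HFq (J := colonBy J f)
    ((Ideal.Quotient.mkₐ k J).toLinearMap ∘ₗ LinearMap.mulLeft k f)
    (fun p => by
      rw [mem_colonBy]; exact Ideal.Quotient.eq_zero_iff_mem) m]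
  refine finrank_map_add_of_le _ _ _ ?_ _ ?_
  · intro v hv
    have : v ∈ J := Ideal.Quotient.eq_zero_iff_mem.1 hv
    exact Ideal.Quotient.eq_zero_iff_mem.2 (Ideal.mem_sup_left this)
  · intro w
    constructor
    · rintro ⟨p, hp, rfl⟩
      refine ⟨f * p, ?_, ?_, rfl⟩
      · have := hf.mul (show p.IsHomogeneous m from hp)
        rw [add_comm] at this
        exact this
      · exact Ideal.Quotient.eq_zero_iff_mem.2
          (Ideal.mem_sup_right (Ideal.mul_mem_right _ _ (Ideal.mem_span_singleton_self f)))
    · rintro ⟨v, hv, h0, rfl⟩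
      have h0 : v ∈ J ⊔ Ideal.span {f} := Ideal.Quotient.eq_zero_iff_mem.1 h0
      obtain ⟨b, hb⟩ := mem_sup_span_singleton.1 h0
      refine ⟨homogeneousComponent m b, homogeneousComponent_isHomogeneous _ _, ?_⟩
      have h1 := hJ _ hb (m + e)
      rw [map_sub, homogeneousComponent_add_mul hf,
        homogeneousComponent_eq_self (show v.IsHomogeneous (m + e) from hv)] at h1
      exact (Ideal.Quotient.eq.2 h1).symm

lemma HFq_of_lt {J : Ideal (MvPolynomial ι k)} (hJ : HomI J) {f : MvPolynomial ι k} {e : ℕ}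
    (hf : f.IsHomogeneous e) {m : ℕ} (hm : m < e) :
    HFq k J m = HFq k (J ⊔ Ideal.span {f}) m := by
  unfold HFq qComp
  have := finrank_map_add_of_le (Ideal.Quotient.mkₐ k J).toLinearMap
    (Ideal.Quotient.mkₐ k (J ⊔ Ideal.span {f})).toLinearMap (homogeneousSubmodule ι k m) ?_ ⊥ ?_
  · simpa using this
  · intro v hv
    have : v ∈ J := Ideal.Quotient.eq_zero_iff_mem.1 hv
    exact Ideal.Quotient.eq_zero_iff_mem.2 (Ideal.mem_sup_left this)
  · intro w
    constructor
    · intro hw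
      rw [Submodule.mem_bot] at hw
      exact ⟨0, zero_mem _, by simp, by simp [hw]⟩
    · rintro ⟨v, hv, h0, rfl⟩
      have h0 : v ∈ J ⊔ Ideal.span {f} := Ideal.Quotient.eq_zero_iff_mem.1 h0
      obtain ⟨b, hb⟩ := mem_sup_span_singleton.1 h0
      have h1 := hJ _ hb m
      rw [map_sub, homogeneousComponent_mul_of_lt hf _ hm, sub_zero,
        homogeneousComponent_eq_self (show v.IsHomogeneous m from hv)] at h1
      exact Ideal.Quotient.eq_zero_iff_mem.2 h1

lemma HFq_le_of_le {J K : Ideal (MvPolynomial ι k)} (h : J ≤ K) (m : ℕ) :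
    HFq k K m ≤ HFq k J m := by
  have h1 := finrank_map_add_of_le (Ideal.Quotient.mkₐ k J).toLinearMap
    (Ideal.Quotient.mkₐ k K).toLinearMap (homogeneousSubmodule ι k m)
    (fun v hv => Ideal.Quotient.eq_zero_iff_mem.2 (h (Ideal.Quotient.eq_zero_iff_mem.1 hv)))
    ((homogeneousSubmodule ι k m ⊓ LinearMap.ker (Ideal.Quotient.mkₐ k K).toLinearMap).map
      (Ideal.Quotient.mkₐ k J).toLinearMap)
    (fun w => by simp only [Submodule.mem_map, Submodule.mem_inf, LinearMap.mem_ker, and_assoc])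
  have h2 : HFq k J m = HFq k K m + _ := h1
  rw [h2]
  exact Nat.le_add_right _ _

lemma mem_of_HFq_eq {J K : Ideal (MvPolynomial ι k)} (h : J ≤ K) {m : ℕ}
    (he : HFq k K m = HFq k J m) {p : MvPolynomial ι k} (hp : p.IsHomogeneous m) (hpK : p ∈ K) :
    p ∈ J := by
  have h1 := finrank_map_add_of_le (Ideal.Quotient.mkₐ k J).toLinearMap
    (Ideal.Quotient.mkₐ k K).toLinearMap (homogeneousSubmodule ι k m)
    (fun v hv => Ideal.Quotient.eq_zero_iff_mem.2 (h (Ideal.Quotient.eq_zero_iff_mem.1 hv)))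
    ((homogeneousSubmodule ι k m ⊓ LinearMap.ker (Ideal.Quotient.mkₐ k K).toLinearMap).map
      (Ideal.Quotient.mkₐ k J).toLinearMap)
    (fun w => by simp only [Submodule.mem_map, Submodule.mem_inf, LinearMap.mem_ker, and_assoc])
  have h2 : HFq k J m = HFq k K m + _ := h1
  rw [he] at h2
  have h3 := Nat.left_eq_add.1 h2
  have : FiniteDimensional k
      ((homogeneousSubmodule ι k m ⊓ LinearMap.ker (Ideal.Quotient.mkₐ k K).toLinearMap :
        Submodule k (MvPolynomial ι k))) :=
    Submodule.finiteDimensional_of_le inf_le_left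
  have h4 := Submodule.finrank_eq_zero.1 h3
  have h5 : (Ideal.Quotient.mkₐ k J).toLinearMap p ∈ (⊥ : Submodule k _) := by
    rw [← h4]
    exact ⟨p, ⟨hp, Ideal.Quotient.eq_zero_iff_mem.2 hpK⟩, rfl⟩
  exact Ideal.Quotient.eq_zero_iff_mem.1 ((Submodule.mem_bot k).1 h5)

lemma eq_of_HFq_eq {J K : Ideal (MvPolynomial ι k)} (h : J ≤ K) (hK : HomI K)
    (he : ∀ m, HFq k K m = HFq k J m) : J = K := by
  refine le_antisymm h fun p hp => mem_of_homogeneousComponent_mem fun m => ?_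
  exact mem_of_HFq_eq h (he m) (homogeneousComponent_isHomogeneous m p) (hK p hp m)

lemma HFq_eq_zero_iff {J : Ideal (MvPolynomial ι k)} {m : ℕ} :
    HFq k J m = 0 ↔ ∀ p : MvPolynomial ι k, p.IsHomogeneous m → p ∈ J := by
  unfold HFq
  rw [Submodule.finrank_eq_zero]
  constructor
  · intro h p hp
    have : Ideal.Quotient.mk J p ∈ qComp k J m := ⟨p, hp, rfl⟩
    rw [h] at this
    exact Ideal.Quotient.eq_zero_iff_mem.1 ((Submodule.mem_bot k).1 this)
  · intro h
    rw [eq_bot_iff]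
    rintro _ ⟨p, hp, rfl⟩
    exact (Submodule.mem_bot k).2 (Ideal.Quotient.eq_zero_iff_mem.2 (h p hp))

lemma HFq_eq_zero_of_le {J : Ideal (MvPolynomial ι k)} {m m' : ℕ} (h : HFq k J m = 0)
    (hm : m ≤ m') : HFq k J m' = 0 := by
  induction m', hm using Nat.le_induction with
  | base => exact h
  | succ j _ ih =>
    rw [HFq_eq_zero_iff] at ih ⊢
    intro p hp
    rw [p.as_sum]
    refine sum_mem fun u hu => ?_
    have hdeg : u.degree = j + 1 := by
      have := hp (mem_support_iff.1 hu)
      rw [Finsupp.degree_eq_weight_one]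
      exact this
    have hne : u ≠ 0 := by
      rintro rfl
      simp at hdeg
    obtain ⟨i, hi⟩ := Finsupp.ne_iff.1 hne
    have hle : Finsupp.single i 1 ≤ u := by
      classical
      rw [Finsupp.single_le_iff]
      exact Nat.one_le_iff_ne_zero.2 hi
    obtain ⟨w, rfl⟩ := exists_add_of_le hle
    have hw : w.degree = j := by
      rw [map_add, Finsupp.degree_single] at hdeg
      omega
    have : monomial (Finsupp.single i 1 + w) (coeff (Finsupp.single i 1 + w) p) =
        X i * monomial w (coeff (Finsupp.single i 1 + w) p) := by
      rw [X, monomial_mul, one_mul]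
    rw [this]
    exact Ideal.mul_mem_left _ _ (ih _ (isHomogeneous_monomial _ hw))

end HilbertFunction

section RegularSequences

variable {k}

/-- `f₁,…,f_r` is a weakly regular sequence on `R/J`. -/
def Reg : Ideal (MvPolynomial ι k) → List (MvPolynomial ι k) → Prop
  | _, [] => True
  | J, f :: l => (∀ r, f * r ∈ J → r ∈ J) ∧ Reg (J ⊔ Ideal.span {f}) l

/-- The ideal `J` enlarged by the entries of a list. -/
def idl (J : Ideal (MvPolynomial ι k)) (l : List (MvPolynomial ι k)) :
    Ideal (MvPolynomial ι k) := J ⊔ Ideal.span {f | f ∈ l}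

omit [Fintype ι] in
@[simp] lemma idl_nil (J : Ideal (MvPolynomial ι k)) : idl J [] = J := by
  simp [idl]

omit [Fintype ι] in
lemma idl_cons (J : Ideal (MvPolynomial ι k)) (f : MvPolynomial ι k)
    (l : List (MvPolynomial ι k)) : idl J (f :: l) = idl (J ⊔ Ideal.span {f}) l := by
  unfold idl
  rw [sup_assoc, ← Ideal.span_union]
  congr 2
  ext x
  simp

omit [Fintype ι] in
lemma idl_append (J : Ideal (MvPolynomial ι k)) (l l' : List (MvPolynomial ι k)) :
    idl J (l ++ l') = idl (idl J l) l' := by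
  unfold idl
  rw [sup_assoc, ← Ideal.span_union]
  congr 2
  ext x
  simp

omit [Fintype ι] in
lemma le_idl (J : Ideal (MvPolynomial ι k)) (l : List (MvPolynomial ι k)) : J ≤ idl J l :=
  le_sup_left

omit [Fintype ι] in
lemma mem_idl (J : Ideal (MvPolynomial ι k)) {l : List (MvPolynomial ι k)}
    {f : MvPolynomial ι k} (h : f ∈ l) : f ∈ idl J l :=
  Ideal.mem_sup_right (Ideal.subset_span h)

omit [Fintype ι] in
lemma reg_append (J : Ideal (MvPolynomial ι k)) (l l' : List (MvPolynomial ι k)) :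
    Reg J (l ++ l') ↔ Reg J l ∧ Reg (idl J l) l' := by
  induction l generalizing J with
  | nil => simp [Reg]
  | cons f l ih => simp [Reg, ih, idl_cons, and_assoc]

/-- A list of linear forms. -/
def LinList (l : List (MvPolynomial ι k)) : Prop := ∀ f ∈ l, f.IsHomogeneous 1

omit [Fintype ι] in
lemma HomI.idl {J : Ideal (MvPolynomial ι k)} (hJ : HomI J) {l : List (MvPolynomial ι k)}
    (hl : LinList l) : HomI (idl J l) :=
  hJ.sup (HomI.span fun s hs => ⟨1, hl s hs⟩)

/-- Partial sums of a function. -/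
def psum (h : ℕ → ℕ) (m : ℕ) : ℕ := ∑ j ∈ Finset.range (m + 1), h j

lemma psum_zero (h : ℕ → ℕ) : psum h 0 = h 0 := by simp [psum]

lemma psum_succ (h : ℕ → ℕ) (m : ℕ) : psum h (m + 1) = psum h m + h (m + 1) := by
  simp [psum, Finset.sum_range_succ]

lemma psum_mono : Monotone psum := fun _ _ h _ => Finset.sum_le_sum fun j _ => h j

lemma psum_injective : Function.Injective psum := by
  intro h h' e
  ext m
  cases m with
  | zero => rw [← psum_zero h, e, psum_zero]
  | succ m =>
    have := congrFun e (m + 1)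
    rw [psum_succ, psum_succ, congrFun e m] at this
    omega

lemma HFq_le_psum {J : Ideal (MvPolynomial ι k)} (hJ : HomI J) {f : MvPolynomial ι k}
    (hf : f.IsHomogeneous 1) : HFq k J ≤ psum (HFq k (J ⊔ Ideal.span {f})) := by
  intro m
  change HFq k J m ≤ psum (HFq k (J ⊔ Ideal.span {f})) m
  induction m with
  | zero => rw [psum_zero, ← HFq_of_lt hJ hf (by omega)]
  | succ m ih =>
    rw [psum_succ, HFq_add_eq hJ hf]
    have := HFq_le_of_le (le_colonBy J f) m
    omega

lemma HFq_eq_psum_iff {J : Ideal (MvPolynomial ι k)} (hJ : HomI J) {f : MvPolynomial ι k}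
    (hf : f.IsHomogeneous 1) :
    HFq k J = psum (HFq k (J ⊔ Ideal.span {f})) ↔ ∀ r, f * r ∈ J → r ∈ J := by
  constructor
  · intro h
    have : J = colonBy J f := by
      refine eq_of_HFq_eq (le_colonBy J f) (hJ.colonBy hf) fun m => ?_
      have h1 := HFq_add_eq hJ hf m
      have h2 := congrFun h m
      have h3 := congrFun h (m + 1)
      rw [psum_succ] at h3
      omega
    intro r hr
    rw [this]
    exact hr
  · intro h
    have hc : colonBy J f = J := le_antisymm (fun r hr => h r hr) (le_colonBy J f)
    ext m
    induction m with
    | zero => rw [psum_zero, ← HFq_of_lt hJ hf (by omega)]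
    | succ m ih => rw [psum_succ, HFq_add_eq hJ hf, hc]; omega

lemma HFq_le_psum_iterate {J : Ideal (MvPolynomial ι k)} (hJ : HomI J)
    {l : List (MvPolynomial ι k)} (hl : LinList l) :
    HFq k J ≤ psum^[l.length] (HFq k (idl J l)) := by
  induction l generalizing J with
  | nil => simp
  | cons f l ih =>
    have hf := hl f (by simp)
    rw [List.length_cons, Function.iterate_succ', idl_cons]
    exact (HFq_le_psum hJ hf).trans
      (psum_mono (ih (hJ.sup (HomI.span_singleton hf)) fun g hg => hl g (by simp [hg])))

/-- A sequence of linear forms is regular iff the Hilbert function is the expected one. -/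
lemma reg_iff_HFq {J : Ideal (MvPolynomial ι k)} (hJ : HomI J)
    {l : List (MvPolynomial ι k)} (hl : LinList l) :
    Reg J l ↔ HFq k J = psum^[l.length] (HFq k (idl J l)) := by
  induction l generalizing J with
  | nil => simp [Reg]
  | cons f l ih =>
    have hf := hl f (by simp)
    have hl' : LinList l := fun g hg => hl g (by simp [hg])
    have hJ' := hJ.sup (HomI.span_singleton hf)
    rw [List.length_cons, Function.iterate_succ', idl_cons, Reg, ih hJ' hl',
      ← HFq_eq_psum_iff hJ hf, Function.comp]
    constructor
    · rintro ⟨h1, h2⟩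
      rw [h1, ← h2]
    · intro h
      have h1 := HFq_le_psum hJ hf
      have h2 := psum_mono (HFq_le_psum_iterate hJ' hl')
      have h3 : psum (HFq k (J ⊔ Ideal.span {f})) ≤ HFq k J := by rw [h]; exact h2
      have h4 := le_antisymm h1 h3
      exact ⟨h4, psum_injective (h4.symm.trans h)⟩

lemma psum_iterate_injective (r : ℕ) : Function.Injective psum^[r] :=
  psum_injective.iterate r

lemma psum_iterate_mono (r : ℕ) : Monotone psum^[r] := psum_mono.iterate r

lemma reg_of_HFq_le {J : Ideal (MvPolynomial ι k)} (hJ : HomI J)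
    {l l' : List (MvPolynomial ι k)} (hl : LinList l) (hl' : LinList l')
    (hlen : l.length = l'.length) (h : Reg J l)
    (hle : HFq k (idl J l') ≤ HFq k (idl J l)) : Reg J l' := by
  rw [reg_iff_HFq hJ hl] at h
  rw [reg_iff_HFq hJ hl']
  refine le_antisymm (HFq_le_psum_iterate hJ hl') ?_
  rw [h, hlen]
  exact psum_iterate_mono _ hle

lemma HFq_eq_of_reg {J : Ideal (MvPolynomial ι k)} (hJ : HomI J)
    {l l' : List (MvPolynomial ι k)} (hl : LinList l) (hl' : LinList l')
    (hlen : l.length = l'.length) (h : Reg J l) (h' : Reg J l') :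
    HFq k (idl J l') = HFq k (idl J l) := by
  rw [reg_iff_HFq hJ hl] at h
  rw [reg_iff_HFq hJ hl', ← hlen] at h'
  exact psum_iterate_injective _ (h'.symm.trans h)

lemma reg_of_idl_eq {J : Ideal (MvPolynomial ι k)} (hJ : HomI J)
    {l l' : List (MvPolynomial ι k)} (hl : LinList l) (hl' : LinList l')
    (hlen : l.length = l'.length) (h : Reg J l) (he : idl J l' = idl J l) : Reg J l' :=
  reg_of_HFq_le hJ hl hl' hlen h (by rw [he])

/-- Two homogeneous ideals `J ≤ L` on which `l` is regular agree if they agree modulo `l`. -/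
lemma eq_of_idl_eq {J L : Ideal (MvPolynomial ι k)} (hJ : HomI J) (hL : HomI L) (hJL : J ≤ L)
    {l : List (MvPolynomial ι k)} (hl : LinList l) (h : Reg J l) (h' : Reg L l)
    (he : idl L l ≤ idl J l) : J = L := by
  refine eq_of_HFq_eq hJL hL fun m => ?_
  have he' : idl J l = idl L l := le_antisymm (sup_le_sup_right hJL _) he
  rw [reg_iff_HFq hJ hl] at h
  rw [reg_iff_HFq hL hl, ← he', ← h] at h'
  rw [h']

end RegularSequences

section Exchange

variable {k}

omit [Fintype ι] in
lemma reg_iff_take {J : Ideal (MvPolynomial ι k)} {l : List (MvPolynomial ι k)} :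
    Reg J l ↔ ∀ i (h : i < l.length), ∀ r, l[i] * r ∈ idl J (l.take i) → r ∈ idl J (l.take i) := by
  induction l generalizing J with
  | nil => simp [Reg]
  | cons f l ih =>
    rw [Reg, ih]
    constructor
    · rintro ⟨h1, h2⟩ i hi r hr
      cases i with
      | zero => simpa using h1 r (by simpa using hr)
      | succ i =>
        rw [List.take_succ_cons, idl_cons] at hr ⊢
        exact h2 i (by simpa using hi) r (by simpa using hr)
    · intro h
      refine ⟨fun r hr => by simpa using h 0 (by simp) r (by simpa using hr), fun i hi r hr => ?_⟩
      have := h (i + 1) (by simpa using hi) r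
      rw [List.take_succ_cons, idl_cons] at this
      exact this (by simpa using hr)

omit [Fintype ι] in
lemma reg_of_isWeaklyRegular {J : Ideal (MvPolynomial ι k)} {l : List (MvPolynomial ι k)}
    (h : RingTheory.Sequence.IsWeaklyRegular (MvPolynomial ι k ⧸ J)
      (l.map (Ideal.Quotient.mk J))) : Reg J l := by
  rw [reg_iff_take]
  intro i hi r hr
  have h1 := h.regular_mod_prev i (by simpa using hi)
  have key : ∀ x : MvPolynomial ι k, Ideal.Quotient.mk J x ∈
      (Ideal.ofList (List.take i (l.map (Ideal.Quotient.mk J))) •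
        (⊤ : Submodule (MvPolynomial ι k ⧸ J) (MvPolynomial ι k ⧸ J))) ↔
      x ∈ idl J (l.take i) := by
    intro x
    rw [smul_eq_mul, Ideal.mul_top, ← List.map_take, ← Ideal.map_ofList,
      Ideal.mem_quotient_iff_mem_sup, sup_comm]
    rfl
  rw [← key] at hr ⊢
  rw [isSMulRegular_iff_right_eq_zero_of_smul] at h1
  have h2 := h1 (Submodule.Quotient.mk (Ideal.Quotient.mk J r)) (by
    rw [← Submodule.Quotient.mk_smul, Submodule.Quotient.mk_eq_zero]
    simpa using hr)
  exact (Submodule.Quotient.mk_eq_zero _).1 h2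

omit [Fintype ι] in
/-- A regular element modulo all the partial quotients may be moved to the front. -/
lemma reg_sup_of_reg {J : Ideal (MvPolynomial ι k)} {l : List (MvPolynomial ι k)}
    {f : MvPolynomial ι k} (h : Reg J l)
    (hf : ∀ i ≤ l.length, ∀ r, f * r ∈ idl J (l.take i) → r ∈ idl J (l.take i)) :
    Reg (J ⊔ Ideal.span {f}) l := by
  induction l generalizing J with
  | nil => trivial
  | cons x l ih =>
    refine ⟨fun r hr => ?_, ?_⟩
    · obtain ⟨b, hb⟩ := mem_sup_span_singleton.1 hr
      have h1 : f * b ∈ J ⊔ Ideal.span {x} := by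
        have : f * b = x * r - (x * r - f * b) := by ring
        rw [this]
        exact sub_mem (Ideal.mem_sup_right (Ideal.mul_mem_right _ _
          (Ideal.mem_span_singleton_self x))) (Ideal.mem_sup_left hb)
      have h2 := hf 1 (by simp) b (by simpa [idl_cons] using h1)
      rw [List.take_succ_cons, List.take_zero, idl_cons, idl_nil] at h2
      obtain ⟨y, hy⟩ := mem_sup_span_singleton.1 h2
      refine mem_sup_span_singleton.2 ⟨y, h.1 _ ?_⟩
      have : x * (r - f * y) = (x * r - f * b) + f * (b - x * y) := by ring
      rw [this]
      exact add_mem hb (Ideal.mul_mem_left _ _ hy)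
    · have : J ⊔ Ideal.span {f} ⊔ Ideal.span {x} = J ⊔ Ideal.span {x} ⊔ Ideal.span {f} :=
        sup_right_comm _ _ _
      rw [this]
      refine ih h.2 fun i hi r hr => ?_
      have := hf (i + 1) (by simpa using hi) r
      rw [List.take_succ_cons, idl_cons] at this
      exact this hr

lemma linForm_isHomogeneous (v : ι → k) : (linForm k v).IsHomogeneous 1 := by
  unfold linForm
  refine IsHomogeneous.sum _ _ _ fun i _ => ?_
  simpa using (isHomogeneous_C _ (v i)).mul (isHomogeneous_X k i)

/-- `v ↦ linForm v` as a linear map. -/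
def linFormL : (ι → k) →ₗ[k] MvPolynomial ι k where
  toFun := linForm k
  map_add' v w := by simp [linForm, add_mul, Finset.sum_add_distrib]
  map_smul' a v := by simp [linForm, smul_eq_C_mul, Finset.mul_sum, mul_assoc]

@[simp] lemma linFormL_apply (v : ι → k) : linFormL v = linForm k v := rfl

lemma linForm_single [DecidableEq ι] (i : ι) : linForm k (Pi.single i 1) = X i := by
  unfold linForm
  rw [Finset.sum_eq_single i]
  · simp
  · intro j _ hj; simp [hj]
  · simp

lemma exists_linForm_regular [Infinite k] (S : Set (Ideal (MvPolynomial ι k))) (hS : S.Finite)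
    (h : ∀ K ∈ S, ∃ x ∈ Ideal.span (Set.range (X : ι → MvPolynomial ι k)),
      ∀ r, x * r ∈ K → r ∈ K) :
    ∃ v : ι → k, ∀ K ∈ S, ∀ r, linForm k v * r ∈ K → r ∈ K := by
  classical
  set A : Set (Ideal (MvPolynomial ι k)) :=
    ⋃ K ∈ S, associatedPrimes (MvPolynomial ι k) (MvPolynomial ι k ⧸ K) with hA
  have hAf : A.Finite := hS.biUnion fun K _ => associatedPrimes.finite _ _
  have hzd : ∀ K : Ideal (MvPolynomial ι k), ∀ x : MvPolynomial ι k,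
      (∃ P ∈ associatedPrimes (MvPolynomial ι k) (MvPolynomial ι k ⧸ K), x ∈ P) ↔
        ∃ r, x * r ∈ K ∧ r ∉ K := by
    intro K x
    have := congrArg (x ∈ ·) (biUnion_associatedPrimes_eq_zero_divisors (MvPolynomial ι k)
      (MvPolynomial ι k ⧸ K))
    simp only [Set.mem_iUnion, Set.mem_ofPred_eq, exists_prop, SetLike.mem_coe, eq_iff_iff] at this
    rw [this]
    constructor
    · rintro ⟨y, hy, hxy⟩
      obtain ⟨r, rfl⟩ := Ideal.Quotient.mk_surjective y
      exact ⟨r, Ideal.Quotient.eq_zero_iff_mem.1 hxy, fun h => hy (Ideal.Quotient.eq_zero_iff_mem.2 h)⟩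
    · rintro ⟨r, h1, h2⟩
      exact ⟨Ideal.Quotient.mk K r, fun h => h2 (Ideal.Quotient.eq_zero_iff_mem.1 h),
        Ideal.Quotient.eq_zero_iff_mem.2 h1⟩
  let V : Ideal (MvPolynomial ι k) → Subspace k (ι → k) := fun P =>
    (P.restrictScalars k).comap linFormL
  have hV : (⊤ : Subspace k (ι → k)) ∉ hAf.toFinset.image V := by
    intro hm
    obtain ⟨P, hP, hPt⟩ := Finset.mem_image.1 hm
    rw [Set.Finite.mem_toFinset, hA] at hP
    simp only [Set.mem_iUnion, exists_prop] at hP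
    obtain ⟨K, hK, hPK⟩ := hP
    obtain ⟨x, hx, hxr⟩ := h K hK
    have hle : Ideal.span (Set.range (X : ι → MvPolynomial ι k)) ≤ P := by
      rw [Ideal.span_le]
      rintro _ ⟨i, rfl⟩
      have : (Pi.single i 1 : ι → k) ∈ V P := by rw [hPt]; trivial
      have h2 : linForm k (Pi.single i 1) ∈ P := this
      rwa [linForm_single] at h2
    obtain ⟨r, h1, h2⟩ := (hzd K x).1 ⟨P, hPK, hle hx⟩
    exact h2 (hxr r h1)
  have hne := Subspace.biUnion_ne_univ_of_top_notMem hV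
  obtain ⟨v, hv⟩ := (Set.ne_univ_iff_exists_notMem _).1 hne
  refine ⟨v, fun K hK r hr => ?_⟩
  by_contra hrK
  obtain ⟨P, hP, hvP⟩ := (hzd K _).2 ⟨r, hr, hrK⟩
  refine hv (Set.mem_biUnion (x := V P) ?_ hvP)
  rw [Finset.mem_coe, Finset.mem_image]
  exact ⟨P, (Set.Finite.mem_toFinset _).2 (Set.mem_biUnion hK hP), rfl⟩

/-- A regular sequence in the irrelevant ideal may be replaced by linear forms. -/
lemma exists_linear_reg [Infinite k] {J : Ideal (MvPolynomial ι k)}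
    {rs : List (MvPolynomial ι k)} (h : Reg J rs)
    (hrs : ∀ f ∈ rs, f ∈ Ideal.span (Set.range (X : ι → MvPolynomial ι k))) :
    ∃ l : List (ι → k), l.length = rs.length ∧ Reg J (l.map (linForm k)) := by
  induction hN : rs.length generalizing J rs with
  | zero => exact ⟨[], rfl, trivial⟩
  | succ N ih =>
    have hne : rs ≠ [] := by rintro rfl; simp at hN
    obtain ⟨v, hv⟩ := exists_linForm_regular
      ((fun i => idl J (rs.take i)) '' (Finset.range rs.length : Set ℕ))
      ((Finset.finite_toSet _).image _) (by
        rintro _ ⟨i, hi, rfl⟩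
        have hi : i < rs.length := by simpa using hi
        exact ⟨rs[i], hrs _ (List.getElem_mem hi), reg_iff_take.1 h i hi⟩)
    have hv' : ∀ i < rs.length, ∀ r, linForm k v * r ∈ idl J (rs.take i) → r ∈ idl J (rs.take i) :=
      fun i hi => hv _ ⟨i, by simpa using hi, rfl⟩
    have hd : Reg J rs.dropLast := by
      have := rs.dropLast_append_getLast hne
      rw [← this, reg_append] at h
      exact h.1
    have h1 : Reg (J ⊔ Ideal.span {linForm k v}) rs.dropLast := by
      refine reg_sup_of_reg hd fun i hi => ?_
      rw [List.length_dropLast] at hi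
      have : rs.dropLast.take i = rs.take i := by
        rw [List.dropLast_eq_take, List.take_take, min_eq_left hi]
      rw [this]
      exact hv' i (by omega)
    obtain ⟨l, hl, hlr⟩ := ih h1 (fun f hf => hrs f (List.mem_of_mem_dropLast hf))
      (by rw [List.length_dropLast]; omega)
    refine ⟨v :: l, by simp [hl], ?_⟩
    rw [List.map_cons]
    exact ⟨by simpa using hv' 0 (by omega), hlr⟩

end Exchange

section Genericity

variable {k}
variable {τ : Type}

lemma Generic.mono {P Q : (τ → k) → Prop} (h : Generic k τ P) (hPQ : ∀ c, P c → Q c) :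
    Generic k τ Q := by
  obtain ⟨g, hg, h⟩ := h
  exact ⟨g, hg, fun c hc => hPQ c (h c hc)⟩

lemma Generic.and {P Q : (τ → k) → Prop} (h : Generic k τ P) (h' : Generic k τ Q) :
    Generic k τ fun c => P c ∧ Q c := by
  obtain ⟨g, hg, h⟩ := h
  obtain ⟨g', hg', h'⟩ := h'
  refine ⟨g * g', mul_ne_zero hg hg', fun c hc => ?_⟩
  rw [map_mul] at hc
  exact ⟨h c (left_ne_zero_of_mul hc), h' c (right_ne_zero_of_mul hc)⟩

lemma Generic.of_forall {P : (τ → k) → Prop} (h : ∀ c, P c) : Generic k τ P :=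
  ⟨1, one_ne_zero, fun c _ => h c⟩

lemma Generic.exists [Infinite k] {P : (τ → k) → Prop} (h : Generic k τ P) : ∃ c, P c := by
  obtain ⟨g, hg, h⟩ := h
  by_contra! hc
  refine hg (MvPolynomial.funext fun c => ?_)
  by_contra h0
  exact hc c (h c (by simpa using h0))

lemma Generic.forall_finset {α : Type*} (s : Finset α) {P : α → (τ → k) → Prop}
    (h : ∀ a ∈ s, Generic k τ (P a)) : Generic k τ fun c => ∀ a ∈ s, P a c := by
  classical
  induction s using Finset.induction_on with
  | empty => exact Generic.of_forall (by simp)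
  | insert a s _ ih =>
    refine ((h a (by simp)).and (ih fun b hb => h b (by simp [hb]))).mono fun c hc b hb => ?_
    rcases Finset.mem_insert.1 hb with rfl | hb
    · exact hc.1
    · exact hc.2 b hb

lemma Generic.comap [Infinite k] {τ' : Type} {P : (τ → k) → Prop} (h : Generic k τ P)
    (p : τ → MvPolynomial τ' k) (hp : ∀ c : τ → k, ∃ c' : τ' → k, ∀ t, eval c' (p t) = c t) :
    Generic k τ' fun c' => P fun t => eval c' (p t) := by
  obtain ⟨g, hg, h⟩ := h
  have key : ∀ c' : τ' → k, eval c' (bind₁ p g) = eval (fun t => eval c' (p t)) g := by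
    intro c'
    rw [← coe_aeval_eq_eval, ← coe_aeval_eq_eval]
    exact aeval_bind₁ _ _ _
  refine ⟨bind₁ p g, ?_, fun c' hc' => h _ (by rwa [← key])⟩
  intro h0
  refine hg (MvPolynomial.funext fun c => ?_)
  obtain ⟨c', hc'⟩ := hp c
  have := key c'
  rw [h0, map_zero] at this
  rw [map_zero, this]
  congr
  ext t
  rw [hc']

lemma Generic.ne_zero (g : MvPolynomial τ k) (hg : g ≠ 0) :
    Generic k τ fun c => eval c g ≠ 0 := ⟨g, hg, fun _ hc => hc⟩

/-- Surjectivity is an open condition in an affine family of linear maps. -/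
lemma generic_surjective [Fintype τ] {V W : Type} [AddCommGroup V] [Module k V] [AddCommGroup W]
    [Module k W] [FiniteDimensional k W] (φ₀ : V →ₗ[k] W) (φ : τ → V →ₗ[k] W) (c₀ : τ → k)
    (h : Function.Surjective (φ₀ + ∑ t, c₀ t • φ t)) :
    Generic k τ fun c => Function.Surjective (φ₀ + ∑ t, c t • φ t) := by
  classical
  obtain ⟨ψ, hψ⟩ := LinearMap.exists_rightInverse_of_surjective _ (LinearMap.range_eq_top.2 h)
  let b := Module.finBasis k W
  let M : Matrix (Fin (Module.finrank k W)) (Fin (Module.finrank k W)) (MvPolynomial τ k) :=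
    Matrix.of fun i j => C (b.repr (φ₀ (ψ (b j))) i) + ∑ t, X t * C (b.repr (φ t (ψ (b j))) i)
  have hM : ∀ c : τ → k, eval c M.det = LinearMap.det ((φ₀ + ∑ t, c t • φ t) ∘ₗ ψ) := by
    intro c
    rw [← LinearMap.det_toMatrix b, RingHom.map_det]
    congr 1
    ext i j
    simp [M, LinearMap.toMatrix_apply, LinearMap.sum_apply]
  refine ⟨M.det, ?_, fun c hc => ?_⟩
  · intro h0
    have := hM c₀
    rw [hψ, LinearMap.det_id, h0, map_zero] at this
    exact zero_ne_one this
  · rw [hM] at hc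
    have h1 := (LinearMap.equivOfDetNeZero _ hc).surjective
    intro w
    obtain ⟨x, hx⟩ := h1 w
    exact ⟨ψ x, hx⟩

end Genericity

section GenericReduction

variable {k}

/-- The linear forms with coefficients `c`, as a list. -/
def forms {d : ℕ} (c : Fin d × ι → k) : List (MvPolynomial ι k) :=
  List.ofFn fun j => linForm k fun i => c (j, i)

lemma linList_forms {d : ℕ} (c : Fin d × ι → k) : LinList (forms c) := by
  intro f hf
  obtain ⟨j, rfl⟩ := (List.mem_ofFn' _ _).1 hf
  exact linForm_isHomogeneous _

@[simp] lemma length_forms {d : ℕ} (c : Fin d × ι → k) : (forms c).length = d :=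
  List.length_ofFn

lemma idl_forms (J : Ideal (MvPolynomial ι k)) {d : ℕ} (c : Fin d × ι → k) :
    idl J (forms c) = redIdeal k J c := by
  unfold idl redIdeal forms
  congr 2
  ext f
  exact List.mem_ofFn' _ _

lemma exists_forms_eq {d : ℕ} (l : List (ι → k)) (hl : l.length = d) :
    ∃ c : Fin d × ι → k, forms c = l.map (linForm k) := by
  subst hl
  refine ⟨fun t => l[t.1] t.2, ?_⟩
  unfold forms
  refine List.ext_getElem (by simp) fun i _ _ => by simp

lemma homI_redIdeal {J : Ideal (MvPolynomial ι k)} (hJ : HomI J) {d : ℕ} (c : Fin d × ι → k) :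
    HomI (redIdeal k J c) := by
  rw [← idl_forms]; exact hJ.idl (linList_forms c)

lemma mem_redIdeal {J : Ideal (MvPolynomial ι k)} {d : ℕ} {c : Fin d × ι → k}
    {p : MvPolynomial ι k} : p ∈ redIdeal k J c ↔
      ∃ a ∈ J, ∃ b : Fin d → MvPolynomial ι k,
        p = a + ∑ j, linForm k (fun i => c (j, i)) * b j := by
  unfold redIdeal
  rw [Submodule.mem_sup]
  constructor
  · rintro ⟨a, ha, z, hz, rfl⟩
    obtain ⟨b, rfl⟩ := (Submodule.mem_span_range_iff_exists_fun _).1 hz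
    exact ⟨a, ha, b, by simp [mul_comm]⟩
  · rintro ⟨a, ha, b, rfl⟩
    refine ⟨a, ha, _, ?_, rfl⟩
    exact sum_mem fun j _ => Ideal.mul_mem_right _ _ (Ideal.subset_span ⟨j, rfl⟩)

lemma generic_HFq_le {J : Ideal (MvPolynomial ι k)} (hJ : HomI J) {d : ℕ} (c₀ : Fin d × ι → k)
    (m : ℕ) :
    Generic k (Fin d × ι) fun c => HFq k (redIdeal k J c) m ≤ HFq k (redIdeal k J c₀) m := by
  classical
  let W := homogeneousSubmodule ι k m
  let comp : MvPolynomial ι k →ₗ[k] W := (homogeneousComponent m).codRestrict W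
    (fun p => homogeneousComponent_isHomogeneous m p)
  let Z : (Fin d × ι → k) → Submodule k W := fun c =>
    ((redIdeal k J c).restrictScalars k).comap W.subtype
  have hZ : ∀ c, HFq k (redIdeal k J c) m + Module.finrank k (Z c) = Module.finrank k W := by
    intro c
    have h1 := LinearMap.finrank_range_add_finrank_ker
      ((Ideal.Quotient.mkₐ k (redIdeal k J c)).toLinearMap.domRestrict W)
    rw [LinearMap.range_domRestrict] at h1
    have h2 : LinearMap.ker ((Ideal.Quotient.mkₐ k (redIdeal k J c)).toLinearMap.domRestrict W) =
        Z c := by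
      ext x
      exact Ideal.Quotient.eq_zero_iff_mem
    rw [h2] at h1
    exact h1
  obtain ⟨Q, hQ⟩ := exists_isCompl (Z c₀)
  have hQd : Module.finrank k Q = HFq k (redIdeal k J c₀) m := by
    have := Submodule.finrank_add_eq_of_isCompl hQ
    have := hZ c₀
    omega
  let V := Q × (J.restrictScalars k) × (Fin d → MvPolynomial ι k)
  let p1 : V →ₗ[k] Q := LinearMap.fst k _ _
  let p2 : V →ₗ[k] (J.restrictScalars k) := LinearMap.fst k _ _ ∘ₗ LinearMap.snd k _ _
  let p3 : V →ₗ[k] (Fin d → MvPolynomial ι k) := LinearMap.snd k _ _ ∘ₗ LinearMap.snd k _ _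
  let φ₀ : V →ₗ[k] W := Q.subtype ∘ₗ p1 + comp ∘ₗ (J.restrictScalars k).subtype ∘ₗ p2
  let φ : Fin d × ι → V →ₗ[k] W := fun t =>
    comp ∘ₗ LinearMap.mulLeft k (X t.2) ∘ₗ LinearMap.proj t.1 ∘ₗ p3
  have hφ : ∀ (c : Fin d × ι → k) (v : V), (φ₀ + ∑ t, c t • φ t) v =
      v.1 + comp (v.2.1 + ∑ j, linForm k (fun i => c (j, i)) * v.2.2 j) := by
    intro c v
    simp only [LinearMap.add_apply, LinearMap.sum_apply, LinearMap.smul_apply, φ₀, φ,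
      LinearMap.comp_apply, map_add, map_sum, Fintype.sum_prod_type, linForm, Finset.sum_mul,
      LinearMap.mulLeft_apply, LinearMap.proj_apply, ← smul_eq_C_mul, smul_mul_assoc, map_smul, add_assoc]
    rfl
  refine (generic_surjective (V := V) (W := W) φ₀ φ c₀ ?_).mono fun c hc => ?_
  · intro w
    have : w ∈ Z c₀ ⊔ Q := by rw [hQ.sup_eq_top]; trivial
    obtain ⟨z, hz, y, hy, rfl⟩ := Submodule.mem_sup.1 this
    have hz' : (z : MvPolynomial ι k) ∈ redIdeal k J c₀ := hz
    obtain ⟨a, ha, b, hab⟩ := mem_redIdeal.1 hz'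
    refine ⟨(⟨y, hy⟩, ⟨a, ha⟩, b), ?_⟩
    rw [hφ]
    simp only
    rw [← hab, add_comm]
    congr 1
    apply Subtype.ext
    exact homogeneousComponent_eq_self z.2
  · have hcod : Codisjoint (Z c) Q := by
      rw [codisjoint_iff_le_sup]
      intro w _
      obtain ⟨v, rfl⟩ := hc w
      rw [hφ, add_comm]
      refine Submodule.add_mem_sup ?_ v.1.2
      change homogeneousComponent m _ ∈ redIdeal k J c
      exact homI_redIdeal hJ c _ (mem_redIdeal.2 ⟨_, v.2.1.2, _, rfl⟩) m
    have h1 := hZ c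
    have h2 := Submodule.finrank_add_le_finrank_add_finrank (Z c) Q
    rw [hcod.eq_top, finrank_top] at h2
    omega

/-- If some sequence of linear forms is regular and some Artinian reduction exists, then a
general sequence of linear forms is regular. -/
lemma generic_reg {J : Ideal (MvPolynomial ι k)} (hJ : HomI J) {d : ℕ} {c₀ c₁ : Fin d × ι → k}
    (h₀ : Reg J (forms c₀)) {N : ℕ} (h₁ : HFq k (redIdeal k J c₁) N = 0) :
    Generic k (Fin d × ι) fun c => Reg J (forms c) ∧
      HFq k (redIdeal k J c) = HFq k (redIdeal k J c₀) := by
  refine ((Generic.forall_finset (Finset.range N) fun m _ => generic_HFq_le hJ c₀ m).and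
    (generic_HFq_le hJ c₁ N)).mono fun c hc => ?_
  have hle : HFq k (redIdeal k J c) ≤ HFq k (redIdeal k J c₀) := by
    intro m
    rcases lt_or_ge m N with h | h
    · exact hc.1 m (by simpa using h)
    · have h3 := hc.2
      rw [h₁] at h3
      exact (HFq_eq_zero_of_le (Nat.le_zero.1 h3) h).le.trans (Nat.zero_le _)
  have hr : Reg J (forms c) :=
    reg_of_HFq_le hJ (linList_forms c₀) (linList_forms c) (by simp) h₀ (by simpa [idl_forms])
  refine ⟨hr, ?_⟩
  simpa [idl_forms] using
    HFq_eq_of_reg hJ (linList_forms c₀) (linList_forms c) (by simp) h₀ hr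

omit [Fintype ι] in
lemma homogeneousComponent_eq_zero_of_mem_span {N : ℕ} {a : MvPolynomial ι k}
    (ha : a ∈ Ideal.span {p : MvPolynomial ι k | ∃ j, N + 1 ≤ j ∧ p.IsHomogeneous j}) :
    homogeneousComponent N a = 0 := by
  induction ha using Submodule.closure_induction with
  | zero => simp
  | add x y _ _ hx hy => rw [map_add, hx, hy, add_zero]
  | smul_mem r x hx =>
    obtain ⟨j, hj, hx⟩ := hx
    rw [smul_eq_mul, mul_comm, homogeneousComponent_mul_of_lt hx _ (by omega)]

lemma exists_HFq_eq_zero {K : Ideal (MvPolynomial ι k)} (hK : HomI K)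
    (h : IsArtinianRing (MvPolynomial ι k ⧸ K)) : ∃ N, HFq k K N = 0 := by
  let S : ℕ → Ideal (MvPolynomial ι k) := fun m =>
    Ideal.span {p | ∃ j, m ≤ j ∧ p.IsHomogeneous j}
  let s : ℕ →o (Ideal (MvPolynomial ι k ⧸ K))ᵒᵈ :=
    { toFun := fun m => OrderDual.toDual ((S m).map (Ideal.Quotient.mk K))
      monotone' := fun m m' hm => by
        refine Ideal.map_mono (Ideal.span_mono ?_)
        rintro p ⟨j, hj, hp⟩
        exact ⟨j, hm.trans hj, hp⟩ }
  obtain ⟨N, hN⟩ := IsArtinian.monotone_stabilizes s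
  refine ⟨N, HFq_eq_zero_iff.2 fun p hp => ?_⟩
  have h1 : (S N).map (Ideal.Quotient.mk K) = (S (N + 1)).map (Ideal.Quotient.mk K) :=
    hN (N + 1) (by omega)
  have h2 : Ideal.Quotient.mk K p ∈ (S (N + 1)).map (Ideal.Quotient.mk K) := by
    rw [← h1]
    exact Ideal.mem_map_of_mem _ (Ideal.subset_span ⟨N, le_rfl, hp⟩)
  rw [Ideal.mem_quotient_iff_mem_sup] at h2
  obtain ⟨a, ha, b, hb, hab⟩ := Submodule.mem_sup.1 h2
  have h3 : homogeneousComponent N a = 0 := homogeneousComponent_eq_zero_of_mem_span ha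
  have h4 := hK b hb N
  have h5 := congrArg (homogeneousComponent N) hab
  rw [map_add, h3, zero_add, homogeneousComponent_eq_self hp] at h5
  rwa [← h5]

lemma finite_of_HFq_eq_zero {K : Ideal (MvPolynomial ι k)} {N : ℕ} (h : HFq k K N = 0) :
    Module.Finite k (MvPolynomial ι k ⧸ K) := by
  have : (⊤ : Submodule k (MvPolynomial ι k ⧸ K)) = ⨆ m ∈ Finset.range N, qComp k K m := by
    refine le_antisymm (fun x _ => ?_) le_top
    obtain ⟨p, rfl⟩ := Ideal.Quotient.mk_surjective x
    rw [← sum_homogeneousComponent p, map_sum]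
    refine sum_mem fun i _ => ?_
    rcases lt_or_ge i N with hi | hi
    · exact Submodule.mem_iSup_of_mem i (Submodule.mem_iSup_of_mem (by simpa using hi)
        ⟨_, homogeneousComponent_isHomogeneous i p, rfl⟩)
    · rw [Ideal.Quotient.eq_zero_iff_mem.2
        (HFq_eq_zero_iff.1 (HFq_eq_zero_of_le h hi) _ (homogeneousComponent_isHomogeneous i p))]
      exact zero_mem _
  refine ⟨?_⟩
  rw [this]
  exact Submodule.fg_biSup _ _ fun m _ => Module.Finite.iff_fg.1 (finiteDimensional_qComp K m)

lemma isArtinianRing_of_HFq_eq_zero {K : Ideal (MvPolynomial ι k)} {N : ℕ} (h : HFq k K N = 0) :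
    IsArtinianRing (MvPolynomial ι k ⧸ K) := by
  have := finite_of_HFq_eq_zero h
  exact IsArtinianRing.of_finite k _

end GenericReduction

section LinkIdeals

variable {k}

/-- The exponent of the squarefree monomial `x_F`. -/
def expo (F : Finset (Fin n)) : Fin n →₀ ℕ := ∑ i ∈ F, Finsupp.single i 1

lemma xFace_eq (F : Finset (Fin n)) : xFace k F = monomial (expo F) 1 := by
  unfold xFace expo
  rw [monomial_sum_one]
  rfl

lemma expo_apply (F : Finset (Fin n)) (i : Fin n) : expo F i = if i ∈ F then 1 else 0 := by
  unfold expo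
  rw [Finsupp.finsetSum_apply]
  simp [Finsupp.single_apply]

lemma support_expo_add (F : Finset (Fin n)) (u : Fin n →₀ ℕ) :
    (expo F + u).support = F ∪ u.support := by
  ext i
  simp only [Finsupp.mem_support_iff, Finsupp.add_apply, expo_apply, Finset.mem_union]
  split_ifs with h <;> simp [h]

lemma mem_srIdeal {D : SC n} {p : MvPolynomial (Fin n) k} :
    p ∈ srIdeal k D ↔ ∀ u ∈ p.support, u.support ∉ D.faces := by
  have h : srIdeal k D = Ideal.span ((fun s => monomial s (1 : k)) ''
      (expo '' {F : Finset (Fin n) | F ∉ D.faces})) := by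
    unfold srIdeal
    congr 1
    ext p
    simp only [Set.mem_image, Set.mem_ofPred_eq, exists_exists_and_eq_and]
    refine exists_congr fun s => and_congr_right fun _ => ?_
    rw [← xFace_eq, eq_comm]
    rfl
  rw [h, mem_ideal_span_monomial_image]
  refine forall₂_congr fun u _ => ⟨?_, fun hu => ⟨_, ⟨u.support, hu, rfl⟩, ?_⟩⟩
  · rintro ⟨_, ⟨F, hF, rfl⟩, hle⟩ hu
    refine hF (D.down_closed _ hu F fun i hi => ?_)
    have := hle i
    rw [expo_apply, if_pos hi] at this
    exact Finsupp.mem_support_iff.2 (by omega)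
  · intro i
    rw [expo_apply]
    split_ifs with hi
    · exact Nat.one_le_iff_ne_zero.2 (Finsupp.mem_support_iff.1 hi)
    · exact Nat.zero_le _

lemma mem_linkIdeal' {D : SC n} {F : Finset (Fin n)} {p : MvPolynomial (Fin n) k} :
    p ∈ linkIdeal k D F ↔ xFace k F * p ∈ srIdeal k D := by
  unfold linkIdeal
  rw [Ideal.mem_colon_span_singleton, mul_comm]

lemma mem_linkIdeal {D : SC n} {F : Finset (Fin n)} {p : MvPolynomial (Fin n) k} :
    p ∈ linkIdeal k D F ↔ ∀ u ∈ p.support, F ∪ u.support ∉ D.faces := by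
  rw [mem_linkIdeal', mem_srIdeal, xFace_eq]
  constructor
  · intro h u hu
    rw [← support_expo_add]
    refine h _ ?_
    rw [mem_support_iff, coeff_monomial_mul, one_mul]
    exact mem_support_iff.1 hu
  · intro h u hu
    rw [mem_support_iff, coeff_monomial_mul'] at hu
    split_ifs at hu with hle
    · obtain ⟨w, rfl⟩ := exists_add_of_le hle
      rw [add_tsub_cancel_left, one_mul] at hu
      rw [support_expo_add]
      exact h w (mem_support_iff.2 hu)
    · exact absurd rfl hu

lemma linkIdeal_empty (D : SC n) : linkIdeal k D ∅ = srIdeal k D := by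
  ext p
  rw [mem_linkIdeal, mem_srIdeal]
  simp

lemma homI_linkIdeal (D : SC n) (F : Finset (Fin n)) : HomI (linkIdeal k D F) := by
  intro p hp m
  rw [mem_linkIdeal] at hp ⊢
  intro u hu
  refine hp u ?_
  rw [mem_support_iff, coeff_homogeneousComponent] at hu
  rw [mem_support_iff]
  intro h0
  simp [h0] at hu

lemma xFace_mul_mem_linkIdeal {D : SC n} {F G : Finset (Fin n)} {p : MvPolynomial (Fin n) k} :
    xFace k F * p ∈ linkIdeal k D G ↔ p ∈ linkIdeal k D (F ∪ G) := by
  rw [mem_linkIdeal, mem_linkIdeal, xFace_eq]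
  constructor
  · intro h u hu
    have := h (expo F + u) (by
      rw [mem_support_iff, coeff_monomial_mul, one_mul]
      exact mem_support_iff.1 hu)
    rw [support_expo_add] at this
    rwa [Finset.union_comm F G, Finset.union_assoc]
  · intro h u hu
    rw [mem_support_iff, coeff_monomial_mul'] at hu
    split_ifs at hu with hle
    · obtain ⟨w, rfl⟩ := exists_add_of_le hle
      rw [add_tsub_cancel_left, one_mul] at hu
      rw [support_expo_add, ← Finset.union_assoc, Finset.union_comm G F]
      exact h w (mem_support_iff.2 hu)
    · exact absurd rfl hu

lemma xFace_singleton (i : Fin n) : xFace k {i} = X i := by simp [xFace]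

lemma X_mul_mem_linkIdeal {D : SC n} {G : Finset (Fin n)} {i : Fin n}
    {p : MvPolynomial (Fin n) k} :
    X i * p ∈ linkIdeal k D G ↔ p ∈ linkIdeal k D (insert i G) := by
  rw [← xFace_singleton, xFace_mul_mem_linkIdeal, Finset.insert_eq]

lemma linkIdeal_mono (D : SC n) {F G : Finset (Fin n)} (h : F ⊆ G) :
    linkIdeal k D F ≤ linkIdeal k D G := by
  intro p hp
  rw [mem_linkIdeal] at hp ⊢
  exact fun u hu hG => hp u hu (D.down_closed _ hG _ (Finset.union_subset_union_left h))

lemma one_mem_linkIdeal {D : SC n} {F : Finset (Fin n)} :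
    (1 : MvPolynomial (Fin n) k) ∈ linkIdeal k D F ↔ F ∉ D.faces := by
  classical
  rw [mem_linkIdeal]
  have : (1 : MvPolynomial (Fin n) k).support = {0} := by
    rw [← C_1, ← monomial_zero', support_monomial, if_neg one_ne_zero]
  simp [this]

lemma X_mem_linkIdeal {D : SC n} {F : Finset (Fin n)} {i : Fin n} :
    (X i : MvPolynomial (Fin n) k) ∈ linkIdeal k D F ↔ insert i F ∉ D.faces := by
  rw [← one_mem_linkIdeal (k := k), ← X_mul_mem_linkIdeal, mul_one]

/-- The vectors vanishing on `F`. -/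
def FreeOf (F : Finset (Fin n)) (l : List (Fin n → k)) : Prop := ∀ v ∈ l, ∀ i ∈ F, v i = 0

lemma linForm_mul_divMonomial {F : Finset (Fin n)} {v : Fin n → k} (hv : ∀ i ∈ F, v i = 0)
    (b : MvPolynomial (Fin n) k) :
    (linForm k v * b).divMonomial (expo F) = linForm k v * b.divMonomial (expo F) := by
  classical
  ext u
  rw [coeff_divMonomial]
  unfold linForm
  rw [Finset.sum_mul, Finset.sum_mul, coeff_sum, coeff_sum]
  refine Finset.sum_congr rfl fun j _ => ?_
  rw [mul_assoc, mul_assoc, coeff_C_mul, coeff_C_mul]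
  by_cases hj : j ∈ F
  · rw [hv j hj, zero_mul, zero_mul]
  congr 1
  rw [coeff_X_mul', coeff_X_mul', coeff_divMonomial, support_expo_add]
  by_cases hu : j ∈ u.support
  · rw [if_pos (Finset.mem_union_right _ hu), if_pos hu]
    congr 1
    rw [add_tsub_assoc_of_le]
    rw [Finsupp.single_le_iff]
    exact Nat.one_le_iff_ne_zero.2 (Finsupp.mem_support_iff.1 hu)
  · rw [if_neg (by simp only [Finset.mem_union, not_or]; exact ⟨hj, hu⟩), if_neg hu]

lemma mem_idl_iff {ι : Type} [Fintype ι] {J : Ideal (MvPolynomial ι k)}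
    {l : List (MvPolynomial ι k)} {p : MvPolynomial ι k} :
    p ∈ idl J l ↔ ∃ b : Fin l.length → MvPolynomial ι k, p - ∑ j, l[j] * b j ∈ J := by
  have hl : ({f | f ∈ l} : Set (MvPolynomial ι k)) = Set.range (fun j : Fin l.length => l[j]) := by
    ext f
    simp [List.mem_iff_get, eq_comm]
  unfold idl
  rw [hl, Submodule.mem_sup]
  constructor
  · rintro ⟨a, ha, z, hz, rfl⟩
    obtain ⟨b, rfl⟩ := (Submodule.mem_span_range_iff_exists_fun _).1 hz
    exact ⟨b, by simpa [mul_comm] using ha⟩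
  · rintro ⟨b, hb⟩
    exact ⟨_, hb, ∑ j, l[j] * b j,
      sum_mem fun j _ => Ideal.mul_mem_right _ _ (Ideal.subset_span ⟨j, rfl⟩), by ring⟩

lemma linList_map (l : List (ι → k)) : LinList (l.map (linForm k)) := by
  intro f hf
  obtain ⟨v, _, rfl⟩ := List.mem_map.1 hf
  exact linForm_isHomogeneous v

/-- Colon ideals by `x_F` commute with adding linear forms not involving the variables in `F`. -/
lemma xFace_mul_mem_idl {D : SC n} {F G : Finset (Fin n)} {l : List (Fin n → k)}
    (hl : FreeOf F l) {p : MvPolynomial (Fin n) k} :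
    xFace k F * p ∈ idl (linkIdeal k D G) (l.map (linForm k)) ↔
      p ∈ idl (linkIdeal k D (F ∪ G)) (l.map (linForm k)) := by
  rw [mem_idl_iff, mem_idl_iff]
  constructor
  · rintro ⟨b, hb⟩
    refine ⟨fun j => (b j).divMonomial (expo F), ?_⟩
    have h1 : p - ∑ j, (l.map (linForm k))[j] * (b j).divMonomial (expo F) =
        (xFace k F * p - ∑ j, (l.map (linForm k))[j] * b j).divMonomial (expo F) := by
      have hsub : ∀ x y : MvPolynomial (Fin n) k, (x - y).divMonomial (expo F) =
          x.divMonomial (expo F) - y.divMonomial (expo F) := by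
        intro x y; ext u; simp only [coeff_divMonomial, coeff_sub]
      have hsum : ∀ y : Fin (l.map (linForm k)).length → MvPolynomial (Fin n) k,
          (∑ j, y j).divMonomial (expo F) = ∑ j, (y j).divMonomial (expo F) := by
        intro y; ext u; simp only [coeff_divMonomial, coeff_sum]
      rw [hsub, xFace_eq, divMonomial_monomial_mul, hsum]
      congr 1
      refine Finset.sum_congr rfl fun j _ => ?_
      simp only [Fin.getElem_fin, List.getElem_map]
      rw [linForm_mul_divMonomial (hl _ (List.getElem_mem _))]
    rw [h1]
    rw [mem_linkIdeal] at hb ⊢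
    intro u hu
    rw [mem_support_iff, coeff_divMonomial] at hu
    have := hb _ (mem_support_iff.2 hu)
    rwa [support_expo_add, ← Finset.union_assoc, Finset.union_comm G F] at this
  · rintro ⟨b, hb⟩
    refine ⟨fun j => xFace k F * b j, ?_⟩
    rw [← xFace_mul_mem_linkIdeal] at hb
    convert hb using 1
    rw [mul_sub, Finset.mul_sum]
    congr 1
    exact Finset.sum_congr rfl fun j _ => by ring

lemma reg_linkIdeal {D : SC n} {F G : Finset (Fin n)} {l : List (Fin n → k)}
    (hl : FreeOf F l) (h : Reg (linkIdeal k D G) (l.map (linForm k))) :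
    Reg (linkIdeal k D (F ∪ G)) (l.map (linForm k)) := by
  rw [reg_iff_take] at h ⊢
  intro i hi r hr
  have hl' : FreeOf F (l.take i) := fun v hv => hl v (List.mem_of_mem_take hv)
  rw [← List.map_take] at hr ⊢
  rw [← xFace_mul_mem_idl hl'] at hr ⊢
  rw [List.map_take]
  refine h i hi _ ?_
  rw [← List.map_take]
  convert hr using 1
  ring

lemma X_regular_idl {D : SC n} {F : Finset (Fin n)} {l : List (Fin n → k)} {i : Fin n}
    (hi : i ∈ F) (hl : ∀ v ∈ l, v i = 0) (r : MvPolynomial (Fin n) k)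
    (h : X i * r ∈ idl (linkIdeal k D F) (l.map (linForm k))) :
    r ∈ idl (linkIdeal k D F) (l.map (linForm k)) := by
  have hl' : FreeOf {i} l := fun v hv j hj => by
    rw [Finset.mem_singleton.1 hj]; exact hl v hv
  rw [← xFace_singleton, xFace_mul_mem_idl hl', Finset.singleton_union,
    Finset.insert_eq_of_mem hi] at h
  exact h

/-- The coordinate vectors of a list of indices. -/
def units (l : List (Fin n)) : List (Fin n → k) := l.map fun i => Pi.single i 1

lemma reg_units {D : SC n} {F : Finset (Fin n)} {g : List (Fin n → k)} {l : List (Fin n)}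
    (hg : FreeOf F g) (hl : ∀ i ∈ l, i ∈ F) (hn : l.Nodup) :
    Reg (idl (linkIdeal k D F) (g.map (linForm k))) ((units (k := k) l).map (linForm k)) := by
  rw [reg_iff_take]
  intro i hi r hr
  rw [← idl_append, ← List.map_take, ← List.map_append] at hr ⊢
  have hi' : i < l.length := by simpa [units] using hi
  have he : ((units (k := k) l).map (linForm k))[i] = X l[i] := by
    simp [units, linForm_single]
  rw [he] at hr
  refine X_regular_idl (hl _ (List.getElem_mem hi')) ?_ r hr
  intro v hv
  rcases List.mem_append.1 hv with hv | hv
  · exact hg v hv _ (hl _ (List.getElem_mem hi'))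
  · rw [units, ← List.map_take] at hv
    obtain ⟨j, hj, rfl⟩ := List.mem_map.1 hv
    rw [Pi.single_apply, if_neg]
    rintro rfl
    obtain ⟨m, hm, hm'⟩ := List.mem_iff_getElem.1 hj
    rw [List.getElem_take] at hm'
    have := (List.Nodup.getElem_inj_iff hn).1 hm'
    simp at hm
    omega

/-- The regular sequence on the link consisting of `F`-free forms and the variables of `F`. -/
lemma reg_append_units {D : SC n} {F : Finset (Fin n)} {g : List (Fin n → k)}
    (hg : FreeOf F g) (h : Reg (srIdeal k D) (g.map (linForm k))) {l : List (Fin n)}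
    (hl : ∀ i ∈ l, i ∈ F) (hn : l.Nodup) :
    Reg (linkIdeal k D F) ((g ++ units l).map (linForm k)) := by
  rw [List.map_append, reg_append]
  rw [← linkIdeal_empty] at h
  refine ⟨?_, reg_units hg hl hn⟩
  simpa using reg_linkIdeal hg h

lemma reg_sup_X {D : SC n} {F : Finset (Fin n)} {g : List (Fin n → k)}
    (hg : FreeOf F g) (h : Reg (srIdeal k D) (g.map (linForm k))) {i : Fin n} {l : List (Fin n)}
    (hl : ∀ j ∈ i :: l, j ∈ F) (hn : (i :: l).Nodup) :
    Reg (linkIdeal k D F ⊔ Ideal.span {X i}) ((g ++ units l).map (linForm k)) := by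
  have h1 := reg_append_units hg h hl hn
  have h2 : Reg (linkIdeal k D F) ((Pi.single i 1 :: (g ++ units l)).map (linForm k)) := by
    refine reg_of_idl_eq (homI_linkIdeal D F) (linList_map _) (linList_map _) ?_ h1 ?_
    · simp [units]; omega
    · unfold idl
      congr 2
      ext f
      simp only [units, List.map_cons, List.map_append, Set.mem_ofPred_eq, List.mem_cons,
        List.mem_append]
      tauto
  rw [List.map_cons, linForm_single] at h2
  exact h2.2

end LinkIdeals

section LinearSystems

variable {k}

/-- The ideal `J` enlarged by the linear forms with coefficients in the subspace `W`. -/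
def idV (J : Ideal (MvPolynomial ι k)) (W : Submodule k (ι → k)) : Ideal (MvPolynomial ι k) :=
  J ⊔ Ideal.span (linForm k '' (W : Set (ι → k)))

lemma le_idV (J : Ideal (MvPolynomial ι k)) (W : Submodule k (ι → k)) : J ≤ idV J W :=
  le_sup_left

lemma linForm_mem_idV (J : Ideal (MvPolynomial ι k)) {W : Submodule k (ι → k)} {w : ι → k}
    (hw : w ∈ W) : linForm k w ∈ idV J W :=
  Ideal.mem_sup_right (Ideal.subset_span ⟨w, hw, rfl⟩)

lemma idV_mono {J J' : Ideal (MvPolynomial ι k)} (h : J ≤ J') (W : Submodule k (ι → k)) :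
    idV J W ≤ idV J' W := sup_le_sup_right h _

lemma homI_idV {J : Ideal (MvPolynomial ι k)} (hJ : HomI J) (W : Submodule k (ι → k)) :
    HomI (idV J W) := by
  refine hJ.sup (HomI.span ?_)
  rintro _ ⟨w, _, rfl⟩
  exact ⟨1, linForm_isHomogeneous w⟩

lemma span_linForm_image (S : Set (ι → k)) :
    Ideal.span (linForm k '' (Submodule.span k S : Set (ι → k))) =
      Ideal.span (linForm k '' S) := by
  refine le_antisymm (Ideal.span_le.2 ?_) (Ideal.span_mono (Set.image_mono Submodule.subset_span))
  rintro _ ⟨w, hw, rfl⟩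
  have h : Submodule.span k S ≤
      ((Ideal.span (linForm k '' S)).restrictScalars k).comap linFormL :=
    Submodule.span_le.2 fun v hv => Ideal.subset_span ⟨v, hv, rfl⟩
  exact h hw

lemma idl_map_linForm (J : Ideal (MvPolynomial ι k)) (l : List (ι → k)) :
    idl J (l.map (linForm k)) = idV J (Submodule.span k {v | v ∈ l}) := by
  unfold idl idV
  rw [span_linForm_image]
  congr 2
  ext f
  simp

/-- The span of the coefficient vectors of a tuple of linear forms. -/
def rowSpan {d : ℕ} (c : Fin d × ι → k) : Submodule k (ι → k) :=
  Submodule.span k (Set.range fun j : Fin d => fun i => c (j, i))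

lemma redIdeal_eq_idV (J : Ideal (MvPolynomial ι k)) {d : ℕ} (c : Fin d × ι → k) :
    redIdeal k J c = idV J (rowSpan c) := by
  unfold redIdeal idV rowSpan
  rw [span_linForm_image, ← Set.range_comp]
  rfl

lemma exists_list_span (U : Submodule k (ι → k)) :
    ∃ l : List (ι → k), l.length = Module.finrank k U ∧ Submodule.span k {v | v ∈ l} = U := by
  let b := Module.finBasis k U
  refine ⟨List.ofFn fun j => (b j : ι → k), by simp, ?_⟩
  have h : {v | v ∈ List.ofFn fun j => (b j : ι → k)} = U.subtype '' Set.range b := by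
    ext v
    simp [List.mem_ofFn']
  rw [h, ← Submodule.map_span, b.span_eq, Submodule.map_top, Submodule.range_subtype]

lemma exists_list_span_append {U W : Submodule k (ι → k)} (h : U ≤ W) :
    ∃ l l' : List (ι → k), l.length = Module.finrank k U ∧ Submodule.span k {v | v ∈ l} = U ∧
      (l ++ l').length = Module.finrank k W ∧ Submodule.span k {v | v ∈ l ++ l'} = W := by
  obtain ⟨U', hU'⟩ := exists_isCompl U
  have hs : U ⊔ (U' ⊓ W) = W := by
    rw [← sup_inf_assoc_of_le U' h, hU'.sup_eq_top, top_inf_eq]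
  have hd : U ⊓ (U' ⊓ W) = ⊥ := by rw [← inf_assoc, hU'.inf_eq_bot, bot_inf_eq]
  obtain ⟨l, hl, hlU⟩ := exists_list_span U
  obtain ⟨l', hl', hlU'⟩ := exists_list_span (U' ⊓ W)
  refine ⟨l, l', hl, hlU, ?_, ?_⟩
  · rw [List.length_append, hl, hl']
    have := Submodule.finrank_sup_add_finrank_inf_eq U (U' ⊓ W)
    rw [hs, hd, finrank_bot] at this
    omega
  · have : {v | v ∈ l ++ l'} = {v | v ∈ l} ∪ {v | v ∈ l'} := by ext; simp
    rw [this, Submodule.span_union, hlU, hlU', hs]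

/-- Restriction to the coordinates in `F` maps `W` onto `k^F`. -/
def Full (W : Submodule k (Fin n → k)) (F : Finset (Fin n)) : Prop :=
  ∀ y : Fin n → k, ∃ w ∈ W, ∀ i ∈ F, w i = y i

/-- The vectors of `W` vanishing on `F`. -/
def vanish (W : Submodule k (Fin n → k)) (F : Finset (Fin n)) : Submodule k (Fin n → k) where
  carrier := {w | w ∈ W ∧ ∀ i ∈ F, w i = 0}
  add_mem' := fun ha hb => ⟨add_mem ha.1 hb.1, fun i hi => by simp [ha.2 i hi, hb.2 i hi]⟩
  zero_mem' := ⟨zero_mem _, fun _ _ => rfl⟩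
  smul_mem' := fun a _ hb => ⟨W.smul_mem a hb.1, fun i hi => by simp [hb.2 i hi]⟩

lemma mem_vanish {W : Submodule k (Fin n → k)} {F : Finset (Fin n)} {w : Fin n → k} :
    w ∈ vanish W F ↔ w ∈ W ∧ ∀ i ∈ F, w i = 0 := Iff.rfl

lemma vanish_le (W : Submodule k (Fin n → k)) (F : Finset (Fin n)) : vanish W F ≤ W :=
  fun _ h => h.1

lemma finrank_vanish {W : Submodule k (Fin n → k)} {F : Finset (Fin n)} (h : Full W F) :
    Module.finrank k (vanish W F) + F.card = Module.finrank k W := by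
  classical
  let ρ : W →ₗ[k] (F → k) := LinearMap.pi fun i => LinearMap.proj (i : Fin n) ∘ₗ W.subtype
  have h1 := LinearMap.finrank_range_add_finrank_ker ρ
  have h2 : LinearMap.range ρ = ⊤ := by
    rw [LinearMap.range_eq_top]
    intro y
    obtain ⟨w, hw, hy⟩ := h fun i => if hi : i ∈ F then y ⟨i, hi⟩ else 0
    refine ⟨⟨w, hw⟩, ?_⟩
    ext i
    have := hy i i.2
    simpa [ρ] using this
  have h3 : vanish W F = (LinearMap.ker ρ).map W.subtype := by
    ext w
    rw [mem_vanish]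
    constructor
    · rintro ⟨hw, h0⟩
      refine ⟨⟨w, hw⟩, ?_, rfl⟩
      ext i
      exact h0 i i.2
    · rintro ⟨⟨w, hw⟩, h0, rfl⟩
      exact ⟨hw, fun i hi => congrFun (show ρ ⟨w, hw⟩ = 0 from h0) ⟨i, hi⟩⟩
  rw [h2, finrank_top, Module.finrank_fintype_fun_eq_card, Fintype.card_coe] at h1
  rw [h3, Submodule.finrank_map_subtype_eq]
  omega

/-- A subspace cutting `k[D]` down to an Artinian ring surjects onto `k^F` for all faces `F`. -/
lemma full_of_HFq_eq_zero {D : SC n} {W : Submodule k (Fin n → k)} {N : ℕ}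
    (h : HFq k (idV (srIdeal k D) W) N = 0) {F : Finset (Fin n)} (hF : F ∈ D.faces) :
    Full W F := by
  classical
  let ρ : W →ₗ[k] (F → k) := LinearMap.pi fun i => LinearMap.proj (i : Fin n) ∘ₗ W.subtype
  suffices hs : LinearMap.range ρ = ⊤ by
    intro y
    obtain ⟨w, hw⟩ := LinearMap.range_eq_top.1 hs fun i => y i
    exact ⟨w, w.2, fun i hi => congrFun hw ⟨i, hi⟩⟩
  by_contra hne
  obtain ⟨φ, hφ0, hφ⟩ := Submodule.exists_le_ker_of_lt_top _ (lt_top_iff_ne_top.2 hne)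
  refine hφ0 (LinearMap.pi_ext' fun i => LinearMap.ext_ring ?_)
  let p : Fin n → k := fun i => if hi : i ∈ F then φ (Pi.single ⟨i, hi⟩ 1) else 0
  have hp : ∀ w ∈ W, ∑ i, w i * p i = 0 := by
    intro w hw
    have h1 : φ (ρ ⟨w, hw⟩) = 0 := hφ ⟨_, rfl⟩
    have h2 : ρ ⟨w, hw⟩ = ∑ i : F, w i • (Pi.single i 1 : F → k) := by
      ext j
      simp [ρ, Finset.sum_apply, Pi.single_apply]
    rw [h2, map_sum] at h1
    rw [← h1, ← Finset.sum_subset (Finset.subset_univ F), ← Finset.sum_coe_sort]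
    · refine Finset.sum_congr rfl fun i _ => ?_
      simp [p]
    · intro i _ hi
      simp [p, hi]
  have hev : idV (srIdeal k D) W ≤ RingHom.ker (eval p) := by
    refine sup_le (Ideal.span_le.2 ?_) (Ideal.span_le.2 ?_)
    · rintro _ ⟨s, hs, rfl⟩
      have : ∃ j ∈ s, j ∉ F := by
        by_contra! hc
        exact hs (D.down_closed F hF s hc)
      obtain ⟨j, hj, hjF⟩ := this
      rw [SetLike.mem_coe, RingHom.mem_ker, map_prod]
      exact Finset.prod_eq_zero hj (by simp [p, hjF])
    · rintro _ ⟨w, hw, rfl⟩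
      rw [SetLike.mem_coe, RingHom.mem_ker]
      simpa [linForm] using hp w hw
  have h1 := hev (HFq_eq_zero_iff.1 h (X i.1 ^ N) (isHomogeneous_X_pow _ _))
  rw [RingHom.mem_ker, map_pow, eval_X] at h1
  have h2 := eq_zero_of_pow_eq_zero h1
  simpa [p] using h2

/-- Linear forms supported on complements of faces: high degrees vanish. -/
lemma monomial_mem_idV {D : SC n} {W : Submodule k (Fin n → k)}
    (hW : ∀ F ∈ D.faces, Full W F) {F : Finset (Fin n)} (u : Fin n →₀ ℕ)
    (hu : dimP D < u.degree + F.card) :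
    (monomial u (1 : k)) ∈ idV (linkIdeal k D F) W := by
  classical
  induction hN : n - (F ∪ u.support).card using Nat.strong_induction_on generalizing u with
  | _ N ih =>
  by_cases hG : F ∪ u.support ∈ D.faces
  · have hcard : (F ∪ u.support).card ≤ dimP D := Finset.le_sup (f := Finset.card) hG
    have hi : ∃ i ∈ u.support, i ∈ F ∨ 2 ≤ u i := by
      by_contra! hc
      have h1 : Disjoint F u.support := by
        rw [Finset.disjoint_right]
        exact fun i hi => (hc i hi).1
      have h2 : u.degree ≤ u.support.card := by
        rw [Finsupp.degree_apply, Finset.card_eq_sum_ones]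
        refine Finset.sum_le_sum fun i hi => ?_
        have := (hc i hi).2
        omega
      rw [Finset.card_union_of_disjoint h1] at hcard
      omega
    obtain ⟨i, hiu, hi⟩ := hi
    obtain ⟨u', rfl⟩ : ∃ u', u = Finsupp.single i 1 + u' := exists_add_of_le (by
      rw [Finsupp.single_le_iff]
      exact Nat.one_le_iff_ne_zero.2 (Finsupp.mem_support_iff.1 hiu))
    have hG' : F ∪ (Finsupp.single i 1 + u').support ⊆ F ∪ u'.support := by
      intro j hj
      rw [Finset.mem_union] at hj ⊢
      rcases hj with hj | hj
      · exact Or.inl hj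
      · by_cases hji : j = i
        · subst hji
          rcases hi with hi | hi
          · exact Or.inl hi
          · right
            rw [Finsupp.mem_support_iff]
            simp at hi
            omega
        · right
          simpa [Finsupp.single_apply, Ne.symm hji] using hj
    obtain ⟨w, hw, hwG⟩ := hW _ hG (Pi.single i 1)
    have hiG : i ∈ F ∪ (Finsupp.single i 1 + u').support := Finset.mem_union_right _ hiu
    have h1 : monomial (Finsupp.single i 1 + u') (1 : k) =
        linForm k w * monomial u' 1 -
          ∑ j ∈ Finset.univ.erase i, C (w j) * monomial (Finsupp.single j 1 + u') 1 := by
      have h3 : ∀ j, C (w j) * monomial (Finsupp.single j 1 + u') 1 =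
          C (w j) * X j * monomial u' (1 : k) := by
        intro j
        rw [mul_assoc, X, monomial_mul, one_mul]
      simp only [h3]
      unfold linForm
      rw [Finset.sum_mul, ← Finset.add_sum_erase _ _ (Finset.mem_univ i), hwG i hiG,
        Pi.single_eq_same, add_sub_cancel_right, C_1, one_mul, X, monomial_mul, one_mul]
    rw [h1]
    refine sub_mem (Ideal.mul_mem_right _ _ (linForm_mem_idV _ hw)) (sum_mem fun j hj => ?_)
    have hji := Finset.ne_of_mem_erase hj
    by_cases hjG : j ∈ F ∪ (Finsupp.single i 1 + u').support
    · rw [hwG j hjG, Pi.single_apply, if_neg hji, C_0, zero_mul]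
      exact zero_mem _
    · refine Ideal.mul_mem_left _ _ (ih _ ?_ _ ?_ rfl)
      · have hlt : (F ∪ (Finsupp.single i 1 + u').support).card <
            (F ∪ (Finsupp.single j 1 + u').support).card := by
          refine Finset.card_lt_card ⟨?_, ?_⟩
          · refine hG'.trans (Finset.union_subset_union_right ?_)
            intro x hx
            rw [Finsupp.mem_support_iff] at hx ⊢
            simp
            tauto
          · intro hss
            exact hjG (hss (Finset.mem_union_right _ (by simp)))
        have hle : (F ∪ (Finsupp.single j 1 + u').support).card ≤ n := by
          simpa using Finset.card_le_univ (F ∪ (Finsupp.single j 1 + u').support)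
        omega
      · simp only [map_add, Finsupp.degree_single] at hu ⊢
        exact hu
  · refine le_idV _ _ (mem_linkIdeal.2 fun v hv => ?_)
    rw [support_monomial, if_neg one_ne_zero, Finset.mem_singleton] at hv
    rwa [hv]

lemma HFq_idV_eq_zero {D : SC n} {W : Submodule k (Fin n → k)}
    (hW : ∀ F ∈ D.faces, Full W F) {F : Finset (Fin n)} {m : ℕ} (hm : dimP D < m + F.card) :
    HFq k (idV (linkIdeal k D F) W) m = 0 := by
  rw [HFq_eq_zero_iff]
  intro p hp
  rw [p.as_sum]
  refine sum_mem fun u hu => ?_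
  have hdeg : u.degree = m := by
    rw [Finsupp.degree_eq_weight_one]
    exact hp (mem_support_iff.1 hu)
  rw [← mul_one (coeff u p), ← C_mul_monomial]
  exact Ideal.mul_mem_left _ _ (monomial_mem_idV hW u (by omega))

end LinearSystems

section Parameters

variable {k}

/-- `W` is the span of a linear system of parameters which is regular on all links of `D`. -/
structure LSOP (D : SC n) (W : Submodule k (Fin n → k)) : Prop where
  finrank_eq : Module.finrank k W = dimP D
  full : ∀ F ∈ D.faces, Full W F
  reg : ∀ F ∈ D.faces, ∀ l : List (Fin n → k), l.length = dimP D →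
    Submodule.span k {v | v ∈ l} = W → Reg (linkIdeal k D F) (l.map (linForm k))

lemma finrank_eq_of_full {D : SC n} {W : Submodule k (Fin n → k)} (h0 : ∅ ∈ D.faces)
    (hW : ∀ F ∈ D.faces, Full W F) (hle : Module.finrank k W ≤ dimP D) :
    Module.finrank k W = dimP D := by
  obtain ⟨F, hF, hFd⟩ := Finset.exists_mem_eq_sup D.faces ⟨_, h0⟩ Finset.card
  have h1 := finrank_vanish (hW F hF)
  have h2 : dimP D = F.card := hFd
  omega

lemma exists_free_list {D : SC n} {W : Submodule k (Fin n → k)} {F : Finset (Fin n)}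
    (hF : Full W F) {J : Ideal (MvPolynomial (Fin n) k)} (hJ : HomI J)
    (hd : Module.finrank k W = dimP D) {l : List (Fin n → k)} (hl : l.length = dimP D)
    (hlW : Submodule.span k {v | v ∈ l} = W) (hr : Reg J (l.map (linForm k))) :
    ∃ g : List (Fin n → k), FreeOf F g ∧ g.length + F.card = dimP D ∧
      Submodule.span k {v | v ∈ g} = vanish W F ∧ Reg J (g.map (linForm k)) := by
  obtain ⟨g, l', hg, hgs, hgl, hgW⟩ := exists_list_span_append (vanish_le W F)
  have h1 := finrank_vanish hF
  refine ⟨g, ?_, by omega, hgs, ?_⟩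
  · intro v hv
    have : v ∈ vanish W F := by rw [← hgs]; exact Submodule.subset_span hv
    exact this.2
  · have h2 : Reg J ((g ++ l').map (linForm k)) := by
      refine reg_of_idl_eq hJ (linList_map _) (linList_map _) ?_ hr ?_
      · rw [List.length_map, List.length_map, hl, hgl, hd]
      · rw [idl_map_linForm, idl_map_linForm, hgW, hlW]
    rw [List.map_append, reg_append] at h2
    exact h2.1

/-- The rows of a coefficient matrix. -/
def rows {d : ℕ} (c : Fin d × ι → k) : List (ι → k) := List.ofFn fun j => fun i => c (j, i)

lemma map_rows {d : ℕ} (c : Fin d × ι → k) : (rows c).map (linForm k) = forms c := by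
  unfold rows forms
  rw [List.map_ofFn]
  rfl

lemma length_rows {d : ℕ} (c : Fin d × ι → k) : (rows c).length = d := List.length_ofFn

lemma span_rows {d : ℕ} (c : Fin d × ι → k) :
    Submodule.span k {v | v ∈ rows c} = rowSpan c := by
  unfold rowSpan rows
  congr 1
  ext v
  exact List.mem_ofFn' _ _

lemma finrank_rowSpan_le {d : ℕ} (c : Fin d × ι → k) : Module.finrank k (rowSpan c) ≤ d := by
  have h := finrank_range_le_card (R := k) (fun (j : Fin d) (i : ι) => c (j, i))
  rw [Fintype.card_fin] at h
  exact h

lemma empty_mem_of_mem {D : SC n} {F : Finset (Fin n)} (hF : F ∈ D.faces) : ∅ ∈ D.faces :=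
  D.down_closed F hF ∅ (Finset.empty_subset F)

lemma length_units (l : List (Fin n)) : (units (k := k) l).length = l.length := by simp [units]

lemma generic_lsop [Infinite k] {D : SC n} (h0 : ∅ ∈ D.faces)
    (hdepth : depthGE k (srIdeal k D) (dimP D))
    (hart : Generic k (Fin (dimP D) × Fin n) fun c =>
      IsArtinianRing (MvPolynomial (Fin n) k ⧸ redIdeal k (srIdeal k D) c)) :
    Generic k (Fin (dimP D) × Fin n) fun c => LSOP D (rowSpan c) := by
  have hI : HomI (srIdeal k D) := by rw [← linkIdeal_empty]; exact homI_linkIdeal D ∅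
  obtain ⟨rs, hrs, hm, hreg⟩ := hdepth
  obtain ⟨l, hl, hlr⟩ := exists_linear_reg (reg_of_isWeaklyRegular hreg.1) hm
  obtain ⟨c₀, hc₀⟩ := exists_forms_eq l (hl.trans hrs)
  obtain ⟨c₁, hc₁⟩ := hart.exists
  obtain ⟨N, hN⟩ := exists_HFq_eq_zero (homI_redIdeal hI c₁) hc₁
  have hg1 : Generic k (Fin (dimP D) × Fin n) fun c => Reg (srIdeal k D) (forms c) ∧
      HFq k (redIdeal k (srIdeal k D) c) N = 0 := by
    refine (generic_reg hI (c₀ := c₀) (hc₀ ▸ hlr) hN).and (generic_HFq_le hI c₁ N) |>.mono ?_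
    rintro c ⟨h1, h2⟩
    rw [hN] at h2
    exact ⟨h1.1, Nat.le_zero.1 h2⟩
  have hfull : ∀ c : Fin (dimP D) × Fin n → k, HFq k (redIdeal k (srIdeal k D) c) N = 0 →
      ∀ F ∈ D.faces, Full (rowSpan c) F := by
    intro c hc F hF
    rw [redIdeal_eq_idV] at hc
    exact full_of_HFq_eq_zero hc hF
  obtain ⟨c, hc, hcN⟩ := hg1.exists
  have hfr := finrank_eq_of_full h0 (hfull c hcN) (finrank_rowSpan_le c)
  have hg2 : Generic k (Fin (dimP D) × Fin n) fun c => ∀ F ∈ D.faces,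
      Reg (linkIdeal k D F) (forms c) := by
    refine Generic.forall_finset _ fun F hF => ?_
    obtain ⟨g, hgF, hgl, -, hgr⟩ := exists_free_list (hfull c hcN F hF) hI hfr
      (length_rows c) (span_rows c) (by rwa [map_rows])
    have h1 := reg_append_units hgF hgr (l := F.toList) (fun i hi => Finset.mem_toList.1 hi)
      F.nodup_toList
    obtain ⟨c₂, hc₂⟩ := exists_forms_eq (d := dimP D) (g ++ units F.toList)
      (by rw [List.length_append, length_units, Finset.length_toList]; exact hgl)
    have h2 : HFq k (redIdeal k (linkIdeal k D F) c) N = 0 := by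
      refine Nat.le_zero.1 (hcN ▸ HFq_le_of_le ?_ N)
      rw [← linkIdeal_empty]
      exact sup_le_sup_right (linkIdeal_mono D (Finset.empty_subset F)) _
    exact (generic_reg (homI_linkIdeal D F) (c₀ := c₂) (hc₂ ▸ h1) h2).mono fun _ h => h.1
  refine (hg1.and hg2).mono fun c hc => ?_
  have hf := hfull c hc.1.2
  refine ⟨finrank_eq_of_full h0 hf (finrank_rowSpan_le c), hf, fun F hF l hl hlW => ?_⟩
  refine reg_of_idl_eq (homI_linkIdeal D F) (linList_forms c) (linList_map _) ?_ (hc.2 F hF) ?_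
  · rw [length_forms, List.length_map, hl]
  · rw [idl_map_linForm, hlW, idl_forms, redIdeal_eq_idV]

namespace LSOP

variable {D : SC n} {W : Submodule k (Fin n → k)}

lemma exists_list (hW : LSOP D W) : ∃ l : List (Fin n → k), l.length = dimP D ∧
    Submodule.span k {v | v ∈ l} = W := by
  obtain ⟨l, hl, hlW⟩ := exists_list_span W
  exact ⟨l, hl.trans hW.finrank_eq, hlW⟩

lemma exists_free (hW : LSOP D W) {F G : Finset (Fin n)} (hF : F ∈ D.faces) (hG : G ∈ D.faces) :
    ∃ g : List (Fin n → k), FreeOf F g ∧ g.length + F.card = dimP D ∧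
      Submodule.span k {v | v ∈ g} = vanish W F ∧ Reg (linkIdeal k D G) (g.map (linForm k)) := by
  obtain ⟨l, hl, hlW⟩ := hW.exists_list
  exact exists_free_list (hW.full F hF) (homI_linkIdeal D G) hW.finrank_eq hl hlW
    (hW.reg G hG l hl hlW)

/-- The Hilbert function modulo a linear system of parameters is independent of the choice. -/
lemma HFq_eq (hW : LSOP D W) {W' : Submodule k (Fin n → k)} (hW' : LSOP D W')
    {F : Finset (Fin n)} (hF : F ∈ D.faces) :
    HFq k (idV (linkIdeal k D F) W) = HFq k (idV (linkIdeal k D F) W') := by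
  obtain ⟨l, hl, hlW⟩ := hW.exists_list
  obtain ⟨l', hl', hlW'⟩ := hW'.exists_list
  have := HFq_eq_of_reg (homI_linkIdeal D F) (linList_map l') (linList_map l)
    (by simp [hl, hl']) (hW'.reg F hF l' hl' hlW') (hW.reg F hF l hl hlW)
  rwa [idl_map_linForm, idl_map_linForm, hlW, hlW'] at this

lemma card_of_facet (hW : LSOP D W) {F : Finset (Fin n)} (hF : F ∈ D.faces)
    (hmax : ∀ i, i ∉ F → insert i F ∉ D.faces) : F.card = dimP D := by
  obtain ⟨g, hgF, hgl, -, hgr⟩ := hW.exists_free hF (empty_mem_of_mem hF)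
  cases g with
  | nil => simpa using hgl
  | cons v g =>
    exfalso
    rw [List.map_cons] at hgr
    have h1 : xFace k F ∈ linkIdeal k D ∅ := by
      refine hgr.1 _ ?_
      rw [mul_comm, xFace_mul_mem_linkIdeal, Finset.union_empty]
      unfold linForm
      refine sum_mem fun i _ => ?_
      by_cases hi : i ∈ F
      · rw [hgF v (by simp) i hi, C_0, zero_mul]
        exact zero_mem _
      · exact Ideal.mul_mem_left _ _ (X_mem_linkIdeal.2 (hmax i hi))
    rw [← mul_one (xFace k F), xFace_mul_mem_linkIdeal, Finset.union_empty,
      one_mem_linkIdeal] at h1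
    exact h1 hF

lemma eq_zero_of_vanish (hW : LSOP D W) {F : Finset (Fin n)} (hF : F ∈ D.faces)
    (hc : F.card = dimP D) {w : Fin n → k} (hw : w ∈ W) (h : ∀ i ∈ F, w i = 0) : w = 0 := by
  have h1 := finrank_vanish (hW.full F hF)
  have h2 : Module.finrank k (vanish W F) = 0 := by
    have := hW.finrank_eq
    omega
  have h3 : w ∈ vanish W F := ⟨hw, h⟩
  rw [Submodule.finrank_eq_zero.1 h2] at h3
  exact h3

lemma HFq_eq_zero (hW : LSOP D W) {F : Finset (Fin n)} {m : ℕ} (hm : dimP D < m + F.card) :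
    HFq k (idV (linkIdeal k D F) W) m = 0 := HFq_idV_eq_zero hW.full hm

/-- For `i ∈ F`, a general sequence of `d - 1` forms is regular on `R/(J_F, x_i)`. -/
lemma generic_reg_X (hW : LSOP D W) {F : Finset (Fin n)} (hF : F ∈ D.faces) {i : Fin n}
    (hi : i ∈ F) {d' : ℕ} (hd : dimP D = d' + 1) :
    Generic k (Fin d' × Fin n) fun c => Reg (linkIdeal k D F ⊔ Ideal.span {X i}) (forms c) := by
  obtain ⟨g, hgF, hgl, -, hgr⟩ := hW.exists_free hF (empty_mem_of_mem hF)
  rw [linkIdeal_empty] at hgr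
  have hmem : ∀ j ∈ i :: (F.erase i).toList, j ∈ F := by
    intro j hj
    rcases List.mem_cons.1 hj with rfl | hj
    · exact hi
    · exact Finset.mem_of_mem_erase (Finset.mem_toList.1 hj)
  have hnd : (i :: (F.erase i).toList).Nodup := by
    rw [List.nodup_cons]
    exact ⟨by simp, Finset.nodup_toList _⟩
  have h1 := reg_sup_X hgF hgr hmem hnd
  have h2 := reg_append_units hgF hgr hmem hnd
  have hcard := Finset.card_erase_add_one hi
  obtain ⟨c₀, hc₀⟩ := exists_forms_eq (d := d') (g ++ units (F.erase i).toList)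
    (by rw [List.length_append, length_units, Finset.length_toList]; omega)
  have h3 : idl (linkIdeal k D F) ((g ++ units (i :: (F.erase i).toList)).map (linForm k)) =
      redIdeal k (linkIdeal k D F ⊔ Ideal.span {X i}) c₀ := by
    rw [← idl_forms, hc₀, ← linForm_single, ← idl_cons]
    unfold idl
    congr 2
    ext f
    simp only [units, List.map_cons, List.map_append, Set.mem_ofPred_eq, List.mem_cons,
      List.mem_append]
    tauto
  obtain ⟨l, hl, hlW⟩ := hW.exists_list
  have h4 := HFq_eq_of_reg (homI_linkIdeal D F) (linList_map l) (linList_map _) (by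
    rw [List.length_map, List.length_map, List.length_append, length_units, List.length_cons,
      Finset.length_toList]; omega) (hW.reg F hF l hl hlW) h2
  rw [h3, idl_map_linForm, hlW] at h4
  have h5 : HFq k (redIdeal k (linkIdeal k D F ⊔ Ideal.span {X i}) c₀) (dimP D + 1) = 0 := by
    rw [h4]
    exact hW.HFq_eq_zero (by omega)
  refine (generic_reg ((homI_linkIdeal D F).sup (HomI.span_singleton (isHomogeneous_X k i)))
    (c₀ := c₀) (hc₀ ▸ h1) h5).mono fun _ h => h.1

end LSOP

end Parameters

section SimpleSocle

variable {k}

/-- The quotient by `K` has an essential simple socle, spanned by the class of some `e`. -/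
def SimpleSocle (K : Ideal (MvPolynomial ι k)) : Prop :=
  ∃ e, e ∉ K ∧ ∀ r, r ∉ K → ∃ y, y * r - e ∈ K

lemma simpleSocle_colonBy {K : Ideal (MvPolynomial ι k)} (h : SimpleSocle K)
    {x : MvPolynomial ι k} (hx : x ∉ K) : SimpleSocle (colonBy K x) := by
  obtain ⟨e, he, hK⟩ := h
  obtain ⟨y₀, hy₀⟩ := hK x hx
  refine ⟨y₀, fun h => he ?_, fun r hr => ?_⟩
  · have := K.sub_mem (mem_colonBy.1 h) hy₀
    rwa [mul_comm x, sub_sub_cancel] at this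
  · obtain ⟨y, hy⟩ := hK (x * r) hr
    refine ⟨y, mem_colonBy.2 ?_⟩
    have := K.sub_mem hy hy₀
    convert this using 1
    ring

lemma mem_socle {K : Ideal (MvPolynomial ι k)} {p : MvPolynomial ι k} :
    Ideal.Quotient.mk K p ∈ socle k K ↔ ∀ i, X i * p ∈ K := by
  unfold socle
  rw [Submodule.mem_iInf]
  refine forall_congr' fun i => ?_
  rw [LinearMap.mem_ker, LinearMap.mulLeft_apply, ← map_mul, Ideal.Quotient.eq_zero_iff_mem]

lemma exists_mul_mem_socle {K : Ideal (MvPolynomial ι k)} {N : ℕ} (hN : HFq k K N = 0)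
    {r : MvPolynomial ι k} (hr : r ∉ K) : ∃ y, y * r ∉ K ∧ ∀ i, X i * (y * r) ∈ K := by
  classical
  have hex : ∃ m, ∀ y : MvPolynomial ι k, y.IsHomogeneous m → y * r ∈ K :=
    ⟨N, fun y hy => K.mul_mem_right _ (HFq_eq_zero_iff.1 hN y hy)⟩
  have hspec := Nat.find_spec hex
  have hmin := fun m => Nat.find_min (m := m) hex
  cases hm : Nat.find hex with
  | zero =>
    rw [hm] at hspec
    have := hspec 1 (isHomogeneous_one ι k)
    rw [one_mul] at this
    exact absurd this hr
  | succ m =>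
    have h1 := hmin m (by omega)
    push Not at h1
    obtain ⟨y, hy, hyr⟩ := h1
    refine ⟨y, hyr, fun i => ?_⟩
    rw [← mul_assoc]
    refine hspec _ ?_
    rw [hm, add_comm]
    exact (isHomogeneous_X k i).mul hy

lemma simpleSocle_of_artGor {K : Ideal (MvPolynomial ι k)} {N : ℕ} (hN : HFq k K N = 0)
    (h : artGor k K) : SimpleSocle K := by
  obtain ⟨⟨v, hv⟩, hv0, hsp⟩ := finrank_eq_one_iff'.1 h.2
  obtain ⟨e, rfl⟩ := Ideal.Quotient.mk_surjective v
  refine ⟨e, fun he => hv0 ?_, fun r hr => ?_⟩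
  · exact Subtype.ext (Ideal.Quotient.eq_zero_iff_mem.2 he)
  · obtain ⟨y, hy, hys⟩ := exists_mul_mem_socle hN hr
    obtain ⟨c, hc⟩ := hsp ⟨_, mem_socle.2 hys⟩
    have hc' : c • Ideal.Quotient.mk K e = Ideal.Quotient.mk K (y * r) := congrArg Subtype.val hc
    have hc0 : c ≠ 0 := by
      rintro rfl
      rw [zero_smul] at hc'
      exact hy (Ideal.Quotient.eq_zero_iff_mem.1 hc'.symm)
    refine ⟨C c⁻¹ * y, ?_⟩
    rw [← Ideal.Quotient.eq_zero_iff_mem, map_sub, mul_assoc, ← smul_eq_C_mul,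
      ← Ideal.Quotient.mkₐ_eq_mk k, map_smul, Ideal.Quotient.mkₐ_eq_mk, ← hc', smul_smul,
      inv_mul_cancel₀ hc0, one_smul, sub_self]

/-- The double annihilator property for principal ideals. -/
lemma SimpleSocle.mem_of_colonBy_le {K : Ideal (MvPolynomial ι k)} (h : SimpleSocle K)
    {N : ℕ} (hN : HFq k K N = 0) {f g : MvPolynomial ι k} (hfg : SRWLP.colonBy K g ≤ SRWLP.colonBy K f) :
    ∃ b, f - g * b ∈ K := by
  have := finite_of_HFq_eq_zero hN
  obtain ⟨e, he, hK⟩ := h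
  by_contra hcon
  have hf : Ideal.Quotient.mk K f ∉
      (Ideal.span {Ideal.Quotient.mk K g}).restrictScalars k := by
    intro hmem
    obtain ⟨a, ha⟩ := Ideal.mem_span_singleton'.1 hmem
    obtain ⟨b, rfl⟩ := Ideal.Quotient.mk_surjective a
    refine hcon ⟨b, ?_⟩
    rw [← Ideal.Quotient.eq_zero_iff_mem, map_sub, map_mul, ← ha, mul_comm, sub_self]
  obtain ⟨F, hF, hle⟩ := Submodule.exists_le_ker_of_notMem hf
  have he' : Ideal.Quotient.mk K e ∉ (⊥ : Submodule k (MvPolynomial ι k ⧸ K)) := fun h =>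
    he (Ideal.Quotient.eq_zero_iff_mem.1 h)
  obtain ⟨l, hl, -⟩ := Submodule.exists_le_ker_of_notMem he'
  let Φ : (MvPolynomial ι k ⧸ K) →ₗ[k] Module.Dual k (MvPolynomial ι k ⧸ K) :=
    (LinearMap.mul k (MvPolynomial ι k ⧸ K)).compr₂ l
  have hΦ : ∀ a b, Φ a b = l (a * b) := fun a b => rfl
  have hnd : ∀ a, (∀ b, l (a * b) = 0) → a = 0 := by
    intro a ha
    obtain ⟨r, rfl⟩ := Ideal.Quotient.mk_surjective a
    by_contra hr
    obtain ⟨y, hy⟩ := hK r fun h => hr (Ideal.Quotient.eq_zero_iff_mem.2 h)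
    refine hl ?_
    have h1 := ha (Ideal.Quotient.mk K y)
    rw [← map_mul, mul_comm, Ideal.Quotient.eq.2 hy] at h1
    exact h1
  have hinj : Function.Injective Φ := by
    rw [← LinearMap.ker_eq_bot, LinearMap.ker_eq_bot']
    intro a ha
    exact hnd a fun b => by rw [← hΦ, ha]; rfl
  obtain ⟨s, hs⟩ := (LinearMap.injective_iff_surjective_of_finrank_eq_finrank
    (Subspace.dual_finrank_eq (K := k) (V := MvPolynomial ι k ⧸ K)).symm).1 hinj F
  obtain ⟨s, rfl⟩ := Ideal.Quotient.mk_surjective s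
  have h1 : Ideal.Quotient.mk K (s * g) = 0 := by
    refine hnd _ fun b => ?_
    rw [(Ideal.Quotient.mk K).map_mul, mul_assoc, ← hΦ, hs]
    exact hle (Ideal.mul_mem_right b _ (Ideal.mem_span_singleton_self _))
  rw [Ideal.Quotient.eq_zero_iff_mem, mul_comm] at h1
  have h2 := hfg (mem_colonBy.2 h1)
  rw [mem_colonBy, mul_comm, ← Ideal.Quotient.eq_zero_iff_mem, map_mul] at h2
  refine hF ?_
  rw [← hs, hΦ, h2, map_zero]

end SimpleSocle

section Specialization

variable {k}

/-- The substitution `x_v ↦ f`. -/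
def substX (v : Fin n) (f : MvPolynomial (Fin n) k) :
    MvPolynomial (Fin n) k →ₐ[k] MvPolynomial (Fin n) k :=
  aeval (Function.update X v f)

lemma substX_self (v : Fin n) (f : MvPolynomial (Fin n) k) : substX v f (X v) = f := by
  simp [substX]

lemma substX_of_ne {v i : Fin n} (f : MvPolynomial (Fin n) k) (h : i ≠ v) :
    substX v f (X i) = X i := by
  simp [substX, h]

lemma sub_substX_mem (v : Fin n) (f p : MvPolynomial (Fin n) k) :
    p - substX v f p ∈ Ideal.span {X v - f} := by
  rw [← Ideal.Quotient.eq]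
  have : (Ideal.Quotient.mkₐ k (Ideal.span {X v - f})) =
      (Ideal.Quotient.mkₐ k (Ideal.span {X v - f})).comp (substX v f) := by
    refine algHom_ext fun i => ?_
    rw [AlgHom.comp_apply]
    by_cases hi : i = v
    · subst hi
      rw [substX_self]
      exact Ideal.Quotient.eq.2 (Ideal.mem_span_singleton_self _)
    · rw [substX_of_ne f hi]
  exact DFunLike.congr_fun this p

lemma substX_linForm {v : Fin n} (f : MvPolynomial (Fin n) k) {w : Fin n → k} (hw : w v = 0) :
    substX v f (linForm k w) = linForm k w := by
  unfold linForm
  rw [map_sum]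
  refine Finset.sum_congr rfl fun i _ => ?_
  by_cases hi : i = v
  · subst hi
    rw [hw, C_0, zero_mul, map_zero]
  · rw [map_mul, substX_of_ne f hi]
    congr 1
    exact (substX v f).commutes (w i)

lemma substX_zero_comp {v : Fin n} {f : MvPolynomial (Fin n) k} (hf : substX v 0 f = f)
    (p : MvPolynomial (Fin n) k) : substX v 0 (substX v f p) = substX v f p := by
  have : (substX v 0).comp (substX v f) = substX (k := k) v f := by
    refine algHom_ext fun i => ?_
    rw [AlgHom.comp_apply]
    by_cases hi : i = v
    · subst hi
      rw [substX_self, hf]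
    · rw [substX_of_ne f hi, substX_of_ne _ hi]
  exact DFunLike.congr_fun this p

lemma substX_mem_linkIdeal {D : SC n} {F : Finset (Fin n)} {v : Fin n} (hv : v ∉ F)
    {p : MvPolynomial (Fin n) k} (hp : p ∈ linkIdeal k D F) :
    substX v 0 p ∈ linkIdeal k D F := by
  have hprod : ∀ s : Finset (Fin n), v ∉ s →
      substX v 0 (∏ i ∈ s, X i) = ∏ i ∈ s, (X i : MvPolynomial (Fin n) k) := by
    intro s hs
    rw [map_prod]
    exact Finset.prod_congr rfl fun i hi => substX_of_ne 0 fun h => hs (h ▸ hi)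
  have hI : srIdeal k D ≤ (srIdeal k D).comap (substX v 0).toRingHom := by
    conv_lhs => unfold srIdeal
    rw [Ideal.span_le]
    rintro _ ⟨s, hs, rfl⟩
    change substX v 0 _ ∈ srIdeal k D
    by_cases hvs : v ∈ s
    · rw [map_prod, Finset.prod_eq_zero hvs (substX_self v 0)]
      exact zero_mem _
    · rw [hprod s hvs]
      exact Ideal.subset_span ⟨s, hs, rfl⟩
  rw [mem_linkIdeal'] at hp ⊢
  have h1 : substX v 0 (xFace k F * p) ∈ srIdeal k D := hI hp
  rw [map_mul] at h1
  unfold xFace at h1 ⊢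
  rwa [hprod F hv] at h1

lemma substX_mem_idl {D : SC n} {F : Finset (Fin n)} {v : Fin n} (hv : v ∉ F)
    {g : List (Fin n → k)} (hg : FreeOf {v} g) {p : MvPolynomial (Fin n) k}
    (hp : p ∈ idl (linkIdeal k D F) (g.map (linForm k))) :
    substX v 0 p ∈ idl (linkIdeal k D F) (g.map (linForm k)) := by
  have : idl (linkIdeal k D F) (g.map (linForm k)) ≤
      (idl (linkIdeal k D F) (g.map (linForm k))).comap (substX v 0).toRingHom := by
    conv_lhs => unfold idl
    refine sup_le (fun p hp => le_idl _ _ (substX_mem_linkIdeal hv hp)) ?_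
    rw [Ideal.span_le]
    rintro f hf
    obtain ⟨w, hw, rfl⟩ := List.mem_map.1 hf
    change substX v 0 (linForm k w) ∈ idl (linkIdeal k D F) (g.map (linForm k))
    rw [substX_linForm 0 (hg w hw v (by simp))]
    exact mem_idl _ hf
  exact this hp

namespace LSOP

variable {D : SC n} {W : Submodule k (Fin n → k)}

/-- A splitting of a linear system of parameters at a vertex. -/
lemma exists_split (hW : LSOP D W) {v : Fin n} (hv : {v} ∈ D.faces) :
    ∃ (g : List (Fin n → k)) (w : Fin n → k), FreeOf {v} g ∧ w v = 1 ∧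
      Submodule.span k {u | u ∈ g ++ [w]} = W ∧
      ∀ F ∈ D.faces, Reg (linkIdeal k D F) ((g ++ [w]).map (linForm k)) := by
  obtain ⟨g, hg, hgl, hgs, -⟩ := hW.exists_free hv hv
  obtain ⟨w, hw, hwv⟩ := hW.full {v} hv fun _ => 1
  have hwv := hwv v (by simp)
  have hspan : Submodule.span k {u | u ∈ g ++ [w]} = W := by
    refine le_antisymm (Submodule.span_le.2 ?_) fun u hu => ?_
    · intro u hu
      rcases List.mem_append.1 hu with hu | hu
      · exact vanish_le W {v} (hgs ▸ Submodule.subset_span hu)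
      · rw [List.mem_singleton.1 hu]
        exact hw
    · have h1 : u - u v • w ∈ vanish W {v} := by
        refine ⟨W.sub_mem hu (W.smul_mem _ hw), fun i hi => ?_⟩
        rw [Finset.mem_singleton.1 hi]
        simp [hwv]
      rw [← hgs] at h1
      have h2 : u - u v • w ∈ Submodule.span k {u | u ∈ g ++ [w]} :=
        Submodule.span_mono (fun x hx => List.mem_append_left _ hx) h1
      have h3 : u v • w ∈ Submodule.span k {u | u ∈ g ++ [w]} :=
        Submodule.smul_mem _ _ (Submodule.subset_span (by simp))
      simpa using Submodule.add_mem _ h2 h3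
  refine ⟨g, w, hg, hwv, hspan, fun F hF => hW.reg F hF _ ?_ hspan⟩
  rw [Finset.card_singleton] at hgl
  simpa using hgl

/-- Multiplication by a vertex of the link induces an injection of Artinian reductions, provided
the source has a simple socle and the vertex is not a cone point. -/
lemma colonBy_X (hW : LSOP D W) {F : Finset (Fin n)} {v : Fin n} (hv : v ∉ F)
    (hF : insert v F ∈ D.faces) (hP : SimpleSocle (idV (linkIdeal k D F) W))
    (hne : linkIdeal k D (insert v F) ≠ linkIdeal k D F) :
    colonBy (idV (linkIdeal k D F) W) (X v) = idV (linkIdeal k D (insert v F)) W := by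
  have hFD : F ∈ D.faces := D.down_closed _ hF _ (Finset.subset_insert v F)
  have hvD : {v} ∈ D.faces := D.down_closed _ hF _ (by simp)
  obtain ⟨g, w, hg, hwv, hspan, hreg⟩ := hW.exists_split hvD
  set J := linkIdeal k D F with hJ
  set L := linkIdeal k D (insert v F) with hL
  have hJL : J ≤ L := linkIdeal_mono D (Finset.subset_insert v F)
  set K := idl J (g.map (linForm k)) with hK
  set M := idl L (g.map (linForm k)) with hM
  have hKW : idV J W = K ⊔ Ideal.span {linForm k w} := by
    rw [← hspan, ← idl_map_linForm, List.map_append, idl_append, List.map_singleton, idl_cons,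
      idl_nil]
  have hMW : idV L W = M ⊔ Ideal.span {linForm k w} := by
    rw [← hspan, ← idl_map_linForm, List.map_append, idl_append, List.map_singleton, idl_cons,
      idl_nil]
  have hKM : ∀ p, X v * p ∈ K ↔ p ∈ M := by
    intro p
    rw [← xFace_singleton, hK, hJ, xFace_mul_mem_idl hg, hM, hL, Finset.insert_eq]
  have hwK : ∀ r, linForm k w * r ∈ K → r ∈ K := by
    have := hreg F hFD
    rw [List.map_append, reg_append] at this
    exact this.2.1
  have hsub : ∀ p ∈ K, substX v 0 p ∈ K := fun p hp => substX_mem_idl hv hg hp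
  set l : MvPolynomial (Fin n) k := linForm k w - X v with hl
  have hlv : substX v 0 l = l := by
    have : l = linForm k (w - Pi.single v 1) := by
      rw [hl, ← linForm_single]
      exact ((linFormL (k := k)).map_sub w (Pi.single v 1)).symm
    rw [this]
    exact substX_linForm 0 (by simp [hwv])
  have hwl : linForm k w = X v + l := by rw [hl]; ring
  have hne' : ∃ s ∈ idV L W, s ∉ idV J W := by
    by_contra hcon
    push Not at hcon
    refine hne (eq_of_idl_eq (homI_linkIdeal D F) (homI_linkIdeal D _) hJL (linList_map _)
      (hreg F hFD) (hreg _ hF) ?_).symm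
    rw [idl_map_linForm, idl_map_linForm, hspan]
    exact hcon
  have hTM : ∀ t, substX v 0 t = t → l * t ∈ K → t ∈ idV L W → t ∈ idV J W := by
    intro t ht hlt htL
    rw [hMW, mem_sup_span_singleton] at htL
    obtain ⟨b, hb⟩ := htL
    rw [← hKM] at hb
    have h1 : linForm k w * (t - X v * b) ∈ K := by
      convert K.add_mem hb hlt using 1
      rw [hwl]
      ring
    have h2 := hsub _ (hwK _ h1)
    rw [map_sub, map_mul, substX_self, zero_mul, sub_zero, ht] at h2
    rw [hKW]
    exact Ideal.mem_sup_left h2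
  have hT : ∀ t, substX v 0 t = t → l * t ∈ K → t ∈ idV J W := by
    intro t ht hlt
    by_contra htJ
    obtain ⟨e, he, hP⟩ := hP
    obtain ⟨s, hsL, hsJ⟩ := hne'
    obtain ⟨y, hy⟩ := hP t htJ
    obtain ⟨z, hz⟩ := hP s hsJ
    have hJL' : idV J W ≤ idV L W := idV_mono hJL W
    have heL : e ∈ idV L W := by
      have := Ideal.sub_mem _ (Ideal.mul_mem_left _ z hsL) (hJL' hz)
      rwa [sub_sub_cancel] at this
    have hy' : substX v (-l) y * t - e ∈ idV J W := by
      have h1 : y - substX v (-l) y ∈ idV J W := by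
        refine (Ideal.span_singleton_le_iff_mem _ |>.2 ?_) (sub_substX_mem v (-l) y)
        rw [sub_neg_eq_add, ← hwl, hKW]
        exact Ideal.mem_sup_right (Ideal.mem_span_singleton_self _)
      convert Ideal.sub_mem _ hy (Ideal.mul_mem_right t _ h1) using 1
      ring
    have h2 : substX v (-l) y * t ∈ idV J W := by
      refine hTM _ ?_ ?_ ?_
      · rw [map_mul, ht, substX_zero_comp (by rw [map_neg, hlv])]
      · convert K.mul_mem_left (substX v (-l) y) hlt using 1
        ring
      · have := Ideal.add_mem _ (hJL' hy') heL
        rwa [sub_add_cancel] at this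
    have := Ideal.sub_mem _ h2 hy'
    rw [sub_sub_cancel] at this
    exact he this
  ext r
  rw [mem_colonBy]
  constructor
  · intro hr
    rw [hKW, mem_sup_span_singleton] at hr
    obtain ⟨b, hb⟩ := hr
    set t := substX v 0 b with ht
    obtain ⟨b', hb'⟩ := Ideal.mem_span_singleton'.1 (sub_substX_mem v 0 b)
    rw [sub_zero, ← ht] at hb'
    have hlt : l * t ∈ K := by
      have := hsub _ hb
      rw [map_sub, map_mul, substX_self, zero_mul, zero_sub, map_mul, hwl, map_add, substX_self,
        hlv, zero_add] at this
      exact neg_mem_iff.1 this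
    have htt : substX v 0 t = t := substX_zero_comp (map_zero _) b
    have h1 : r - t - linForm k w * b' ∈ M := by
      rw [← hKM]
      have hbt : b = t + b' * X v := by rw [hb']; ring
      convert K.add_mem hb hlt using 1
      rw [hbt, hwl]
      ring
    have h2 := idV_mono hJL W (hT t htt hlt)
    have h3 : r - t ∈ idV L W := by
      rw [hMW, mem_sup_span_singleton]
      exact ⟨b', h1⟩
    simpa using Ideal.add_mem _ h3 h2
  · intro hr
    rw [hMW, mem_sup_span_singleton] at hr
    obtain ⟨b, hb⟩ := hr
    rw [← hKM] at hb
    rw [hKW, mem_sup_span_singleton]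
    refine ⟨X v * b, ?_⟩
    convert hb using 1
    ring

end LSOP

end Specialization

section TopDegree

variable {k}

lemma one_notMem_idV {D : SC n} {F : Finset (Fin n)} (hF : F ∈ D.faces)
    (W : Submodule k (Fin n → k)) : (1 : MvPolynomial (Fin n) k) ∉ idV (linkIdeal k D F) W := by
  have h : idV (linkIdeal k D F) W ≤ RingHom.ker (constantCoeff (R := k) (σ := Fin n)) := by
    refine sup_le (fun p hp => ?_) (Ideal.span_le.2 ?_)
    · rw [RingHom.mem_ker, constantCoeff_eq]
      by_contra h0
      have := mem_linkIdeal.1 hp 0 (mem_support_iff.2 h0)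
      simp only [Finsupp.support_zero, Finset.union_empty] at this
      exact this hF
    · rintro _ ⟨w, -, rfl⟩
      change constantCoeff (linForm k w) = 0
      simp [linForm]
  intro h1
  have := h h1
  rw [RingHom.mem_ker, map_one] at this
  exact one_ne_zero this

lemma homogeneousComponent_one_linForm_mul (w : ι → k) (b : MvPolynomial ι k) :
    homogeneousComponent 1 (linForm k w * b) = linForm k (coeff 0 b • w) := by
  have := homogeneousComponent_add_mul (linForm_isHomogeneous w) b 0
  rw [zero_add] at this
  rw [this, homogeneousComponent_zero, mul_comm, ← smul_eq_C_mul]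
  exact ((linFormL (k := k)).map_smul _ w).symm

lemma exists_sub_linForm_mem {J : Ideal (MvPolynomial ι k)} (hJ : HomI J)
    {W : Submodule k (ι → k)} {p : MvPolynomial ι k} (hp : p.IsHomogeneous 1)
    (h : p ∈ idV J W) : ∃ u ∈ W, p - linForm k u ∈ J := by
  obtain ⟨l, -, hl⟩ := exists_list_span W
  rw [← hl, ← idl_map_linForm, mem_idl_iff] at h
  obtain ⟨b, hb⟩ := h
  have h1 := hJ _ hb 1
  rw [map_sub, homogeneousComponent_of_mem hp, if_pos rfl, map_sum] at h1
  have h2 : ∀ j, ∃ u ∈ W, homogeneousComponent 1 ((l.map (linForm k))[j] * b j) = linForm k u := by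
    intro j
    obtain ⟨w, hw, hwj⟩ := List.mem_map.1 (List.getElem_mem j.2)
    refine ⟨coeff 0 (b j) • w, W.smul_mem _ ?_, ?_⟩
    · rw [← hl]
      exact Submodule.subset_span hw
    · rw [← homogeneousComponent_one_linForm_mul, hwj]
      rfl
  choose u hu huj using h2
  refine ⟨∑ j, u j, W.sum_mem fun j _ => hu j, ?_⟩
  convert h1 using 2
  rw [Finset.sum_congr rfl fun j _ => huj j]
  exact map_sum (linFormL (k := k)) u _

lemma linForm_mem_linkIdeal {D : SC n} {F : Finset (Fin n)} {z : Fin n → k}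
    (h : linForm k z ∈ linkIdeal k D F) {i : Fin n} (hi : z i ≠ 0) : insert i F ∉ D.faces := by
  have hc : coeff (Finsupp.single i 1) (linForm k z) = z i := by
    unfold linForm
    rw [coeff_sum, Finset.sum_eq_single i]
    · rw [coeff_C_mul, coeff_X, if_pos rfl, mul_one]
    · intro j _ hj
      rw [coeff_C_mul, coeff_X, if_neg, mul_zero]
      intro h
      exact hj (Finsupp.single_left_injective one_ne_zero h)
    · simp
  have := mem_linkIdeal.1 h (Finsupp.single i 1) (by rw [mem_support_iff, hc]; exact hi)
  rwa [Finsupp.support_single _ one_ne_zero, Finset.union_comm, ← Finset.insert_eq] at this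

lemma xFace_mem_linkIdeal {D : SC n} {F G : Finset (Fin n)} :
    xFace k G ∈ linkIdeal k D F ↔ G ∪ F ∉ D.faces := by
  rw [← mul_one (xFace k G), xFace_mul_mem_linkIdeal, one_mem_linkIdeal]

lemma exists_facet {D : SC n} {F : Finset (Fin n)} (hF : F ∈ D.faces) :
    ∃ H ∈ D.faces, F ⊆ H ∧ ∀ i, i ∉ H → insert i H ∉ D.faces := by
  obtain ⟨H, hH, hmax⟩ := Finset.exists_max_image (D.faces.filter (F ⊆ ·)) Finset.card
    ⟨F, by simp [hF]⟩
  rw [Finset.mem_filter] at hH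
  refine ⟨H, hH.1, hH.2, fun i hi hiH => ?_⟩
  have := hmax (insert i H) (by
    rw [Finset.mem_filter]
    exact ⟨hiH, hH.2.trans (Finset.subset_insert i H)⟩)
  rw [Finset.card_insert_of_notMem hi] at this
  omega

namespace LSOP

variable {D : SC n} {W : Submodule k (Fin n → k)}

lemma pow_mem (hW : LSOP D W) {F : Finset (Fin n)} (v : Fin n) :
    (X v : MvPolynomial (Fin n) k) ^ (dimP D + 1) ∈ idV (linkIdeal k D F) W := by
  refine HFq_eq_zero_iff.1 (hW.HFq_eq_zero (m := dimP D + 1) (by omega)) _ ?_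
  have := (isHomogeneous_X k v).pow (dimP D + 1)
  rwa [one_mul] at this

/-- If two vertices span a face with `F`, and neither is a cone point of the link of `F`, then
their links over `F` differ, in presence of a simple socle. -/
lemma linkIdeal_insert_ne (hW : LSOP D W) {F : Finset (Fin n)} {v w : Fin n} (hv : v ∉ F)
    (hw : w ∉ F) (hvw : v ≠ w) (hvF : insert v F ∈ D.faces) (hwF : insert w F ∈ D.faces)
    (hP : SimpleSocle (idV (linkIdeal k D F) W))
    (hne : ∀ i, i ∉ F → insert i F ∈ D.faces → linkIdeal k D (insert i F) ≠ linkIdeal k D F) :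
    linkIdeal k D (insert v F) ≠ linkIdeal k D (insert w F) := by
  intro heq
  have hFD : F ∈ D.faces := D.down_closed _ hvF _ (Finset.subset_insert v F)
  have h1 : colonBy (idV (linkIdeal k D F) W) (X w) ≤ colonBy (idV (linkIdeal k D F) W) (X v) := by
    rw [hW.colonBy_X hv hvF hP (hne v hv hvF), hW.colonBy_X hw hwF hP (hne w hw hwF), heq]
  obtain ⟨b, hb⟩ := hP.mem_of_colonBy_le (hW.HFq_eq_zero (m := dimP D + 1) (by omega)) h1
  have h2 := homI_idV (homI_linkIdeal D F) W _ hb 1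
  rw [map_sub, homogeneousComponent_of_mem (isHomogeneous_X k v), if_pos rfl,
    ← linForm_single w, homogeneousComponent_one_linForm_mul] at h2
  have h3 : ((X v : MvPolynomial (Fin n) k) -
      linForm k (coeff 0 b • (Pi.single w 1 : Fin n → k))).IsHomogeneous 1 :=
    (isHomogeneous_X k v).sub (linForm_isHomogeneous _)
  obtain ⟨u, hu, hu'⟩ := exists_sub_linForm_mem (homI_linkIdeal D F) h3 h2
  set z : Fin n → k := Pi.single v 1 - coeff 0 b • (Pi.single w 1 : Fin n → k) - u with hz
  have hzmem : linForm k z ∈ linkIdeal k D F := by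
    convert hu' using 1
    rw [← linForm_single v, hz]
    change linFormL (k := k) (ι := Fin n) _ = linFormL (k := k) _ - linFormL (k := k) _ - linFormL (k := k) _
    rw [map_sub, map_sub]
  obtain ⟨H, hH, hFH, hmax, hvH⟩ : ∃ H ∈ D.faces, F ⊆ H ∧
      (∀ i, i ∉ H → insert i H ∉ D.faces) ∧ v ∉ H := by
    have : ∃ p ∈ linkIdeal k D (insert v F), p ∉ linkIdeal k D F := by
      by_contra hcon
      push Not at hcon
      exact hne v hv hvF (le_antisymm hcon (linkIdeal_mono D (Finset.subset_insert v F)))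
    obtain ⟨p, hp, hpF⟩ := this
    rw [mem_linkIdeal] at hp hpF
    push Not at hpF
    obtain ⟨m, hm, hmF⟩ := hpF
    obtain ⟨H, hH, hmH, hmax⟩ := exists_facet hmF
    refine ⟨H, hH, Finset.subset_union_left.trans hmH, hmax, fun hvH => hp m hm ?_⟩
    refine D.down_closed H hH _ (Finset.union_subset (Finset.insert_subset hvH ?_) ?_)
    · exact Finset.subset_union_left.trans hmH
    · exact Finset.subset_union_right.trans hmH
  have hwH : w ∉ H := by
    intro hwH
    have h4 : H ∪ insert w F ∈ D.faces := by
      rwa [Finset.union_eq_left.2 (Finset.insert_subset hwH hFH)]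
    rw [← not_not (a := H ∪ insert w F ∈ D.faces), ← xFace_mem_linkIdeal (k := k), ← heq,
      xFace_mem_linkIdeal, not_not] at h4
    exact hmax v hvH (D.down_closed _ h4 _ (Finset.insert_subset (by simp)
      Finset.subset_union_left))
  have hu0 : u = 0 := by
    refine hW.eq_zero_of_vanish hH (hW.card_of_facet hH hmax) hu fun i hi => ?_
    by_contra hui
    have hiv : i ≠ v := fun h => hvH (h ▸ hi)
    have hiw : i ≠ w := fun h => hwH (h ▸ hi)
    refine linForm_mem_linkIdeal hzmem (i := i) ?_
      (D.down_closed H hH _ (Finset.insert_subset hi hFH))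
    simp [hz, hiv, hiw, hui]
  refine linForm_mem_linkIdeal hzmem (i := v) ?_ hvF
  simp [hz, hvw, hu0]

/-- The top-degree component of a Gorenstein Artinian reduction is one-dimensional. -/
theorem HFq_dimP (hW : LSOP D W) (h0 : ∅ ∈ D.faces) (hG : artGor k (idV (srIdeal k D) W))
    (hcone : ∀ i : Fin n, ∃ τ ∈ D.faces, insert i τ ∉ D.faces) :
    HFq k (idV (srIdeal k D) W) (dimP D) = 1 := by
  classical
  rw [← linkIdeal_empty] at hG ⊢
  set A := idV (linkIdeal k D ∅) W with hA
  have hN : HFq k A (dimP D + 1) = 0 := hW.HFq_eq_zero (by omega)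
  have hP : SimpleSocle A := simpleSocle_of_artGor hN hG
  have hinjP : ∀ F ∈ D.faces, colonBy A (xFace k F) = idV (linkIdeal k D F) W →
      xFace k F ∉ A := by
    intro F hF hinj h
    refine one_notMem_idV hF W ?_
    rw [← hinj, mem_colonBy, mul_one]
    exact h
  have hinjS : ∀ F ∈ D.faces, colonBy A (xFace k F) = idV (linkIdeal k D F) W →
      SimpleSocle (idV (linkIdeal k D F) W) := by
    intro F hF hinj
    rw [← hinj]
    exact simpleSocle_colonBy hP (hinjP F hF hinj)
  have hstep : ∀ F v, v ∉ F → insert v F ∈ D.faces →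
      colonBy A (xFace k F) = idV (linkIdeal k D F) W →
      linkIdeal k D (insert v F) ≠ linkIdeal k D F →
      colonBy A (xFace k (insert v F)) = idV (linkIdeal k D (insert v F)) W := by
    intro F v hv hF hinj hne
    have hFD : F ∈ D.faces := D.down_closed _ hF _ (Finset.subset_insert v F)
    rw [← hW.colonBy_X hv hF (hinjS F hFD hinj) hne, ← hinj]
    ext r
    simp only [mem_colonBy, xFace, Finset.prod_insert hv]
    ring_nf
  let Good : Finset (Fin n) → Prop := fun F =>
    colonBy A (xFace k F) = idV (linkIdeal k D F) W ∧
      ∀ i, i ∉ F → insert i F ∈ D.faces → linkIdeal k D (insert i F) ≠ linkIdeal k D F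
  have hgood0 : Good ∅ := by
    refine ⟨?_, fun i _ hi heq => ?_⟩
    · ext r
      rw [mem_colonBy, xFace, Finset.prod_empty, one_mul]
    · obtain ⟨τ, hτ, hiτ⟩ := hcone i
      have h1 : xFace k τ ∈ linkIdeal k D (insert i ∅) := by
        rw [xFace_mem_linkIdeal, Finset.union_comm]
        simpa using hiτ
      rw [heq, xFace_mem_linkIdeal] at h1
      simp [hτ] at h1
  obtain ⟨F, hF, hmax⟩ := Finset.exists_max_image (D.faces.filter Good) Finset.card
    ⟨∅, by simp [h0, hgood0]⟩
  rw [Finset.mem_filter] at hF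
  obtain ⟨hFD, hinj, hne⟩ := hF
  have hfacet : ∀ w, w ∉ F → insert w F ∉ D.faces := by
    intro w hw hwF
    have hinjw := hstep F w hw hwF hinj (hne w hw hwF)
    have hng : ¬ Good (insert w F) := by
      intro hg
      have := hmax _ (Finset.mem_filter.2 ⟨hwF, hg⟩)
      rw [Finset.card_insert_of_notMem hw] at this
      omega
    have : ∃ v, v ∉ insert w F ∧ insert v (insert w F) ∈ D.faces ∧
        linkIdeal k D (insert v (insert w F)) = linkIdeal k D (insert w F) := by
      by_contra hcon
      push Not at hcon
      exact hng ⟨hinjw, hcon⟩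
    obtain ⟨v, hv, hvF, hveq⟩ := this
    have hvw : v ≠ w := fun h => hv (by simp [h])
    have hvF' : v ∉ F := fun h => hv (Finset.mem_insert_of_mem h)
    have hcomm : insert v (insert w F) = insert w (insert v F) := Finset.insert_comm v w F
    have hvD : insert v F ∈ D.faces := D.down_closed _ hvF _
      (Finset.insert_subset_insert v (Finset.subset_insert w F))
    have hinjv := hstep F v hvF' hvD hinj (hne v hvF' hvD)
    have hwv : w ∉ insert v F := by
      rw [Finset.mem_insert]
      exact fun h => h.elim (fun h => hvw h.symm) hw
    have heq : linkIdeal k D (insert v F) = linkIdeal k D (insert w F) := by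
      by_contra hcon
      have h1 : colonBy A (xFace k (insert v (insert w F))) =
          idV (linkIdeal k D (insert w F)) W := by
        rw [← hveq, hcomm]
        refine hstep (insert v F) w hwv (hcomm ▸ hvF) hinjv ?_
        rw [← hcomm, hveq]
        exact Ne.symm hcon
      have h2 : ∀ r, X v * r ∈ idV (linkIdeal k D (insert w F)) W →
          r ∈ idV (linkIdeal k D (insert w F)) W := by
        intro r hr
        rw [← hinjw, mem_colonBy] at hr
        rw [← h1, mem_colonBy, xFace, Finset.prod_insert hv]
        convert hr using 1
        rw [xFace]
        ring
      have h3 : ∀ m : ℕ, (X v : MvPolynomial (Fin n) k) ^ m ∉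
          idV (linkIdeal k D (insert w F)) W := by
        intro m
        induction m with
        | zero =>
          rw [pow_zero]
          exact one_notMem_idV hwF W
        | succ m ih =>
          rw [pow_succ']
          exact fun h => ih (h2 _ h)
      exact h3 _ (hW.pow_mem v)
    exact hW.linkIdeal_insert_ne hvF' hw hvw hvD hwF (hinjS F hFD hinj) hne heq
  have hcard := hW.card_of_facet hFD hfacet
  have hhom : (xFace k F).IsHomogeneous (dimP D) := by
    rw [← hcard, Finset.card_eq_sum_ones]
    exact IsHomogeneous.prod F _ _ fun i _ => isHomogeneous_X k i
  have hne0 : HFq k A (dimP D) ≠ 0 := fun h =>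
    hinjP F hFD hinj (HFq_eq_zero_iff.1 h _ hhom)
  have hle : HFq k A (dimP D) ≤ 1 := by
    rw [← hG.2]
    have := finite_of_HFq_eq_zero hN
    refine Submodule.finrank_mono ?_
    intro x hx
    obtain ⟨p, hp, rfl⟩ := mem_qComp.1 hx
    refine mem_socle.2 fun i => HFq_eq_zero_iff.1 hN _ ?_
    rw [add_comm]
    exact (isHomogeneous_X k i).mul hp
  omega

end LSOP

end TopDegree

section
variable {k}

/-- Expansion of an element of `R[T]` as a polynomial in `T` with coefficients in `R`. -/
def expandT : MvPolynomial (Fin (n + 1)) k →ₐ[k] Polynomial (MvPolynomial (Fin n) k) :=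
  aeval (Fin.lastCases (motive := fun _ => Polynomial (MvPolynomial (Fin n) k))
    Polynomial.X fun i => Polynomial.C (X i))

lemma expandT_Tv : expandT (Tv k n) = Polynomial.X := by
  simp [expandT, Tv]

lemma expandT_toT (r : MvPolynomial (Fin n) k) : expandT (toT k r) = Polynomial.C r := by
  induction r using MvPolynomial.induction_on with
  | C a => simp [expandT, toT, algebraMap_eq]
  | add p q hp hq => rw [map_add, map_add, hp, hq, Polynomial.C_add]
  | mul_X p i hp =>
    rw [map_mul, map_mul, hp, Polynomial.C_mul]
    simp [expandT, toT]

lemma eval₂_expandT (p : MvPolynomial (Fin (n + 1)) k) :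
    (expandT p).eval₂ (toT k : MvPolynomial (Fin n) k →ₐ[k] _).toRingHom (Tv k n) = p := by
  induction p using MvPolynomial.induction_on with
  | C a =>
    have h : expandT (C a : MvPolynomial (Fin (n + 1)) k) = Polynomial.C (C a) := by
      rw [← expandT_toT]
      simp [toT]
    rw [h, Polynomial.eval₂_C]
    simp [toT]
  | add p q hp hq => rw [map_add, Polynomial.eval₂_add, hp, hq]
  | mul_X p i hp =>
    rw [map_mul, Polynomial.eval₂_mul, hp]
    congr 1
    induction i using Fin.lastCases with
    | last => rw [← Tv, expandT_Tv, Polynomial.eval₂_X]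
    | cast i =>
      have : (X i.castSucc : MvPolynomial (Fin (n + 1)) k) = toT k (X i) := by simp [toT]
      rw [this, expandT_toT, Polynomial.eval₂_C]
      rfl

lemma eq_sum_expandT (p : MvPolynomial (Fin (n + 1)) k) {N : ℕ}
    (hN : (expandT p).natDegree < N) :
    p = ∑ j ∈ Finset.range N, toT k ((expandT p).coeff j) * Tv k n ^ j := by
  conv_lhs => rw [← eval₂_expandT p]
  exact Polynomial.eval₂_eq_sum_range' _ hN _

lemma expandT_eq_finSuccEquiv (p : MvPolynomial (Fin (n + 1)) k) :
    expandT p = finSuccEquiv k n (rename (Fin.lastCases (motive := fun _ => Fin (n + 1)) 0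
      Fin.succ) p) := by
  have : (expandT (k := k) (n := n)) = (finSuccEquiv k n).toAlgHom.comp
      (rename (Fin.lastCases (motive := fun _ => Fin (n + 1)) 0 Fin.succ)) := by
    apply MvPolynomial.algHom_ext
    intro i
    induction i using Fin.lastCases with
    | last => simp [expandT, finSuccEquiv_X_zero]
    | cast i => simp [expandT, finSuccEquiv_X_succ]
  exact DFunLike.congr_fun this p

lemma expandT_coeff_isHomogeneous {p : MvPolynomial (Fin (n + 1)) k} {m : ℕ}
    (hp : p.IsHomogeneous m) {j : ℕ} (hj : j ≤ m) :
    ((expandT p).coeff j).IsHomogeneous (m - j) := by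
  rw [expandT_eq_finSuccEquiv]
  exact (hp.rename_isHomogeneous).finSuccEquiv_coeff_isHomogeneous _ _ (by omega)

lemma expandT_coeff_eq_zero {p : MvPolynomial (Fin (n + 1)) k} {m : ℕ}
    (hp : p.IsHomogeneous m) {j : ℕ} (hj : m < j) : (expandT p).coeff j = 0 := by
  rw [expandT_eq_finSuccEquiv]
  by_contra h
  have := totalDegree_coeff_finSuccEquiv_add_le _ _ h
  have h2 := (hp.rename_isHomogeneous (f := Fin.lastCases (motive := fun _ => Fin (n + 1)) 0
      Fin.succ)).totalDegree_le
  omega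

lemma toT_isHomogeneous {r : MvPolynomial (Fin n) k} {m : ℕ} (hr : r.IsHomogeneous m) :
    (toT k r).IsHomogeneous m :=
  hr.rename_isHomogeneous

/-- Polynomials in `T` whose constant coefficient is in `𝔞` and whose coefficients of
`T, …, T^q` are in `𝔟`. -/
def truncIdeal {𝔞 𝔟 : Ideal (MvPolynomial (Fin n) k)} (_h : 𝔞 ≤ 𝔟) (q : ℕ) :
    Ideal (MvPolynomial (Fin (n + 1)) k) where
  carrier := {p | (expandT p).coeff 0 ∈ 𝔞 ∧ ∀ j ≤ q, (expandT p).coeff j ∈ 𝔟}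
  add_mem' := fun ha hb => by
    refine ⟨?_, fun j hj => ?_⟩
    · rw [map_add, Polynomial.coeff_add]
      exact 𝔞.add_mem ha.1 hb.1
    · rw [map_add, Polynomial.coeff_add]
      exact 𝔟.add_mem (ha.2 j hj) (hb.2 j hj)
  zero_mem' := by simp
  smul_mem' := fun r p hp => by
    refine ⟨?_, fun j hj => ?_⟩
    · rw [smul_eq_mul, map_mul, Polynomial.mul_coeff_zero]
      exact 𝔞.mul_mem_left _ hp.1
    · rw [smul_eq_mul, map_mul, Polynomial.coeff_mul]
      refine 𝔟.sum_mem fun x hx => 𝔟.mul_mem_left _ (hp.2 _ ?_)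
      rw [Finset.HasAntidiagonal.mem_antidiagonal] at hx
      omega

lemma mem_truncIdeal {𝔞 𝔟 : Ideal (MvPolynomial (Fin n) k)} (h : 𝔞 ≤ 𝔟) {q : ℕ}
    {p : MvPolynomial (Fin (n + 1)) k} : p ∈ truncIdeal h q ↔
      (expandT p).coeff 0 ∈ 𝔞 ∧ ∀ i : Fin q, (expandT p).coeff (i + 1) ∈ 𝔟 := by
  constructor
  · exact fun hp => ⟨hp.1, fun i => hp.2 _ (by omega)⟩
  · refine fun hp => ⟨hp.1, fun j hj => ?_⟩
    obtain _ | j := j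
    · exact h hp.1
    · exact hp.2 ⟨j, by omega⟩

lemma redIdeal_mono {I J : Ideal (MvPolynomial ι k)} (h : I ≤ J) {d : ℕ} (c : Fin d × ι → k) :
    redIdeal k I c ≤ redIdeal k J c :=
  sup_le_sup_right h _

lemma linForm_mem_redIdeal (J : Ideal (MvPolynomial ι k)) {d : ℕ} (c : Fin d × ι → k)
    (j : Fin d) : linForm k (fun i => c (j, i)) ∈ redIdeal k J c :=
  Ideal.mem_sup_right (Ideal.subset_span ⟨j, rfl⟩)

lemma trunc_eq {I J : Ideal (MvPolynomial (Fin n) k)} (h : I ≤ J) {d : ℕ}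
    (c : Fin d × Fin n → k) (q : ℕ) :
    extI k I ⊔ Ideal.span {Tv k n ^ (q + 1)} ⊔ TmulI k J ⊔ xForms k c =
      truncIdeal (redIdeal_mono h c) q := by
  set K := extI k I ⊔ Ideal.span {Tv k n ^ (q + 1)} ⊔ TmulI k J ⊔ xForms k c with hK
  have hC : ∀ r j, (expandT (toT k r : MvPolynomial (Fin (n + 1)) k)).coeff (j + 1) = 0 := by
    intro r j
    rw [expandT_toT, Polynomial.coeff_C_succ]
  have hC0 : ∀ r, (expandT (toT k r : MvPolynomial (Fin (n + 1)) k)).coeff 0 = r := by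
    intro r
    rw [expandT_toT, Polynomial.coeff_C_zero]
  apply le_antisymm
  · refine sup_le (sup_le (sup_le ?_ ?_) ?_) ?_
    · refine Ideal.map_le_iff_le_comap.2 fun r hr => ?_
      refine (mem_truncIdeal (redIdeal_mono h c)).2 ⟨?_, fun i => ?_⟩
      · erw [hC0]; exact Ideal.mem_sup_left hr
      · erw [hC]; exact Ideal.zero_mem _
    · rw [Ideal.span_singleton_le_iff_mem, mem_truncIdeal, map_pow, expandT_Tv]
      refine ⟨?_, fun i => ?_⟩
      · rw [Polynomial.coeff_X_pow, if_neg (by omega)]; exact Ideal.zero_mem _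
      · rw [Polynomial.coeff_X_pow, if_neg (by omega)]; exact Ideal.zero_mem _
    · rw [TmulI, Ideal.span_le]
      rintro _ ⟨r, hr, rfl⟩
      refine (mem_truncIdeal (redIdeal_mono h c)).2 ⟨?_, fun i => ?_⟩
      · rw [map_mul, expandT_Tv, Polynomial.coeff_X_mul_zero]; exact Ideal.zero_mem _
      · rw [map_mul, expandT_Tv, Polynomial.coeff_X_mul]
        obtain hi | hi := Nat.eq_zero_or_pos (i : ℕ)
        · rw [hi, hC0]; exact Ideal.mem_sup_left hr
        · obtain ⟨j, hj⟩ := Nat.exists_eq_succ_of_ne_zero hi.ne'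
          rw [hj, Nat.succ_eq_add_one, hC]; exact Ideal.zero_mem _
    · rw [xForms, Ideal.span_le]
      rintro _ ⟨j, rfl⟩
      refine (mem_truncIdeal (redIdeal_mono h c)).2 ⟨?_, fun i => ?_⟩
      · rw [hC0]; exact linForm_mem_redIdeal I c j
      · rw [hC]; exact Ideal.zero_mem _
  · have hx : ∀ j : Fin d, toT k (linForm k fun i => c (j, i)) ∈ K := fun j =>
      Ideal.mem_sup_right (Ideal.subset_span ⟨j, rfl⟩)
    have h0 : ∀ r ∈ redIdeal k I c, toT k r ∈ K := by
      intro r hr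
      have : redIdeal k I c ≤ K.comap (toT k : MvPolynomial (Fin n) k →ₐ[k] _) := by
        refine sup_le (fun a ha => ?_) (Ideal.span_le.2 ?_)
        · exact Ideal.mem_sup_left (Ideal.mem_sup_left (Ideal.mem_sup_left
            (Ideal.mem_map_of_mem _ ha)))
        · rintro _ ⟨j, rfl⟩
          exact hx j
      exact this hr
    have h1 : ∀ r ∈ redIdeal k J c, Tv k n * toT k r ∈ K := by
      intro r hr
      have : redIdeal k J c ≤ (colonBy K (Tv k n)).comap
          (toT k : MvPolynomial (Fin n) k →ₐ[k] _) := by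
        refine sup_le (fun a ha => ?_) (Ideal.span_le.2 ?_)
        · have : Tv k n * toT k a ∈ TmulI k J := Ideal.subset_span ⟨a, ha, rfl⟩
          exact mem_colonBy.2 (Ideal.mem_sup_left (Ideal.mem_sup_right this))
        · rintro _ ⟨j, rfl⟩
          exact mem_colonBy.2 (K.mul_mem_left _ (hx j))
      exact mem_colonBy.1 (this hr)
    have hT : Tv k n ^ (q + 1) ∈ K :=
      Ideal.mem_sup_left (Ideal.mem_sup_left (Ideal.mem_sup_right (Ideal.mem_span_singleton_self _)))
    intro p hp
    rw [eq_sum_expandT p (Nat.lt_succ_self _)]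
    refine K.sum_mem fun j _ => ?_
    obtain hj | hj := Nat.eq_zero_or_pos j
    · rw [hj, pow_zero, mul_one]
      exact h0 _ hp.1
    · obtain hjq | hjq := le_or_gt j q
      · have := h1 _ (hp.2 j hjq)
        obtain ⟨j, rfl⟩ := Nat.exists_eq_succ_of_ne_zero hj.ne'
        have e : toT k ((expandT p).coeff j.succ) * Tv k n ^ j.succ =
          Tv k n ^ j * (Tv k n * toT k ((expandT p).coeff j.succ)) := by
            rw [Nat.succ_eq_add_one, pow_succ]; ring
        rw [e]
        exact K.mul_mem_left _ this
      · obtain ⟨e, rfl⟩ := Nat.exists_eq_add_of_le (show q + 1 ≤ j from hjq)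
        rw [pow_add]
        exact K.mul_mem_left _ (K.mul_mem_right _ hT)

lemma srIdeal_le_linkIdeal (D : SC n) (F : Finset (Fin n)) : srIdeal k D ≤ linkIdeal k D F := by
  rw [← linkIdeal_empty]
  exact linkIdeal_mono D (Finset.empty_subset F)

lemma mem_IC_sup {D : SC n} {σ : Finset (Fin n)} {q d : ℕ} {c : Fin d × Fin n → k}
    {p : MvPolynomial (Fin (n + 1)) k} : p ∈ IC k D σ q ⊔ xForms k c ↔
      (expandT p).coeff 0 ∈ redIdeal k (srIdeal k D) c ∧
        ∀ i : Fin q, (expandT p).coeff (i + 1) ∈ redIdeal k (linkIdeal k D σ) c := by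
  rw [IC, trunc_eq (srIdeal_le_linkIdeal D σ), mem_truncIdeal]

lemma expandT_sum_coeff {q : ℕ} (a : MvPolynomial (Fin n) k) (b : Fin q → MvPolynomial (Fin n) k) :
    (expandT (toT k a + ∑ i : Fin q, toT k (b i) * Tv k n ^ ((i : ℕ) + 1))).coeff 0 = a ∧
    ∀ i : Fin q,
      (expandT (toT k a + ∑ i : Fin q, toT k (b i) * Tv k n ^ ((i : ℕ) + 1))).coeff (i + 1) =
        b i := by
  have : expandT (toT k a + ∑ i : Fin q, toT k (b i) * Tv k n ^ ((i : ℕ) + 1)) =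
      Polynomial.C a + ∑ i : Fin q, Polynomial.C (b i) * Polynomial.X ^ ((i : ℕ) + 1) := by
    rw [map_add, map_sum, expandT_toT]
    congr 1
    refine Finset.sum_congr rfl fun i _ => ?_
    rw [map_mul, map_pow, expandT_toT, expandT_Tv]
  rw [this]
  constructor
  · simp [Polynomial.coeff_X_pow]
  · intro i
    rw [Polynomial.coeff_add, Polynomial.coeff_C_succ, zero_add, Polynomial.finsetSum_coeff,
      Finset.sum_eq_single i]
    · rw [Polynomial.coeff_C_mul, Polynomial.coeff_X_pow, if_pos rfl, mul_one]
    · intro j _ hj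
      rw [Polynomial.coeff_C_mul, Polynomial.coeff_X_pow, if_neg, mul_zero]
      intro h
      exact hj (Fin.ext (by omega))
    · simp

/-- The expansion map `R[T] → A ⊕ B^q`. -/
def truncMap (𝔞 𝔟 : Ideal (MvPolynomial (Fin n) k)) (q : ℕ) :
    MvPolynomial (Fin (n + 1)) k →ₗ[k]
      (MvPolynomial (Fin n) k ⧸ 𝔞) × (Fin q → MvPolynomial (Fin n) k ⧸ 𝔟) :=
  ((Ideal.Quotient.mkₐ k 𝔞).toLinearMap ∘ₗ
      (Polynomial.lcoeff (MvPolynomial (Fin n) k) 0).restrictScalars k ∘ₗ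
        expandT.toLinearMap).prod
    (LinearMap.pi fun i => (Ideal.Quotient.mkₐ k 𝔟).toLinearMap ∘ₗ
      (Polynomial.lcoeff (MvPolynomial (Fin n) k) (i + 1)).restrictScalars k ∘ₗ
        expandT.toLinearMap)

lemma truncMap_apply (𝔞 𝔟 : Ideal (MvPolynomial (Fin n) k)) (q : ℕ)
    (p : MvPolynomial (Fin (n + 1)) k) :
    truncMap 𝔞 𝔟 q p = (Ideal.Quotient.mk 𝔞 ((expandT p).coeff 0),
      fun i : Fin q => Ideal.Quotient.mk 𝔟 ((expandT p).coeff (i + 1))) := rfl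

lemma mem_qCompZ_sub {J : Ideal (MvPolynomial ι k)} {m j : ℕ} {y : MvPolynomial ι k ⧸ J} :
    y ∈ qCompZ k J ((m : ℤ) - (j : ℤ)) ↔
      ∃ b : MvPolynomial ι k, Ideal.Quotient.mk J b = y ∧ b.IsHomogeneous (m - j) ∧
        (m < j → b = 0) := by
  rw [qCompZ]
  split_ifs with h
  · rw [mem_qComp]
    have e : ((m : ℤ) - (j : ℤ)).toNat = m - j := by omega
    rw [e]
    constructor
    · rintro ⟨p, hp, rfl⟩
      exact ⟨p, rfl, hp, fun h' => by omega⟩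
    · rintro ⟨p, rfl, hp, -⟩
      exact ⟨p, hp, rfl⟩
  · rw [Submodule.mem_bot]
    constructor
    · rintro rfl
      exact ⟨0, map_zero _, isHomogeneous_zero _ _ _, fun _ => rfl⟩
    · rintro ⟨b, rfl, -, hb⟩
      rw [hb (by omega), map_zero]

lemma HFZ_sub (J : Ideal (MvPolynomial ι k)) (m j : ℕ) :
    HFZ k J ((m : ℤ) - (j : ℤ)) = if j ≤ m then HFq k J (m - j) else 0 := by
  by_cases h : j ≤ m
  · have e : ((m : ℤ) - (j : ℤ)).toNat = m - j := by omega
    rw [if_pos h, HFZ, qCompZ, if_pos (by omega), e, HFq]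
  · rw [if_neg h, HFZ, qCompZ, if_neg (by omega)]
    exact finrank_bot k _

instance (J : Ideal (MvPolynomial ι k)) (m : ℤ) : FiniteDimensional k (qCompZ k J m) := by
  by_cases h : 0 ≤ m
  · rw [qCompZ, if_pos h]
    infer_instance
  · rw [qCompZ, if_neg h]
    infer_instance

lemma map_truncMap (𝔞 𝔟 : Ideal (MvPolynomial (Fin n) k)) (q m : ℕ) :
    (homogeneousSubmodule (Fin (n + 1)) k m).map (truncMap 𝔞 𝔟 q) =
      (qComp k 𝔞 m).prod (Submodule.pi Set.univ fun i : Fin q =>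
        qCompZ k 𝔟 ((m : ℤ) - (((i : ℕ) + 1 : ℕ) : ℤ))) := by
  ext ⟨x, y⟩
  rw [Submodule.mem_map, Submodule.mem_prod, Submodule.mem_pi]
  constructor
  · rintro ⟨p, hp, hxy⟩
    rw [truncMap_apply, Prod.mk.injEq] at hxy
    obtain ⟨rfl, rfl⟩ := hxy
    rw [mem_homogeneousSubmodule] at hp
    refine ⟨mem_qComp.2 ⟨_, expandT_coeff_isHomogeneous hp (Nat.zero_le _), rfl⟩, fun i _ => ?_⟩
    rw [mem_qCompZ_sub]
    obtain h | h := le_or_gt ((i : ℕ) + 1) m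
    · exact ⟨_, rfl, expandT_coeff_isHomogeneous hp h, fun h' => by omega⟩
    · refine ⟨_, rfl, ?_, fun _ => expandT_coeff_eq_zero hp h⟩
      rw [expandT_coeff_eq_zero hp h]
      exact isHomogeneous_zero _ _ _
  · rintro ⟨hx, hy⟩
    obtain ⟨a, ha, rfl⟩ := mem_qComp.1 hx
    have hy' : ∀ i : Fin q, ∃ b : MvPolynomial (Fin n) k, Ideal.Quotient.mk 𝔟 b = y i ∧
        b.IsHomogeneous (m - (i + 1)) ∧ (m < (i : ℕ) + 1 → b = 0) := fun i =>
      mem_qCompZ_sub.1 (hy i (Set.mem_univ _))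
    choose b hb hbm hb0 using hy'
    refine ⟨toT k a + ∑ i : Fin q, toT k (b i) * Tv k n ^ ((i : ℕ) + 1), ?_, ?_⟩
    · rw [mem_homogeneousSubmodule]
      refine (toT_isHomogeneous ha).add (IsHomogeneous.sum _ _ _ fun i _ => ?_)
      obtain h | h := le_or_gt ((i : ℕ) + 1) m
      · have := (toT_isHomogeneous (hbm i)).mul ((isHomogeneous_X k (Fin.last n)).pow ((i : ℕ) + 1))
        rwa [one_mul, Nat.sub_add_cancel h] at this
      · rw [hb0 i h, map_zero, zero_mul]
        exact isHomogeneous_zero _ _ _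
    · rw [truncMap_apply, (expandT_sum_coeff a b).1, Prod.mk.injEq]
      refine ⟨rfl, funext fun i => ?_⟩
      rw [(expandT_sum_coeff a b).2, hb]

lemma range_piMap_subtype {q : ℕ} {V : Type} [AddCommGroup V] [Module k V]
    (S : Fin q → Submodule k V) :
    LinearMap.range (LinearMap.piMap fun i => (S i).subtype) = Submodule.pi Set.univ S := by
  ext x
  rw [LinearMap.mem_range, Submodule.mem_pi]
  constructor
  · rintro ⟨y, rfl⟩ i _
    exact (y i).2
  · intro h
    exact ⟨fun i => ⟨x i, h i (Set.mem_univ _)⟩, rfl⟩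

instance {q : ℕ} {V : Type} [AddCommGroup V] [Module k V]
    (S : Fin q → Submodule k V) [∀ i, FiniteDimensional k (S i)] :
    FiniteDimensional k (Submodule.pi Set.univ S) := by
  rw [← range_piMap_subtype]
  infer_instance

lemma finrank_pi_submodule {q : ℕ} {V : Type} [AddCommGroup V] [Module k V]
    (S : Fin q → Submodule k V) [∀ i, FiniteDimensional k (S i)] :
    Module.finrank k (Submodule.pi Set.univ S) = ∑ i, Module.finrank k (S i) := by
  have hinj : Function.Injective (LinearMap.piMap fun i => (S i).subtype) := by
    intro x y h
    funext i
    exact Subtype.ext (congrFun h i)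
  rw [← range_piMap_subtype, LinearMap.finrank_range_of_inj hinj, Module.finrank_pi_fintype]

lemma finrank_prod_submodule {V W : Type} [AddCommGroup V] [Module k V] [AddCommGroup W]
    [Module k W] (S : Submodule k V) (T : Submodule k W) [FiniteDimensional k S]
    [FiniteDimensional k T] :
    Module.finrank k (S.prod T) = Module.finrank k S + Module.finrank k T := by
  have hinj : Function.Injective (S.subtype.prodMap T.subtype) :=
    Function.Injective.prodMap S.injective_subtype T.injective_subtype
  rw [← Module.finrank_prod, ← LinearMap.finrank_range_of_inj hinj, LinearMap.range_prodMap,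
    Submodule.range_subtype, Submodule.range_subtype]

lemma HFq_IC_sup (D : SC n) (σ : Finset (Fin n)) (q : ℕ) {d : ℕ} (c : Fin d × Fin n → k) (m : ℕ) :
    HFq k (IC k D σ q ⊔ xForms k c) m = HFq k (redIdeal k (srIdeal k D) c) m +
      ∑ i ∈ Finset.Icc 1 q, HFZ k (redIdeal k (linkIdeal k D σ) c) ((m : ℤ) - (i : ℤ)) := by
  rw [← finrank_map_eq_HFq (truncMap (redIdeal k (srIdeal k D) c)
    (redIdeal k (linkIdeal k D σ) c) q), map_truncMap, finrank_prod_submodule,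
    finrank_pi_submodule]
  · rw [HFq]
    congr 1
    change ∑ i : Fin q, HFZ k (redIdeal k (linkIdeal k D σ) c)
      ((m : ℤ) - (((i : ℕ) + 1 : ℕ) : ℤ)) = _
    rw [← Finset.sum_range fun i => HFZ k (redIdeal k (linkIdeal k D σ) c)
      ((m : ℤ) - ((i + 1 : ℕ) : ℤ)), Finset.range_eq_Ico,
      Finset.sum_Ico_add' (fun i : ℕ => HFZ k (redIdeal k (linkIdeal k D σ) c)
        ((m : ℤ) - (i : ℤ))) 0 q 1]
    rfl
  · intro p
    rw [truncMap_apply, mem_IC_sup, Prod.mk_eq_zero, Ideal.Quotient.eq_zero_iff_mem, _root_.funext_iff]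
    refine and_congr_right fun _ => forall_congr' fun i => ?_
    exact Ideal.Quotient.eq_zero_iff_mem

end

section
variable {k}

/-- The initial rows of a tuple of linear forms. -/
def initRows {d : ℕ} (c : Fin (d + 1) × ι → k) : Fin d × ι → k := fun t => c (t.1.castSucc, t.2)

/-- The last row of a tuple of linear forms. -/
def lastRow {d : ℕ} (c : Fin (d + 1) × ι → k) : ι → k := fun i => c (Fin.last d, i)

lemma forms_succ {d : ℕ} (c : Fin (d + 1) × ι → k) :
    forms c = forms (initRows c) ++ [linForm k (lastRow c)] :=
  List.ofFn_succ_last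

lemma redIdeal_succ (J : Ideal (MvPolynomial ι k)) {d : ℕ} (c : Fin (d + 1) × ι → k) :
    redIdeal k J c = redIdeal k J (initRows c) ⊔ Ideal.span {linForm k (lastRow c)} := by
  rw [← idl_forms, forms_succ, idl_append, idl_forms, idl_cons, idl_nil]

lemma sum_shift_add_psum (h : ℕ → ℕ) (q m : ℕ) :
    (∑ i ∈ Finset.Icc 1 q, if i ≤ m then h (m - i) else 0) +
      (if q + 1 ≤ m then psum h (m - (q + 1)) else 0) =
    if 1 ≤ m then psum h (m - 1) else 0 := by
  induction q with
  | zero => simp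
  | succ q ih =>
    rw [← ih, Finset.sum_Icc_succ_top (by omega), add_assoc]
    congr 1
    obtain hm | hm := lt_or_ge m (q + 1)
    · rw [if_neg (by omega), if_neg (by omega), if_neg (by omega)]
    · obtain ⟨e, rfl⟩ := Nat.exists_eq_add_of_le hm
      have e1 : q + 1 + e - (q + 1) = e := by omega
      rw [if_pos hm, if_pos hm, e1]
      obtain _ | e := e
      · rw [if_neg (by omega), psum_zero, add_zero]
      · have e2 : q + 1 + (e + 1) - (q + 1 + 1) = e := by omega
        rw [if_pos (by omega), e2, psum_succ, add_comm]

/-- The ideal `(𝔰, θ J)`. -/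
def sumMul (S J : Ideal (MvPolynomial ι k)) (θ : MvPolynomial ι k) : Ideal (MvPolynomial ι k) :=
  S ⊔ Ideal.span {θ} * J

lemma mem_sumMul {S J : Ideal (MvPolynomial ι k)} {θ p : MvPolynomial ι k} :
    p ∈ sumMul S J θ ↔ ∃ b ∈ J, p - θ * b ∈ S := by
  rw [sumMul, Submodule.mem_sup]
  constructor
  · rintro ⟨s, hs, t, ht, rfl⟩
    obtain ⟨b, hb, rfl⟩ := Ideal.mem_span_singleton_mul.1 ht
    exact ⟨b, hb, by rwa [add_sub_cancel_right]⟩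
  · rintro ⟨b, hb, h⟩
    exact ⟨_, h, θ * b, Ideal.mem_span_singleton_mul.2 ⟨b, hb, rfl⟩, sub_add_cancel _ _⟩

lemma homI_sumMul {S J : Ideal (MvPolynomial ι k)} (hS : HomI S) (hJ : HomI J)
    {θ : MvPolynomial ι k} (hθ : θ.IsHomogeneous 1) : HomI (sumMul S J θ) := by
  intro p hp m
  obtain ⟨b, hb, h⟩ := mem_sumMul.1 hp
  rw [mem_sumMul]
  have h1 := hS _ h m
  rw [map_sub] at h1
  obtain _ | m := m
  · rw [homogeneousComponent_mul_of_lt hθ _ Nat.one_pos, sub_zero] at h1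
    exact ⟨0, J.zero_mem, by rwa [mul_zero, sub_zero]⟩
  · rw [homogeneousComponent_add_mul hθ] at h1
    exact ⟨_, hJ _ hb m, h1⟩

lemma xFace_isHomogeneous (σ : Finset (Fin n)) : (xFace k σ).IsHomogeneous σ.card := by
  have := IsHomogeneous.prod σ (fun i : Fin n => (X i : MvPolynomial (Fin n) k)) (fun _ => 1)
    fun i _ => isHomogeneous_X k i
  simpa [xFace] using this

/-- Regularity data for a tuple `c` of linear forms with respect to the face `σ`. -/
structure Good (D : SC n) (σ : Finset (Fin n)) {d : ℕ} (c : Fin (d + 1) × Fin n → k) : Prop where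
  reg : Reg (srIdeal k D) (forms c)
  reg_link : Reg (linkIdeal k D σ) (forms c)
  reg_X : ∀ i ∈ σ, Reg (linkIdeal k D σ ⊔ Ideal.span {X i}) (forms (initRows c))

namespace Good

variable {D : SC n} {σ : Finset (Fin n)} {d : ℕ} {c : Fin (d + 1) × Fin n → k}

lemma mem_of_X_mul_mem (h : Good D σ c) {i : Fin n} (hi : i ∈ σ) {r : MvPolynomial (Fin n) k}
    (hr : X i * r ∈ redIdeal k (linkIdeal k D σ) (initRows c)) :
    r ∈ redIdeal k (linkIdeal k D σ) (initRows c) := by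
  have hX : (X i : MvPolynomial (Fin n) k).IsHomogeneous 1 := isHomogeneous_X k i
  have h1 : Reg (linkIdeal k D σ) (X i :: forms (initRows c)) := by
    refine ⟨fun r hr => ?_, h.reg_X i hi⟩
    rwa [X_mul_mem_linkIdeal, Finset.insert_eq_of_mem hi] at hr
  have h2 : Reg (linkIdeal k D σ) (forms (initRows c) ++ [X i]) := by
    refine reg_of_idl_eq (homI_linkIdeal D σ) ?_ ?_ ?_ h1 ?_
    · intro f hf
      obtain rfl | hf := List.mem_cons.1 hf
      · exact hX
      · exact linList_forms _ f hf
    · intro f hf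
      obtain hf | hf := List.mem_append.1 hf
      · exact linList_forms _ f hf
      · rw [List.mem_singleton.1 hf]
        exact hX
    · simp
    · simp only [idl]
      congr 2
      ext f
      simp [or_comm]
  rw [reg_append, idl_forms] at h2
  exact h2.2.1 r hr

lemma mem_of_xFace_mul_mem (h : Good D σ c) {F : Finset (Fin n)} (hF : F ⊆ σ)
    {r : MvPolynomial (Fin n) k}
    (hr : xFace k F * r ∈ redIdeal k (linkIdeal k D σ) (initRows c)) :
    r ∈ redIdeal k (linkIdeal k D σ) (initRows c) := by
  induction F using Finset.induction_on with
  | empty => simpa [xFace] using hr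
  | insert i F hi ih =>
    rw [xFace, Finset.prod_insert hi, mul_assoc] at hr
    exact ih ((Finset.subset_insert i F).trans hF)
      (h.mem_of_X_mul_mem (hF (Finset.mem_insert_self i F)) hr)

lemma regular_last {J : Ideal (MvPolynomial (Fin n) k)} (h : Reg J (forms c))
    {r : MvPolynomial (Fin n) k} (hr : linForm k (lastRow c) * r ∈ redIdeal k J (initRows c)) :
    r ∈ redIdeal k J (initRows c) := by
  rw [forms_succ, reg_append, idl_forms] at h
  exact h.2.1 r hr

lemma mul_mem_of_mem_redIdeal {S J : Ideal (MvPolynomial (Fin n) k)} {d : ℕ}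
    {f : Fin d × Fin n → k} {g : MvPolynomial (Fin n) k}
    (hg : ∀ r ∈ J, g * r ∈ S) (hS : ∀ j, linForm k (fun i => f (j, i)) ∈ S)
    {r : MvPolynomial (Fin n) k} (hr : r ∈ redIdeal k J f) : g * r ∈ S := by
  have : redIdeal k J f ≤ colonBy S g := by
    refine sup_le (fun r hr => mem_colonBy.2 (hg r hr)) (Ideal.span_le.2 ?_)
    rintro _ ⟨j, rfl⟩
    exact mem_colonBy.2 (S.mul_mem_left _ (hS j))
  exact mem_colonBy.1 (this hr)

variable (D σ c) in
/-- The ideal `(I, f', θ I_L)`, where `f'` are the initial linear forms and `θ` the last one. -/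
def aux : Ideal (MvPolynomial (Fin n) k) :=
  sumMul (redIdeal k (srIdeal k D) (initRows c)) (linkIdeal k D σ) (linForm k (lastRow c))

lemma redIdeal_le_aux : redIdeal k (srIdeal k D) (initRows c) ≤ aux D σ c := le_sup_left

lemma aux_le : aux D σ c ≤ redIdeal k (linkIdeal k D σ) (initRows c) := by
  refine sup_le (redIdeal_mono (srIdeal_le_linkIdeal D σ) _) ?_
  exact Ideal.mul_le_right.trans le_sup_left

lemma homI_aux : HomI (aux D σ c) :=
  homI_sumMul (homI_redIdeal (by rw [← linkIdeal_empty]; exact homI_linkIdeal D ∅) _)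
    (homI_linkIdeal D σ) (linForm_isHomogeneous _)

lemma aux_sup : aux D σ c ⊔ Ideal.span {linForm k (lastRow c)} = redIdeal k (srIdeal k D) c := by
  rw [redIdeal_succ]
  apply le_antisymm
  · refine sup_le (sup_le le_sup_left ?_) le_sup_right
    exact Ideal.mul_le_left.trans le_sup_right
  · exact sup_le_sup_right redIdeal_le_aux _

lemma colonBy_aux_last (h : Good D σ c) : colonBy (aux D σ c) (linForm k (lastRow c)) =
    redIdeal k (linkIdeal k D σ) (initRows c) := by
  ext r
  rw [mem_colonBy]
  constructor
  · intro hr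
    obtain ⟨b, hb, hr⟩ := mem_sumMul.1 hr
    rw [← mul_sub] at hr
    have := redIdeal_mono (srIdeal_le_linkIdeal D σ) _ (regular_last h.reg hr)
    rw [← sub_add_cancel r b]
    exact Ideal.add_mem _ this (Ideal.mem_sup_left hb)
  · refine mul_mem_of_mem_redIdeal (fun r hr => ?_) fun j => ?_
    · exact mem_sumMul.2 ⟨r, hr, by rw [sub_self]; exact Ideal.zero_mem _⟩
    · exact redIdeal_le_aux (linForm_mem_redIdeal _ (initRows c) j)

lemma colonBy_aux_xFace (h : Good D σ c) : colonBy (aux D σ c) (xFace k σ) =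
    redIdeal k (linkIdeal k D σ) (initRows c) := by
  ext r
  rw [mem_colonBy]
  constructor
  · exact fun hr => h.mem_of_xFace_mul_mem subset_rfl (aux_le hr)
  · refine mul_mem_of_mem_redIdeal (fun r hr => ?_) fun j => ?_
    · exact redIdeal_le_aux (Ideal.mem_sup_left (mem_linkIdeal'.1 hr))
    · exact redIdeal_le_aux (linForm_mem_redIdeal _ (initRows c) j)

lemma HFq_link (h : Good D σ c) : HFq k (redIdeal k (linkIdeal k D σ) (initRows c)) =
    psum (HFq k (redIdeal k (linkIdeal k D σ) c)) := by
  rw [redIdeal_succ _ c]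
  exact (HFq_eq_psum_iff (homI_redIdeal (homI_linkIdeal D σ) _) (linForm_isHomogeneous _)).2
    fun r => regular_last h.reg_link

lemma HFq_aux (h : Good D σ c) (m : ℕ) : HFq k (aux D σ c) m =
    HFq k (redIdeal k (srIdeal k D) c) m +
      if 1 ≤ m then psum (HFq k (redIdeal k (linkIdeal k D σ) c)) (m - 1) else 0 := by
  obtain _ | m := m
  · rw [if_neg (by omega), HFq_of_lt homI_aux (linForm_isHomogeneous (lastRow c)) Nat.one_pos,
      aux_sup, add_zero]
  · rw [if_pos (by omega), HFq_add_eq homI_aux (linForm_isHomogeneous (lastRow c)), aux_sup,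
      h.colonBy_aux_last, h.HFq_link, Nat.add_sub_cancel]

lemma HFq_aux_sup (h : Good D σ c) {q : ℕ} (hq : σ.card = q + 1) (m : ℕ) :
    HFq k (aux D σ c ⊔ Ideal.span {xFace k σ}) m =
      HFq k (redIdeal k (srIdeal k D) c) m +
        ∑ i ∈ Finset.Icc 1 q,
          HFZ k (redIdeal k (linkIdeal k D σ) c) ((m : ℤ) - (i : ℤ)) := by
  have hx : (xFace k σ).IsHomogeneous (q + 1) := hq ▸ xFace_isHomogeneous σ
  have h1 : HFq k (aux D σ c) m = HFq k (aux D σ c ⊔ Ideal.span {xFace k σ}) m +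
      if q + 1 ≤ m then psum (HFq k (redIdeal k (linkIdeal k D σ) c)) (m - (q + 1)) else 0 := by
    obtain hm | hm := lt_or_ge m (q + 1)
    · rw [if_neg (by omega), HFq_of_lt homI_aux hx hm, add_zero]
    · obtain ⟨e, rfl⟩ := Nat.exists_eq_add_of_le' hm
      rw [if_pos hm, HFq_add_eq homI_aux hx, h.colonBy_aux_xFace, h.HFq_link, Nat.add_sub_cancel]
  rw [h.HFq_aux, ← sum_shift_add_psum _ q m, ← add_assoc] at h1
  simp only [HFZ_sub]
  exact (Nat.add_right_cancel h1).symm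

end Good

end

section
variable {k}

/-- Coefficient tuples of linear forms in `x₁, …, xₙ` obtained by eliminating `T` from linear
forms in `x₁, …, xₙ, T` by means of the last one. -/
def elimT {A : Type} [CommRing A] {d : ℕ} (c : Fin (d + 1) × Fin (n + 1) → A) :
    Fin (d + 1) × Fin n → A := fun t =>
  Fin.lastCases (motive := fun _ => A) (c (Fin.last d, t.2.castSucc))
    (fun j => c (Fin.last d, Fin.last n) * c (j.castSucc, t.2.castSucc) -
      c (j.castSucc, Fin.last n) * c (Fin.last d, t.2.castSucc)) t.1

/-- The substitution of `T` by the linear form obtained from solving the last linear form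
for `T`. -/
def substT {d : ℕ} (c : Fin (d + 1) × Fin (n + 1) → k) :
    MvPolynomial (Fin (n + 1)) k →ₐ[k] MvPolynomial (Fin n) k :=
  aeval (Fin.lastCases (motive := fun _ => MvPolynomial (Fin n) k)
    (C (-(c (Fin.last d, Fin.last n))⁻¹) * linForm k (lastRow (elimT c))) X)

section substT

variable {d : ℕ} (c : Fin (d + 1) × Fin (n + 1) → k)

lemma substT_Tv : substT c (Tv k n) =
    C (-(c (Fin.last d, Fin.last n))⁻¹) * linForm k (lastRow (elimT c)) := by
  simp [substT, Tv]

lemma substT_toT (r : MvPolynomial (Fin n) k) : substT c (toT k r) = r := by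
  have : (substT c).comp (toT k) = AlgHom.id k _ := by
    apply MvPolynomial.algHom_ext
    intro i
    simp [substT, toT]
  exact DFunLike.congr_fun this r

lemma substT_isHomogeneous {p : MvPolynomial (Fin (n + 1)) k} {m : ℕ} (hp : p.IsHomogeneous m) :
    (substT c p).IsHomogeneous m := by
  have := hp.aeval (Fin.lastCases (motive := fun _ => MvPolynomial (Fin n) k)
    (C (-(c (Fin.last d, Fin.last n))⁻¹) * linForm k (lastRow (elimT c))) X) (n := 1) ?_
  · rwa [one_mul] at this
  · intro i
    induction i using Fin.lastCases with
    | last =>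
      rw [Fin.lastCases_last]
      exact (linForm_isHomogeneous _).C_mul _
    | cast i =>
      rw [Fin.lastCases_castSucc]
      exact isHomogeneous_X k i

lemma map_substT (m : ℕ) : (homogeneousSubmodule (Fin (n + 1)) k m).map (substT c).toLinearMap =
    homogeneousSubmodule (Fin n) k m := by
  ext r
  rw [Submodule.mem_map]
  constructor
  · rintro ⟨p, hp, rfl⟩
    exact substT_isHomogeneous c hp
  · exact fun hr => ⟨toT k r, toT_isHomogeneous hr, substT_toT c r⟩

lemma linForm_eq_add (v : Fin (n + 1) → k) :
    linForm k v = toT k (linForm k fun i => v i.castSucc) + C (v (Fin.last n)) * Tv k n := by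
  simp [linForm, Fin.sum_univ_castSucc, toT, Tv]

lemma linForm_sub_smul (a b : k) (u v : ι → k) :
    linForm k (fun i => a * u i - b * v i) = C a * linForm k u - C b * linForm k v := by
  simp only [linForm, C_sub, C_mul, sub_mul, Finset.sum_sub_distrib, Finset.mul_sum, mul_assoc]

variable {c}

lemma substT_last (hc : c (Fin.last d, Fin.last n) ≠ 0) :
    substT c (linForm k fun i => c (Fin.last d, i)) = 0 := by
  have h : lastRow (elimT c) = fun i => c (Fin.last d, i.castSucc) := by
    funext i
    simp [lastRow, elimT]
  have h2 : substT c (C (c (Fin.last d, Fin.last n))) = C (c (Fin.last d, Fin.last n)) :=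
    (substT c).commutes _
  rw [linForm_eq_add, map_add, substT_toT, map_mul, substT_Tv, h2, ← mul_assoc, ← C_mul,
    mul_neg, mul_inv_cancel₀ hc, h, C_neg, C_1]
  ring

lemma substT_castSucc (hc : c (Fin.last d, Fin.last n) ≠ 0) (j : Fin d) :
    C (c (Fin.last d, Fin.last n)) * substT c (linForm k fun i => c (j.castSucc, i)) =
      linForm k fun i => initRows (elimT c) (j, i) := by
  have h : lastRow (elimT c) = fun i => c (Fin.last d, i.castSucc) := by
    funext i
    simp [lastRow, elimT]
  have h' : (fun i => initRows (elimT c) (j, i)) = fun i : Fin n =>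
      c (Fin.last d, Fin.last n) * c (j.castSucc, i.castSucc) -
        c (j.castSucc, Fin.last n) * c (Fin.last d, i.castSucc) := by
    funext i
    simp [initRows, elimT]
  have h2 : substT c (C (c (j.castSucc, Fin.last n))) = C (c (j.castSucc, Fin.last n)) :=
    (substT c).commutes _
  have h3 : (C (c (Fin.last d, Fin.last n)) : MvPolynomial (Fin n) k) *
      C (c (Fin.last d, Fin.last n))⁻¹ = 1 := by
    rw [← C_mul, mul_inv_cancel₀ hc, C_1]
  rw [h', linForm_sub_smul, linForm_eq_add, map_add, substT_toT, map_mul, substT_Tv, h2, h, C_neg]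
  linear_combination (-(C (c (j.castSucc, Fin.last n)) *
    linForm k fun i : Fin n => c (Fin.last d, i.castSucc))) * h3

lemma sub_toT_substT_mem {L : Ideal (MvPolynomial (Fin (n + 1)) k)}
    (hc : c (Fin.last d, Fin.last n) ≠ 0)
    (hL : (linForm k fun i => c (Fin.last d, i)) ∈ L) (p : MvPolynomial (Fin (n + 1)) k) :
    p - toT k (substT c p) ∈ L := by
  have : ((Ideal.Quotient.mkₐ k L).comp (toT k)).comp (substT c) = Ideal.Quotient.mkₐ k L := by
    apply MvPolynomial.algHom_ext
    intro i
    induction i using Fin.lastCases with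
    | cast i =>
      have : (X i.castSucc : MvPolynomial (Fin (n + 1)) k) = toT k (X i) := by simp [toT]
      rw [this, AlgHom.comp_apply, substT_toT, AlgHom.comp_apply]
    | last =>
      rw [AlgHom.comp_apply, AlgHom.comp_apply, ← Tv, substT_Tv]
      symm
      refine Ideal.Quotient.eq.2 ?_
      have h : lastRow (elimT c) = fun i => c (Fin.last d, i.castSucc) := by
        funext i
        simp [lastRow, elimT]
      have hC : ∀ a : k, toT k (C a) = (C a : MvPolynomial (Fin (n + 1)) k) := fun a =>
        (toT k).commutes a
      have h3 : (C (c (Fin.last d, Fin.last n)) : MvPolynomial (Fin (n + 1)) k) *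
          C (c (Fin.last d, Fin.last n))⁻¹ = 1 := by
        rw [← C_mul, mul_inv_cancel₀ hc, C_1]
      have e : Tv k n - toT k (C (-(c (Fin.last d, Fin.last n))⁻¹) *
          linForm k (lastRow (elimT c))) =
          C (c (Fin.last d, Fin.last n))⁻¹ * linForm k fun i => c (Fin.last d, i) := by
        rw [h, linForm_eq_add, map_mul, hC, C_neg]
        linear_combination (-(Tv k n)) * h3
      rw [e]
      exact L.mul_mem_left _ hL
  have h := DFunLike.congr_fun this p
  exact Ideal.Quotient.eq.1 h.symm

lemma mem_redIdeal_Jst {D : SC n} {σ : Finset (Fin n)} (hc : c (Fin.last d, Fin.last n) ≠ 0)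
    (p : MvPolynomial (Fin (n + 1)) k) : p ∈ redIdeal k (Jst k D σ) c ↔
      substT c p ∈ Good.aux D σ (elimT c) ⊔ Ideal.span {xFace k σ} := by
  set L := redIdeal k (Jst k D σ) c with hL
  set K := Good.aux D σ (elimT c) ⊔ Ideal.span {xFace k σ} with hK
  have hlin : ∀ j, (linForm k fun i => c (j, i)) ∈ L := linForm_mem_redIdeal _ c
  have hmod := sub_toT_substT_mem hc (hlin (Fin.last d))
  have hI : extI k (srIdeal k D) ≤ L := (le_sup_left.trans le_sup_left).trans le_sup_left
  have hx : toT k (xFace k σ) ∈ L := Ideal.mem_sup_left (Ideal.mem_sup_left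
    (Ideal.mem_sup_right (Ideal.mem_span_singleton_self _)))
  have hT : TmulI k (linkIdeal k D σ) ≤ L := le_sup_right.trans le_sup_left
  have hC : ∀ a : k, toT k (C a) = (C a : MvPolynomial (Fin (n + 1)) k) := fun a =>
    (toT k).commutes a
  have hCC : ∀ a : k, ∀ p, substT c (C a * p) = C a * substT c p := fun a p => by
    rw [map_mul]
    congr 1
    exact (substT c).commutes a
  constructor
  · have hLK : L ≤ K.comap (substT c) := by
      refine sup_le (sup_le (sup_le ?_ ?_) ?_) ?_
      · refine Ideal.map_le_iff_le_comap.2 fun r hr => ?_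
        have : substT c (toT k r) ∈ K := by
          rw [substT_toT]
          exact Ideal.mem_sup_left (Good.redIdeal_le_aux (Ideal.mem_sup_left hr))
        exact this
      · rw [Ideal.span_singleton_le_iff_mem, Ideal.mem_comap, substT_toT]
        exact Ideal.mem_sup_right (Ideal.mem_span_singleton_self _)
      · refine Ideal.span_le.2 ?_
        rintro _ ⟨r, hr, rfl⟩
        have : substT c (Tv k n * toT k r) ∈ K := by
          rw [map_mul, substT_toT, substT_Tv, mul_assoc]
          refine K.mul_mem_left _ (Ideal.mem_sup_left (mem_sumMul.2 ⟨r, hr, ?_⟩))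
          rw [sub_self]
          exact Ideal.zero_mem _
        exact this
      · refine Ideal.span_le.2 ?_
        rintro _ ⟨j, rfl⟩
        have : substT c (linForm k fun i => c (j, i)) ∈ K := by
          induction j using Fin.lastCases with
          | last => rw [substT_last hc]; exact K.zero_mem
          | cast j =>
            have h1 : C (c (Fin.last d, Fin.last n)) *
                substT c (linForm k fun i => c (j.castSucc, i)) ∈ K := by
              rw [substT_castSucc hc]
              exact Ideal.mem_sup_left (Good.redIdeal_le_aux
                (linForm_mem_redIdeal _ (initRows (elimT c)) j))
            have h2 := K.mul_mem_left (C (c (Fin.last d, Fin.last n))⁻¹) h1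
            rwa [← mul_assoc, ← C_mul, inv_mul_cancel₀ hc, C_1, one_mul] at h2
        exact this
    exact fun hp => hLK hp
  · have hKL : K ≤ L.comap (toT k : MvPolynomial (Fin n) k →ₐ[k] _) := by
      refine sup_le (sup_le (sup_le ?_ ?_) ?_) ?_
      · exact fun r hr => hI (Ideal.mem_map_of_mem _ hr)
      · refine Ideal.span_le.2 ?_
        rintro _ ⟨j, rfl⟩
        have : toT k (linForm k fun i => initRows (elimT c) (j, i)) ∈ L := by
          rw [← substT_castSucc hc, ← hCC]
          have h1 := L.mul_mem_left (C (c (Fin.last d, Fin.last n))) (hlin j.castSucc)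
          have h2 := L.sub_mem h1 (hmod (C (c (Fin.last d, Fin.last n)) *
            linForm k fun i => c (j.castSucc, i)))
          rwa [sub_sub_cancel] at h2
        exact this
      · intro r hr
        obtain ⟨b, hb, rfl⟩ := Ideal.mem_span_singleton_mul.1 hr
        have h1 : Tv k n * toT k b ∈ L := hT (Ideal.subset_span ⟨b, hb, rfl⟩)
        have h2 := L.sub_mem h1 (hmod (Tv k n * toT k b))
        rw [sub_sub_cancel, map_mul, substT_toT, substT_Tv, map_mul, map_mul, hC] at h2
        have h3 := L.mul_mem_left (C (-(c (Fin.last d, Fin.last n)))) h2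
        rw [← mul_assoc, ← mul_assoc, ← C_mul, neg_mul_neg, mul_inv_cancel₀ hc, C_1,
          one_mul] at h3
        rw [Ideal.mem_comap, map_mul]
        exact h3
      · rw [Ideal.span_singleton_le_iff_mem]
        exact hx
    intro hp
    have h1 : toT k (substT c p) ∈ L := hKL hp
    have h2 := L.add_mem (hmod p) h1
    rwa [sub_add_cancel] at h2

lemma HFq_redIdeal_Jst {D : SC n} {σ : Finset (Fin n)}
    (hc : c (Fin.last d, Fin.last n) ≠ 0) (m : ℕ) : HFq k (redIdeal k (Jst k D σ) c) m =
      HFq k (Good.aux D σ (elimT c) ⊔ Ideal.span {xFace k σ}) m := by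
  set K := Good.aux D σ (elimT c) ⊔ Ideal.span {xFace k σ} with hK
  rw [← finrank_map_eq_HFq ((Ideal.Quotient.mkₐ k K).toLinearMap ∘ₗ (substT c).toLinearMap),
    Submodule.map_comp, map_substT]
  · rfl
  · intro p
    rw [mem_redIdeal_Jst hc, ← hK]
    exact Ideal.Quotient.eq_zero_iff_mem

end substT

lemma generic_elimT [Infinite k] {d : ℕ} {P : (Fin (d + 1) × Fin n → k) → Prop}
    (h : Generic k (Fin (d + 1) × Fin n) P) :
    Generic k (Fin (d + 1) × Fin (n + 1)) fun c => P (elimT c) := by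
  have heval : ∀ (c : Fin (d + 1) × Fin (n + 1) → k) t,
      eval c (elimT (A := MvPolynomial (Fin (d + 1) × Fin (n + 1)) k) X t) = elimT c t := by
    rintro c ⟨j, i⟩
    induction j using Fin.lastCases with
    | last => simp [elimT]
    | cast j => simp [elimT]
  refine (h.comap (τ' := Fin (d + 1) × Fin (n + 1))
    (elimT (A := MvPolynomial (Fin (d + 1) × Fin (n + 1)) k) X) fun c => ?_).mono fun c hc => ?_
  · refine ⟨fun t => Fin.lastCases (motive := fun _ => k) (if t.1 = Fin.last d then 1 else 0)
      (fun i => c (t.1, i)) t.2, ?_⟩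
    rintro ⟨j, i⟩
    rw [heval]
    induction j using Fin.lastCases with
    | last => simp [elimT]
    | cast j => simp [elimT]
  · simp only [heval] at hc
    exact hc

lemma generic_good [Infinite k] {D : SC n} {σ : Finset (Fin n)} (hσ : σ ∈ D.faces) {d : ℕ}
    (hd : dimP D = d + 1)
    (h : Generic k (Fin (d + 1) × Fin n) fun c => LSOP D (rowSpan c)) :
    Generic k (Fin (d + 1) × Fin n) (Good D σ) := by
  obtain ⟨c₀, h₀⟩ := h.exists
  have hX : Generic k (Fin (d + 1) × Fin n) fun c => ∀ i ∈ σ,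
      Reg (linkIdeal k D σ ⊔ Ideal.span {X i}) (forms (initRows c)) := by
    refine Generic.forall_finset σ fun i hi => ?_
    refine ((h₀.generic_reg_X hσ hi hd).comap (fun t => X (t.1.castSucc, t.2)) fun c => ?_).mono ?_
    · refine ⟨fun t => Fin.lastCases (motive := fun _ => k) 0 (fun j => c (j, t.2)) t.1,
        fun t => ?_⟩
      simp
    · intro c hc
      simp only [eval_X] at hc
      exact hc
  refine (h.and hX).mono fun c hc => ?_
  obtain ⟨hW, hcX⟩ := hc
  have hreg : ∀ F ∈ D.faces, Reg (linkIdeal k D F) (forms c) := by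
    intro F hF
    rw [← map_rows]
    exact hW.reg F hF _ (by rw [length_rows, hd]) (span_rows c)
  refine ⟨?_, hreg σ hσ, hcX⟩
  rw [← linkIdeal_empty]
  exact hreg ∅ (empty_mem_of_mem hσ)

end

section
variable {k}

lemma mk_trunc_eq_iff {D : SC n} {σ : Finset (Fin n)} {q d : ℕ} {c : Fin d × Fin n → k}
    (a a' : MvPolynomial (Fin n) k) (b b' : Fin q → MvPolynomial (Fin n) k) :
    (Ideal.Quotient.mk (IC k D σ q ⊔ xForms k c)
        (toT k a + ∑ i : Fin q, toT k (b i) * Tv k n ^ ((i : ℕ) + 1)) =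
      Ideal.Quotient.mk (IC k D σ q ⊔ xForms k c)
        (toT k a' + ∑ i : Fin q, toT k (b' i) * Tv k n ^ ((i : ℕ) + 1))) ↔
    (Ideal.Quotient.mk (redIdeal k (srIdeal k D) c) a =
        Ideal.Quotient.mk (redIdeal k (srIdeal k D) c) a' ∧
      ∀ i : Fin q,
        Ideal.Quotient.mk (redIdeal k (linkIdeal k D σ) c) (b i) =
          Ideal.Quotient.mk (redIdeal k (linkIdeal k D σ) c) (b' i)) := by
  simp only [Ideal.Quotient.eq]
  rw [mem_IC_sup, map_sub, Polynomial.coeff_sub, (expandT_sum_coeff a b).1,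
    (expandT_sum_coeff a' b').1]
  refine and_congr_right fun _ => forall_congr' fun i => ?_
  rw [Polynomial.coeff_sub, (expandT_sum_coeff a b).2, (expandT_sum_coeff a' b').2]

lemma exists_mk_trunc_eq {D : SC n} {σ : Finset (Fin n)} {q d : ℕ} {c : Fin d × Fin n → k}
    (y : MvPolynomial (Fin (n + 1)) k ⧸ (IC k D σ q ⊔ xForms k c)) :
    ∃ (a : MvPolynomial (Fin n) k) (b : Fin q → MvPolynomial (Fin n) k),
      Ideal.Quotient.mk (IC k D σ q ⊔ xForms k c)
        (toT k a + ∑ i : Fin q, toT k (b i) * Tv k n ^ ((i : ℕ) + 1)) = y := by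
  obtain ⟨p, rfl⟩ := Ideal.Quotient.mk_surjective y
  refine ⟨(expandT p).coeff 0, fun i => (expandT p).coeff (i + 1), Ideal.Quotient.eq.2 ?_⟩
  rw [mem_IC_sup, map_sub, Polynomial.coeff_sub, (expandT_sum_coeff _ _).1, sub_self]
  refine ⟨Ideal.zero_mem _, fun i => ?_⟩
  rw [Polynomial.coeff_sub, (expandT_sum_coeff _ _).2, sub_self]
  exact Ideal.zero_mem _

lemma LSOP.HFq_redIdeal_eq {D : SC n} {d : ℕ} {c c' : Fin d × Fin n → k}
    (hc : LSOP D (rowSpan c)) (hc' : LSOP D (rowSpan c')) {F : Finset (Fin n)} (hF : F ∈ D.faces) :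
    HFq k (redIdeal k (linkIdeal k D F) c) = HFq k (redIdeal k (linkIdeal k D F) c') := by
  rw [redIdeal_eq_idV, redIdeal_eq_idV, hc.HFq_eq hc' hF]

lemma generic_HFq_Jst [Infinite k] {D : SC n} {σ : Finset (Fin n)} (hσ : σ ∈ D.faces) {q : ℕ}
    (hcard : σ.card = q + 1) {d : ℕ} (hd : d = dimP D)
    (h : Generic k (Fin d × Fin n) fun c => LSOP D (rowSpan c)) {c : Fin d × Fin n → k}
    (hc : LSOP D (rowSpan c)) :
    Generic k (Fin d × Fin (n + 1)) fun c' => ∀ m : ℕ,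
      HFq k (redIdeal k (Jst k D σ) c') m = HFq k (IC k D σ q ⊔ xForms k c) m := by
  obtain ⟨d, rfl⟩ : ∃ e, d = e + 1 := by
    refine Nat.exists_eq_succ_of_ne_zero fun h0 => ?_
    have : σ.card ≤ dimP D := Finset.le_sup (f := Finset.card) hσ
    omega
  have h1 := generic_elimT (h.and (generic_good hσ hd.symm h))
  have h2 : Generic k (Fin (d + 1) × Fin (n + 1)) fun c' => c' (Fin.last d, Fin.last n) ≠ 0 :=
    (Generic.ne_zero (X (Fin.last d, Fin.last n)) (X_ne_zero _)).mono fun c' hc' => by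
      rwa [eval_X] at hc'
  refine (h1.and h2).mono fun c' hc' m => ?_
  obtain ⟨⟨hW, hgood⟩, hne⟩ := hc'
  have e1 := congrFun (hW.HFq_redIdeal_eq hc (empty_mem_of_mem hσ)) m
  rw [linkIdeal_empty] at e1
  have e2 := hW.HFq_redIdeal_eq hc hσ
  rw [HFq_redIdeal_Jst hne, hgood.HFq_aux_sup hcard, HFq_IC_sup, e1]
  simp only [HFZ_sub, e2]

lemma qComp_eq_bot_of_HFq_eq_zero {J : Ideal (MvPolynomial ι k)} {m : ℕ} (h : HFq k J m = 0) :
    qComp k J m = ⊥ :=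
  Submodule.finrank_eq_zero.1 h

lemma LSOP.sum_HFZ_eq_zero {D : SC n} {σ : Finset (Fin n)} {q : ℕ}
    (hcard : σ.card = q + 1) {d : ℕ} {c : Fin d × Fin n → k} (hc : LSOP D (rowSpan c)) {m : ℕ}
    (hm : dimP D ≤ m) :
    ∑ i ∈ Finset.Icc 1 q, HFZ k (redIdeal k (linkIdeal k D σ) c) ((m : ℤ) - (i : ℤ)) = 0 := by
  refine Finset.sum_eq_zero fun i hi => ?_
  rw [Finset.mem_Icc] at hi
  rw [HFZ_sub, redIdeal_eq_idV]
  split_ifs with h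
  · exact hc.HFq_eq_zero (by omega)
  · rfl

end

/-- **Lemma (structure of `C`).** The `k`-linear map `A ⊕ B^q → C`,
`([a],[b₁],…,[b_q]) ↦ [a + ∑ bᵢ Tⁱ]`, is well defined and bijective; consequently
`C` is Artinian, `HF(m,C) = HF(m,A) + ∑_{i=1}^q HF(m-i,B)`, `HF(C)` equals the
Hilbert function of a general Artinian reduction of `k[D_σ]`, `C_i = 0` for
`i ≥ d+1` and `C_d` is one-dimensional. -/
theorem structure_of_C (k : Type) [Field k] [Infinite k]
    (n q d : ℕ) (hq : 1 ≤ q)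
    (D : SC n) (hD : gorStar k D)
    (σ : Finset (Fin n)) (hσ : σ ∈ D.faces) (hcard : σ.card = q + 1)
    (hd : d = dimP D) :
    Generic k (Fin d × Fin n) fun c =>
      (∀ (a a' : MvPolynomial (Fin n) k) (b b' : Fin q → MvPolynomial (Fin n) k),
        (Ideal.Quotient.mk (IC k D σ q ⊔ xForms k c)
            (toT k a + ∑ i : Fin q, toT k (b i) * Tv k n ^ ((i : ℕ) + 1)) =
          Ideal.Quotient.mk (IC k D σ q ⊔ xForms k c)
            (toT k a' + ∑ i : Fin q, toT k (b' i) * Tv k n ^ ((i : ℕ) + 1))) ↔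
        (Ideal.Quotient.mk (redIdeal k (srIdeal k D) c) a =
            Ideal.Quotient.mk (redIdeal k (srIdeal k D) c) a' ∧
          ∀ i : Fin q,
            Ideal.Quotient.mk (redIdeal k (linkIdeal k D σ) c) (b i) =
              Ideal.Quotient.mk (redIdeal k (linkIdeal k D σ) c) (b' i))) ∧
      (∀ y : MvPolynomial (Fin (n + 1)) k ⧸ (IC k D σ q ⊔ xForms k c),
        ∃ (a : MvPolynomial (Fin n) k) (b : Fin q → MvPolynomial (Fin n) k),
          Ideal.Quotient.mk (IC k D σ q ⊔ xForms k c)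
            (toT k a + ∑ i : Fin q, toT k (b i) * Tv k n ^ ((i : ℕ) + 1)) = y) ∧
      IsArtinianRing (MvPolynomial (Fin (n + 1)) k ⧸ (IC k D σ q ⊔ xForms k c)) ∧
      (∀ m : ℕ, HFq k (IC k D σ q ⊔ xForms k c) m =
        HFq k (redIdeal k (srIdeal k D) c) m +
          ∑ i ∈ Finset.Icc 1 q,
            HFZ k (redIdeal k (linkIdeal k D σ) c) ((m : ℤ) - (i : ℤ))) ∧
      (Generic k (Fin d × Fin (n + 1)) fun c' => ∀ m : ℕ,
        HFq k (redIdeal k (Jst k D σ) c') m = HFq k (IC k D σ q ⊔ xForms k c) m) ∧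
      (∀ i : ℕ, d + 1 ≤ i → qComp k (IC k D σ q ⊔ xForms k c) i = ⊥) ∧
      Module.finrank k (qComp k (IC k D σ q ⊔ xForms k c) d) = 1 := by
  obtain ⟨-, ⟨⟨-, hdepth⟩, hgor⟩, hcone⟩ := hD
  have h0 := empty_mem_of_mem hσ
  have hlsop : Generic k (Fin d × Fin n) fun c => LSOP D (rowSpan c) := by
    subst hd
    exact generic_lsop h0 hdepth (hgor.mono fun c hc => hc.1)
  have hgor' : Generic k (Fin d × Fin n) fun c => artGor k (redIdeal k (srIdeal k D) c) := by
    subst hd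
    exact hgor
  refine (hlsop.and hgor').mono fun c hc => ?_
  obtain ⟨hW, hG⟩ := hc
  have hzero : ∀ i : ℕ, d + 1 ≤ i → HFq k (IC k D σ q ⊔ xForms k c) i = 0 := by
    intro i hi
    have hA : HFq k (redIdeal k (srIdeal k D) c) i = 0 := by
      rw [redIdeal_eq_idV, ← linkIdeal_empty]
      exact hW.HFq_eq_zero (by rw [Finset.card_empty]; omega)
    rw [HFq_IC_sup, hW.sum_HFZ_eq_zero hcard (by omega), hA]
  refine ⟨mk_trunc_eq_iff, exists_mk_trunc_eq, isArtinianRing_of_HFq_eq_zero (hzero _ le_rfl),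
    HFq_IC_sup D σ q c, generic_HFq_Jst hσ hcard hd hlsop hW,
    fun i hi => qComp_eq_bot_of_HFq_eq_zero (hzero i hi), ?_⟩
  rw [redIdeal_eq_idV] at hG
  have hA : HFq k (redIdeal k (srIdeal k D) c) d = 1 := by
    rw [redIdeal_eq_idV]
    subst hd
    exact hW.HFq_dimP h0 hG hcone
  change HFq k (IC k D σ q ⊔ xForms k c) d = 1
  rw [HFq_IC_sup, hW.sum_HFZ_eq_zero hcard hd.ge, hA]

end SRWLP
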